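/- Let N ≥ 2, 1 < p < N, 0 ≤ s < p, p*(s) = p(N−s)/(N−p), β(s) = ((N−1)p − (p−1)s)/(N−p), R > 0, and V_1(x) = |x|^{−s}(1 − (|x|/R)^{(N−p)/(p−1)})^{−β(s)}. For each λ ∈ (0,∞) the radial function U^λ(r) = λ^{(N−p)/p} [1 + (λr)^{(p−s)/(p−1)} (1 − (r/R)^{(N−p)/(p−1)})^{−(p−s)/(N−p)}]^{−(N−p)/(p−s)}, 0 ≤ r < R, is a minimizer of the quotient (∫_{B_R}|∇u|^p dx)/(∫_{B_R}|u|^{p*(s)} V_1(x) dx)^{p/p*(s)} over nonzero radial u ∈ W_0^{1,p}(B_R), and the value of the quotient at U^λ equals the classical Hardy–Sobolev best constant C_{N,p,s}. -/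

import Mathlib

open MeasureTheory Metric Set Filter

noncomputable section

namespace HS

abbrev Euc (N : ℕ) := EuclideanSpace ℝ (Fin N)

/-- smooth compactly supported test functions in the ball `B_R`. -/
def IsTest (N : ℕ) (R : ℝ) (u : Euc N → ℝ) : Prop :=
  ContDiff ℝ (⊤ : ℕ∞) u ∧ HasCompactSupport u ∧ tsupport u ⊆ ball (0 : Euc N) R

/-- a function is radial if it only depends on the norm. -/
def IsRadial {N : ℕ} (u : Euc N → ℝ) : Prop :=
  ∀ x y : Euc N, ‖x‖ = ‖y‖ → u x = u y

/-- the critical Hardy–Sobolev exponent `p*(s) = p(N-s)/(N-p)`. -/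
def pstar (N : ℕ) (p s : ℝ) : ℝ := p * ((N : ℝ) - s) / ((N : ℝ) - p)

/-- the exponent `β(s) = ((N-1)p - (p-1)s)/(N-p)`. -/
def beta (N : ℕ) (p s : ℝ) : ℝ := (((N : ℝ) - 1) * p - (p - 1) * s) / ((N : ℝ) - p)

/-- the potential `V_a(x) = |x|^{-s} (1 - a (|x|/R)^{(N-p)/(p-1)})^{-β(s)}`. -/
def Va (N : ℕ) (p s R a : ℝ) (x : Euc N) : ℝ :=
  ‖x‖ ^ (-s) * (1 - a * (‖x‖ / R) ^ (((N : ℝ) - p) / (p - 1))) ^ (-(beta N p s))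

/-- the gradient energy `∫_{B_R} |∇u|^p`. -/
def gradEn (N : ℕ) (p R : ℝ) (u : Euc N → ℝ) : ℝ :=
  ∫ x in ball (0 : Euc N) R, ‖fderiv ℝ u x‖ ^ p

/-- the denominator `(∫_{B_R} |u|^{p*(s)} V_a)^{p/p*(s)}`. -/
def denomV (N : ℕ) (p s R a : ℝ) (u : Euc N → ℝ) : ℝ :=
  (∫ x in ball (0 : Euc N) R, |u x| ^ pstar N p s * Va N p s R a x) ^ (p / pstar N p s)

/-- the Rayleigh-type quotient for the improved Hardy–Sobolev inequality. -/
def quotV (N : ℕ) (p s R a : ℝ) (u : Euc N → ℝ) : ℝ :=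
  gradEn N p R u / denomV N p s R a u

/-- `I_a` : the infimum of the quotient over nonzero functions of `W_0^{1,p}(B_R)`
(equivalently, by density, over nonzero test functions). -/
def Ia (N : ℕ) (p s R a : ℝ) : ℝ :=
  sInf (quotV N p s R a '' {u | IsTest N R u ∧ u ≠ 0})

/-- `I_{a,rad}` : the infimum of the quotient over nonzero radial functions. -/
def IaRad (N : ℕ) (p s R a : ℝ) : ℝ :=
  sInf (quotV N p s R a '' {u | IsTest N R u ∧ IsRadial u ∧ u ≠ 0})

/-- the best constant `C_{N,p,s}` in the classical Hardy–Sobolev inequality on `ℝ^N`. -/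
def HSC (N : ℕ) (p s : ℝ) : ℝ :=
  sInf ((fun u : Euc N → ℝ =>
      (∫ x : Euc N, ‖fderiv ℝ u x‖ ^ p) /
        (∫ x : Euc N, |u x| ^ pstar N p s * ‖x‖ ^ (-s)) ^ (p / pstar N p s)) ''
    {u : Euc N → ℝ | ContDiff ℝ (⊤ : ℕ∞) u ∧ HasCompactSupport u ∧ u ≠ 0})

/-- `u ∈ W_0^{1,p}(B_R)` with weak gradient `g` : `u` is a limit, in the `W^{1,p}` sense,
of test functions supported in `B_R`. -/
def MemW (N : ℕ) (p R : ℝ) (u : Euc N → ℝ) (g : Euc N → Euc N) : Prop :=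
  ∃ f : ℕ → Euc N → ℝ,
    (∀ n, IsTest N R (f n)) ∧
    Tendsto (fun n => ∫ x in ball (0 : Euc N) R, ‖gradient (f n) x - g x‖ ^ p)
      atTop (nhds (0 : ℝ)) ∧
    Tendsto (fun n => ∫ x in ball (0 : Euc N) R, |f n x - u x| ^ p) atTop (nhds (0 : ℝ))

/-- the quotient for a Sobolev function `u` with weak gradient `g`. -/
def quotW (N : ℕ) (p s R a : ℝ) (u : Euc N → ℝ) (g : Euc N → Euc N) : ℝ :=
  (∫ x in ball (0 : Euc N) R, ‖g x‖ ^ p) / denomV N p s R a u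

/-- a Sobolev function is nonzero if it is not a.e. zero on the ball. -/
def Nonzero (N : ℕ) (R : ℝ) (u : Euc N → ℝ) : Prop :=
  ¬ (u =ᵐ[volume.restrict (ball (0 : Euc N) R)] (fun _ => (0 : ℝ)))

/-- `I_a` is attained by some nonzero function of `W_0^{1,p}(B_R)`. -/
def Attained (N : ℕ) (p s R a : ℝ) : Prop :=
  ∃ u g, MemW N p R u g ∧ Nonzero N R u ∧ quotW N p s R a u g = Ia N p s R a

end HS

/-- the explicit radial minimizer `U^λ` on `B_R`, extended by `0` outside the ball. -/
def Ulam (N : ℕ) (p s R lam : ℝ) (x : HS.Euc N) : ℝ :=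
  if ‖x‖ < R then
    lam ^ (((N : ℝ) - p) / p) *
      (1 + (lam * ‖x‖) ^ ((p - s) / (p - 1)) *
          (1 - (‖x‖ / R) ^ (((N : ℝ) - p) / (p - 1))) ^ (-((p - s) / ((N : ℝ) - p)))) ^
        (-(((N : ℝ) - p) / (p - s)))
  else 0

section

open scoped ENNReal Pointwise Topology

theorem lintegral_eq_lintegral_measure_ofReal_lt {α : Type*} [MeasurableSpace α] (μ : Measure α)
    [SFinite μ] {f : α → ℝ≥0∞} (hf : Measurable f) :
    ∫⁻ x, f x ∂μ = ∫⁻ t in Ioi (0 : ℝ), μ {x | ENNReal.ofReal t < f x} := by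
  have key : ∀ a : ℝ≥0∞, a = ∫⁻ t in Ioi (0 : ℝ), {t : ℝ | ENNReal.ofReal t < a}.indicator 1 t := by
    intro a
    have hm : MeasurableSet {t : ℝ | ENNReal.ofReal t < a} :=
      measurableSet_lt ENNReal.measurable_ofReal measurable_const
    rw [lintegral_indicator_one hm, Measure.restrict_apply hm]
    rcases eq_or_ne a ∞ with rfl | ha
    · simp
    · have : {t : ℝ | ENNReal.ofReal t < a} ∩ Ioi 0 = Ioo 0 a.toReal := by
        ext t
        simp only [mem_inter_iff, mem_ofPred_eq, mem_Ioi, mem_Ioo]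
        constructor
        · rintro ⟨h, h0⟩
          exact ⟨h0, (ENNReal.ofReal_lt_iff_lt_toReal h0.le ha).1 h⟩
        · rintro ⟨h0, h⟩
          exact ⟨(ENNReal.ofReal_lt_iff_lt_toReal h0.le ha).2 h, h0⟩
      rw [this, Real.volume_Ioo, sub_zero, ENNReal.ofReal_toReal ha]
  have hm : MeasurableSet {z : α × ℝ | ENNReal.ofReal z.2 < f z.1} :=
    measurableSet_lt (ENNReal.measurable_ofReal.comp measurable_snd) (hf.comp measurable_fst)
  have hx : ∀ (t : ℝ) (x : α), {t : ℝ | ENNReal.ofReal t < f x}.indicator (1 : ℝ → ℝ≥0∞) t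
      = {x : α | ENNReal.ofReal t < f x}.indicator (1 : α → ℝ≥0∞) x := by
    intro t x
    simp only [indicator, mem_ofPred_eq, Pi.one_apply]
  have hswap := lintegral_lintegral_swap (μ := μ) (ν := volume.restrict (Ioi (0 : ℝ)))
    (f := fun x t => {x : α | ENNReal.ofReal t < f x}.indicator (1 : α → ℝ≥0∞) x)
    ((measurable_one.indicator hm).aemeasurable)
  calc ∫⁻ x, f x ∂μ
      = _ := lintegral_congr fun x => (key (f x)).trans (lintegral_congr fun t => hx t x)
    _ = _ := hswap
    _ = _ := lintegral_congr fun t => lintegral_indicator_one (measurableSet_lt measurable_const hf)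

theorem Real.volume_add_volume_le_of_isCompact {A B : Set ℝ} (hA : IsCompact A) (hB : IsCompact B)
    (hA' : A.Nonempty) (hB' : B.Nonempty) : volume A + volume B ≤ volume (A + B) := by
  obtain ⟨a, ha, hamax⟩ := hA.exists_isGreatest hA'
  obtain ⟨b, hb, hbmin⟩ := hB.exists_isLeast hB'
  have h1 : (b +ᵥ A) ∪ (a +ᵥ B) ⊆ A + B := by
    rintro x (⟨y, hy, rfl⟩ | ⟨y, hy, rfl⟩)
    · exact ⟨y, hy, b, hb, add_comm _ _⟩
    · exact ⟨a, ha, y, hy, rfl⟩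
  have h2 : (b +ᵥ A) ∩ (a +ᵥ B) ⊆ {a + b} := by
    rintro x ⟨⟨y, hy, rfl⟩, ⟨z, hz, hzy⟩⟩
    have h3 := hamax hy
    have h4 := hbmin hz
    simp only [vadd_eq_add, mem_singleton_iff] at *
    linarith
  have h5 : AEDisjoint volume (b +ᵥ A) (a +ᵥ B) := by
    refine measure_mono_null h2 (by simp)
  calc volume A + volume B = volume (b +ᵥ A) + volume (a +ᵥ B) := by
        rw [measure_vadd, measure_vadd]
    _ = volume ((b +ᵥ A) ∪ (a +ᵥ B)) :=
        (measure_union₀ (hB.vadd a).measurableSet.nullMeasurableSet h5).symm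
    _ ≤ _ := measure_mono h1

theorem Real.volume_add_volume_le {A B C : Set ℝ} (hA : MeasurableSet A) (hB : MeasurableSet B)
    (hA' : A.Nonempty) (hB' : B.Nonempty) (hC : A + B ⊆ C) :
    volume A + volume B ≤ volume C := by
  obtain ⟨a, ha⟩ := hA'
  obtain ⟨b, hb⟩ := hB'
  have hsup : ∀ {S : Set ℝ}, MeasurableSet S →
      volume S = ⨆ K ∈ {K : Set ℝ | K ⊆ S ∧ IsCompact K}, volume K := by
    intro S hS
    rw [hS.measure_eq_iSup_isCompact]
    simp only [mem_ofPred_eq, iSup_and]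
  rw [hsup hA, hsup hB]
  have hne : ∀ S : Set ℝ, {K : Set ℝ | K ⊆ S ∧ IsCompact K}.Nonempty := fun S =>
    ⟨∅, empty_subset _, isCompact_empty⟩
  refine ENNReal.biSup_add_biSup_le (hne A) (hne B) ?_
  rintro K ⟨hK, hKc⟩ L ⟨hL, hLc⟩
  calc volume K + volume L ≤ volume (insert a K) + volume (insert b L) := by
        gcongr <;> exact subset_insert _ _
    _ ≤ volume (insert a K + insert b L) :=
        volume_add_volume_le_of_isCompact (hKc.insert a) (hLc.insert b) (insert_nonempty _ _)
          (insert_nonempty _ _)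
    _ ≤ volume C := measure_mono
        ((add_subset_add (insert_subset ha hK) (insert_subset hb hL)).trans hC)

theorem ENNReal.rpow_mul_rpow_le_add {s t : ℝ} (hs : 0 < s) (ht : 0 < t) (hst : s + t = 1)
    (a b : ℝ≥0∞) : a ^ s * b ^ t ≤ ENNReal.ofReal s * a + ENNReal.ofReal t * b := by
  rcases eq_or_ne a ∞ with rfl | ha
  · simp [ENNReal.mul_top, hs]
  rcases eq_or_ne b ∞ with rfl | hb
  · simp [ENNReal.mul_top, ht]
  lift a to NNReal using ha
  lift b to NNReal using hb
  have := Real.geom_mean_le_arith_mean2_weighted hs.le ht.le a.2 b.2 hst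
  rw [← ENNReal.coe_rpow_of_nonneg _ hs.le, ← ENNReal.coe_rpow_of_nonneg _ ht.le,
    ← ENNReal.ofReal_coe_nnreal, ← ENNReal.ofReal_coe_nnreal, ← ENNReal.ofReal_coe_nnreal (p := a),
    ← ENNReal.ofReal_coe_nnreal (p := b), ← ENNReal.ofReal_mul (by positivity),
    ← ENNReal.ofReal_mul hs.le, ← ENNReal.ofReal_mul ht.le, ← ENNReal.ofReal_add (by positivity)
    (by positivity)]
  exact ENNReal.ofReal_le_ofReal (by simpa using this)

theorem prekopa_leindler_of_iSup_eq_one {l : ℝ} (hl0 : 0 < l) (hl1 : l < 1) {f g h : ℝ → ℝ≥0∞}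
    (hf : Measurable f) (hg : Measurable g) (hh : Measurable h)
    (hf1 : ∀ c < 1, ∃ x, c < f x) (hf2 : ∀ x, f x ≤ 1)
    (hg1 : ∀ c < 1, ∃ x, c < g x) (hg2 : ∀ x, g x ≤ 1)
    (hfgh : ∀ x y, f x ^ (1 - l) * g y ^ l ≤ h ((1 - l) * x + l * y)) :
    (∫⁻ x, f x) ^ (1 - l) * (∫⁻ x, g x) ^ l ≤ ∫⁻ x, h x := by
  have h1l : 0 < 1 - l := by linarith
  have hle : ENNReal.ofReal (1 - l) * (∫⁻ x, f x) + ENNReal.ofReal l * (∫⁻ x, g x) ≤ ∫⁻ x, h x := by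
    rw [lintegral_eq_lintegral_measure_ofReal_lt _ hf, lintegral_eq_lintegral_measure_ofReal_lt _ hg,
      lintegral_eq_lintegral_measure_ofReal_lt _ hh, ← lintegral_const_mul' _ _ ENNReal.ofReal_ne_top,
      ← lintegral_const_mul' _ _ ENNReal.ofReal_ne_top, ← lintegral_add_left']
    · refine lintegral_mono fun t => ?_
      rcases lt_or_ge (ENNReal.ofReal t) 1 with ht | ht
      · have e : ∀ (k : ℝ), 0 < k → ∀ A : Set ℝ,
            ENNReal.ofReal k * volume A = volume (k • A) := by
          intro k hk A
          rw [Measure.addHaar_smul]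
          simp [abs_of_pos hk]
        simp only
        rw [e _ h1l, e _ hl0]
        refine Real.volume_add_volume_le ?_ ?_ ?_ ?_ ?_
        · exact (measurableSet_lt measurable_const hf).const_smul₀ _
        · exact (measurableSet_lt measurable_const hg).const_smul₀ _
        · exact Set.Nonempty.smul_set (hf1 _ ht)
        · exact Set.Nonempty.smul_set (hg1 _ ht)
        · rintro _ ⟨_, ⟨x, hx, rfl⟩, _, ⟨y, hy, rfl⟩, rfl⟩
          refine lt_of_lt_of_le ?_ (hfgh x y)
          simp only [mem_ofPred_eq] at hx hy
          have hx' := ENNReal.rpow_lt_rpow hx h1l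
          have hy' := ENNReal.rpow_lt_rpow hy hl0
          refine lt_of_eq_of_lt ?_ (ENNReal.mul_lt_mul hx' hy')
          rw [← ENNReal.rpow_add_of_nonneg _ _ h1l.le hl0.le]
          simp
      · have e1 : {x | ENNReal.ofReal t < f x} = ∅ := by
          ext x; simpa using (hf2 x).trans ht
        have e2 : {x | ENNReal.ofReal t < g x} = ∅ := by
          ext x; simpa using (hg2 x).trans ht
        simp [e1, e2]
    · refine Measurable.aemeasurable (Measurable.const_mul (Antitone.measurable ?_) _)
      intro s t hst
      refine measure_mono fun x hx => lt_of_le_of_lt (ENNReal.ofReal_le_ofReal hst) hx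
  refine le_trans ?_ hle
  exact ENNReal.rpow_mul_rpow_le_add h1l hl0 (by ring) _ _

theorem prekopa_leindler_of_iSup {l : ℝ} (hl0 : 0 < l) (hl1 : l < 1) {f g h : ℝ → ℝ≥0∞}
    (hf : Measurable f) (hg : Measurable g) (hh : Measurable h)
    (hf0 : ⨆ x, f x ≠ 0) (hft : ⨆ x, f x ≠ ∞) (hg0 : ⨆ x, g x ≠ 0) (hgt : ⨆ x, g x ≠ ∞)
    (hfgh : ∀ x y, f x ^ (1 - l) * g y ^ l ≤ h ((1 - l) * x + l * y)) :
    (∫⁻ x, f x) ^ (1 - l) * (∫⁻ x, g x) ^ l ≤ ∫⁻ x, h x := by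
  have h1l : 0 < 1 - l := by linarith
  have norm1 : ∀ {f : ℝ → ℝ≥0∞}, ⨆ x, f x ≠ 0 → ⨆ x, f x ≠ ∞ →
      (∀ c < 1, ∃ x, c < (⨆ x, f x)⁻¹ * f x) ∧ ∀ x, (⨆ x, f x)⁻¹ * f x ≤ 1 := by
    intro f h0 ht
    constructor
    · intro c hc
      have : c * (⨆ x, f x) < ⨆ x, f x := by
        simpa using ENNReal.mul_lt_mul_left h0 ht hc
      obtain ⟨x, hx⟩ := lt_iSup_iff.1 this
      refine ⟨x, ?_⟩
      rwa [mul_comm, ← div_eq_mul_inv, ENNReal.lt_div_iff_mul_lt (Or.inl h0) (Or.inl ht)]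
    · intro x
      rw [mul_comm, ← div_eq_mul_inv]
      exact ENNReal.div_le_of_le_mul (by simpa using le_iSup f x)
  set a := ⨆ x, f x
  set b := ⨆ x, g x
  have hai : a⁻¹ ≠ ∞ := ENNReal.inv_ne_top.2 hf0
  have hbi : b⁻¹ ≠ ∞ := ENNReal.inv_ne_top.2 hg0
  have hai0 : a⁻¹ ≠ 0 := ENNReal.inv_ne_zero.2 hft
  have hbi0 : b⁻¹ ≠ 0 := ENNReal.inv_ne_zero.2 hgt
  set c := a⁻¹ ^ (1 - l) * b⁻¹ ^ l
  have hct : c ≠ ∞ := ENNReal.mul_ne_top (ENNReal.rpow_ne_top_of_nonneg h1l.le hai)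
    (ENNReal.rpow_ne_top_of_nonneg hl0.le hbi)
  have hc0 : c ≠ 0 := by
    refine mul_ne_zero ?_ ?_
    · exact (ENNReal.rpow_pos hai0.bot_lt hai).ne'
    · exact (ENNReal.rpow_pos hbi0.bot_lt hbi).ne'
  have := prekopa_leindler_of_iSup_eq_one hl0 hl1 (hf.const_mul a⁻¹) (hg.const_mul b⁻¹)
    (hh.const_mul c) (norm1 hf0 hft).1 (norm1 hf0 hft).2
    (norm1 hg0 hgt).1 (norm1 hg0 hgt).2 (fun x y => by
      rw [ENNReal.mul_rpow_of_nonneg _ _ h1l.le, ENNReal.mul_rpow_of_nonneg _ _ hl0.le,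
        mul_mul_mul_comm]
      exact mul_le_mul_right (hfgh x y) _)
  rw [lintegral_const_mul' _ _ hai, lintegral_const_mul' _ _ hbi, lintegral_const_mul' _ _ hct,
    ENNReal.mul_rpow_of_nonneg _ _ h1l.le, ENNReal.mul_rpow_of_nonneg _ _ hl0.le,
    mul_mul_mul_comm] at this
  exact (ENNReal.mul_le_mul_iff_right hc0 hct).1 this

theorem prekopa_leindler_real {l : ℝ} (hl0 : 0 < l) (hl1 : l < 1) {f g h : ℝ → ℝ≥0∞}
    (hf : Measurable f) (hg : Measurable g) (hh : Measurable h)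
    (hfgh : ∀ x y, f x ^ (1 - l) * g y ^ l ≤ h ((1 - l) * x + l * y)) :
    (∫⁻ x, f x) ^ (1 - l) * (∫⁻ x, g x) ^ l ≤ ∫⁻ x, h x := by
  have h1l : 0 < 1 - l := by linarith
  rcases eq_or_ne (∫⁻ x, f x) 0 with hf0 | hf0
  · simp [hf0, h1l]
  rcases eq_or_ne (∫⁻ x, g x) 0 with hg0 | hg0
  · simp [hg0, hl0]
  have hlim : ∀ {f : ℝ → ℝ≥0∞}, Measurable f → ∀ {k : ℝ}, 0 < k →
      Tendsto (fun n : ℕ => (∫⁻ x, min (f x) n) ^ k) atTop (𝓝 ((∫⁻ x, f x) ^ k)) := by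
    intro f hf k hk
    refine (ENNReal.continuous_rpow_const.tendsto _).comp ?_
    refine lintegral_tendsto_of_tendsto_of_monotone (fun n => (hf.min measurable_const).aemeasurable)
      (ae_of_all _ fun x m n hmn => min_le_min le_rfl (by exact_mod_cast hmn))
      (ae_of_all _ fun x => ?_)
    simpa using (tendsto_const_nhds (x := f x)).min ENNReal.tendsto_nat_nhds_top
  have hintegrable : ∀ {f : ℝ → ℝ≥0∞}, ∫⁻ x, f x ≠ 0 → ∀ n : ℕ, n ≠ 0 →
      ⨆ x, min (f x) n ≠ 0 ∧ ⨆ x, min (f x) n ≠ ∞ := by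
    intro f h0 n hn
    constructor
    · obtain ⟨x, hx⟩ : ∃ x, f x ≠ 0 := by
        by_contra! h
        exact h0 (by simp [h])
      refine (lt_of_lt_of_le ?_ (le_iSup (fun x => min (f x) (n : ℝ≥0∞)) x)).ne'
      exact lt_min hx.bot_lt (by exact_mod_cast hn.bot_lt)
    · exact ne_top_of_le_ne_top (ENNReal.natCast_ne_top n) (iSup_le fun x => min_le_right _ _)
  refine le_of_tendsto (ENNReal.Tendsto.mul (hlim hf h1l)
    (Or.inl (by simpa [h1l, h1l.le, h1l.not_gt] using hf0)) (hlim hg hl0)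
    (Or.inl (by simpa [hl0, hl0.le, hl0.not_gt] using hg0))) ?_
  filter_upwards [eventually_ne_atTop 0] with n hn
  refine prekopa_leindler_of_iSup hl0 hl1 (hf.min measurable_const) (hg.min measurable_const) hh
    (hintegrable hf0 n hn).1 (hintegrable hf0 n hn).2 (hintegrable hg0 n hn).1 (hintegrable hg0 n hn).2 fun x y => ?_
  refine le_trans ?_ (hfgh x y)
  gcongr <;> exact min_le_left _ _

/-- The **Prékopa–Leindler inequality** on `Fin n → ℝ`. -/
theorem prekopa_leindler_pi {l : ℝ} (hl0 : 0 < l) (hl1 : l < 1) (n : ℕ)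
    {f g h : (Fin n → ℝ) → ℝ≥0∞} (hf : Measurable f) (hg : Measurable g) (hh : Measurable h)
    (hfgh : ∀ x y, f x ^ (1 - l) * g y ^ l ≤ h ((1 - l) • x + l • y)) :
    (∫⁻ x, f x) ^ (1 - l) * (∫⁻ x, g x) ^ l ≤ ∫⁻ x, h x := by
  induction n with
  | zero =>
    have e : ∀ f : (Fin 0 → ℝ) → ℝ≥0∞, ∫⁻ x, f x = f 0 := by
      intro f
      rw [volume_pi, Measure.pi_of_empty _ 0, lintegral_dirac]
    simpa [e] using hfgh 0 0
  | succ n ih =>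
    let e := MeasurableEquiv.piFinSuccAbove (fun _ : Fin (n + 1) => ℝ) 0
    have he : MeasurePreserving e := volume_preserving_piFinSuccAbove (fun _ : Fin (n + 1) => ℝ) 0
    have hF : ∀ {f : (Fin (n + 1) → ℝ) → ℝ≥0∞}, Measurable f →
        ∫⁻ x, f x = ∫⁻ t, ∫⁻ z, f (e.symm (t, z)) := by
      intro f hf
      rw [← he.symm.lintegral_comp_emb e.symm.measurableEmbedding, Measure.volume_eq_prod,
        lintegral_prod (fun z => f (e.symm z)) (hf.comp e.symm.measurable).aemeasurable]
    have hm : ∀ {f : (Fin (n + 1) → ℝ) → ℝ≥0∞}, Measurable f →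
        Measurable fun t => ∫⁻ z, f (e.symm (t, z)) := fun hf =>
      (hf.comp e.symm.measurable).lintegral_prod_right'
    have he' : ∀ (a b : ℝ) (t₁ t₂ : ℝ) (z₁ z₂ : Fin n → ℝ),
        e.symm (a * t₁ + b * t₂, a • z₁ + b • z₂) = a • e.symm (t₁, z₁) + b • e.symm (t₂, z₂) := by
      intro a b t₁ t₂ z₁ z₂
      have h1 : ∀ t z, e.symm (t, z) = Fin.cons t z := fun t z => by
        simp [e, MeasurableEquiv.piFinSuccAbove, Fin.consEquiv]
      rw [h1, h1, h1]
      ext i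
      refine Fin.cases ?_ (fun j => ?_) i <;> simp
    rw [hF hf, hF hg, hF hh]
    refine prekopa_leindler_real hl0 hl1 (hm hf) (hm hg) (hm hh) fun t₁ t₂ => ?_
    refine ih (hf.comp (e.symm.measurable.comp measurable_prodMk_left))
      (hg.comp (e.symm.measurable.comp measurable_prodMk_left))
      (hh.comp (e.symm.measurable.comp measurable_prodMk_left)) fun z₁ z₂ => ?_
    have := hfgh (e.symm (t₁, z₁)) (e.symm (t₂, z₂))
    rw [← he'] at this
    exact this

theorem prekopa_leindler_euclidean {l : ℝ} (hl0 : 0 < l) (hl1 : l < 1) (n : ℕ)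
    {f g h : EuclideanSpace ℝ (Fin n) → ℝ≥0∞} (hf : Measurable f) (hg : Measurable g)
    (hh : Measurable h) (hfgh : ∀ x y, f x ^ (1 - l) * g y ^ l ≤ h ((1 - l) • x + l • y)) :
    (∫⁻ x, f x) ^ (1 - l) * (∫⁻ x, g x) ^ l ≤ ∫⁻ x, h x := by
  have he := PiLp.volume_preserving_toLp (Fin n)
  have hF : ∀ {f : EuclideanSpace ℝ (Fin n) → ℝ≥0∞}, Measurable f →
        ∫⁻ x, f x = ∫⁻ z, f (WithLp.toLp 2 z) := fun hf => (he.lintegral_comp hf).symm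
  rw [hF hf, hF hg, hF hh]
  exact prekopa_leindler_pi hl0 hl1 n (hf.comp he.measurable) (hg.comp he.measurable)
    (hh.comp he.measurable) fun x y => hfgh _ _

theorem EuclideanSpace.le_volume_thickening {N : ℕ} {A : Set (EuclideanSpace ℝ (Fin N))}
    (hA : MeasurableSet A) (hA' : A.Nonempty) {r ε : ℝ} (hr : 0 ≤ r) (hε : 0 < ε)
    (hAr : volume A = volume (ball (0 : EuclideanSpace ℝ (Fin N)) r)) :
    volume (ball (0 : EuclideanSpace ℝ (Fin N)) (r + ε)) ≤ volume (thickening ε A) := by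
  rcases hr.eq_or_lt with rfl | hr
  · obtain ⟨x, hx⟩ := hA'
    calc volume (ball (0 : EuclideanSpace ℝ (Fin N)) (0 + ε)) = volume (ball x ε) := by
          rw [zero_add, Measure.addHaar_ball_center volume x]
      _ ≤ _ := measure_mono (ball_subset_thickening hx ε)
  set l := ε / (r + ε) with hl
  have hl0 : 0 < l := by positivity
  have h1l : 1 - l = r / (r + ε) := by rw [hl]; field_simp; ring
  have h1l0 : 0 < 1 - l := by rw [h1l]; positivity
  have hT : MeasurableSet (thickening ε A) := isOpen_thickening.measurableSet
  have hb : MeasurableSet (ball (0 : EuclideanSpace ℝ (Fin N)) ε) := measurableSet_ball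
  have hA1 := hA.const_smul₀ (1 - l)⁻¹
  have hB1 := hb.const_smul₀ l⁻¹
  have := prekopa_leindler_euclidean hl0 (by linarith) N
    (measurable_one.indicator hA1) (measurable_one.indicator hB1) (measurable_one.indicator hT)
    (by
      intro x y
      by_cases hx : x ∈ (1 - l)⁻¹ • A
      · by_cases hy : y ∈ l⁻¹ • ball (0 : EuclideanSpace ℝ (Fin N)) ε
        · have : (1 - l) • x + l • y ∈ thickening ε A := by
            rw [mem_inv_smul_set_iff₀ h1l0.ne'] at hx
            rw [mem_inv_smul_set_iff₀ hl0.ne', mem_ball_zero_iff] at hy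
            exact mem_thickening_iff.2 ⟨_, hx, by simpa using hy⟩
          rw [indicator_of_mem hx, indicator_of_mem hy, indicator_of_mem this]
          simp
        · rw [indicator_of_notMem hy, ENNReal.zero_rpow_of_pos hl0, mul_zero]
          exact zero_le
      · rw [indicator_of_notMem hx, ENNReal.zero_rpow_of_pos h1l0, zero_mul]
        exact zero_le)
  rw [lintegral_indicator_one hA1, lintegral_indicator_one hB1, lintegral_indicator_one hT] at this
  refine le_trans (le_of_eq ?_) this
  have e1 : volume ((1 - l)⁻¹ • A) = volume (ball (0 : EuclideanSpace ℝ (Fin N)) (r + ε)) := by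
    rw [Measure.addHaar_smul, hAr, ← Measure.addHaar_smul, _root_.smul_ball (inv_ne_zero h1l0.ne'), smul_zero,
      Real.norm_of_nonneg (by positivity), h1l]
    congr 2
    field_simp
  have e2 : volume (l⁻¹ • ball (0 : EuclideanSpace ℝ (Fin N)) ε) =
      volume (ball (0 : EuclideanSpace ℝ (Fin N)) (r + ε)) := by
    rw [_root_.smul_ball (inv_ne_zero hl0.ne'), smul_zero, Real.norm_of_nonneg (by positivity), hl]
    congr 2
    field_simp
  rw [e1, e2, ← ENNReal.rpow_add_of_nonneg _ _ h1l0.le hl0.le]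
  simp

namespace Rearrangement

/-- The volume of the unit ball. -/
def omega (N : ℕ) : ℝ := (volume (ball (0 : EuclideanSpace ℝ (Fin N)) 1)).toReal

/-- The radius of the ball having the same volume as `A`. -/
def ballRadius {N : ℕ} (A : Set (EuclideanSpace ℝ (Fin N))) : ℝ :=
  ((volume A).toReal / omega N) ^ (1 / (N : ℝ))

theorem omega_pos (N : ℕ) : 0 < omega N :=
  ENNReal.toReal_pos (measure_ball_pos _ _ one_pos).ne' measure_ball_lt_top.ne

theorem ballRadius_nonneg {N : ℕ} (A : Set (EuclideanSpace ℝ (Fin N))) : 0 ≤ ballRadius A :=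
  Real.rpow_nonneg (div_nonneg ENNReal.toReal_nonneg (omega_pos N).le) _

theorem volume_ball_eq {N : ℕ} (hN : N ≠ 0) {r : ℝ} (hr : 0 ≤ r) :
    volume (ball (0 : EuclideanSpace ℝ (Fin N)) r) = ENNReal.ofReal (omega N * r ^ N) := by
  have : Nonempty (Fin N) := ⟨⟨0, Nat.pos_of_ne_zero hN⟩⟩
  rw [Measure.addHaar_ball _ _ hr, finrank_euclideanSpace_fin, mul_comm,
    ENNReal.ofReal_mul (omega_pos N).le, omega, ENNReal.ofReal_toReal measure_ball_lt_top.ne]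

theorem volume_ball_ballRadius {N : ℕ} (hN : N ≠ 0) {A : Set (EuclideanSpace ℝ (Fin N))}
    (hA : volume A ≠ ∞) :
    volume (ball (0 : EuclideanSpace ℝ (Fin N)) (ballRadius A)) = volume A := by
  have hN' : (N : ℝ) ≠ 0 := by exact_mod_cast hN
  rw [volume_ball_eq hN (ballRadius_nonneg A), ballRadius, ← Real.rpow_natCast, ← Real.rpow_mul
    (div_nonneg ENNReal.toReal_nonneg (omega_pos N).le), one_div_mul_cancel hN', Real.rpow_one,
    mul_div_cancel₀ _ (omega_pos N).ne', ENNReal.ofReal_toReal hA]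

theorem ballRadius_mono {N : ℕ} {A B : Set (EuclideanSpace ℝ (Fin N))} (hAB : A ⊆ B)
    (hB : volume B ≠ ∞) : ballRadius A ≤ ballRadius B := by
  unfold ballRadius
  have := omega_pos N
  have := ENNReal.toReal_mono hB (measure_mono hAB)
  gcongr

theorem le_volume_thickening_diff {N : ℕ} (hN : 2 ≤ N) {A : Set (EuclideanSpace ℝ (Fin N))}
    (hA : MeasurableSet A) (hfin : volume A ≠ ∞) {ε : ℝ} (hε : 0 < ε) :
    ENNReal.ofReal (N * omega N * ballRadius A ^ (N - 1)) * ENNReal.ofReal ε ≤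
      volume (thickening ε A \ A) := by
  have hr := ballRadius_nonneg A
  have hω := omega_pos N
  rcases A.eq_empty_or_nonempty with rfl | hne
  · have : ballRadius (∅ : Set (EuclideanSpace ℝ (Fin N))) = 0 := by
      rw [ballRadius, measure_empty, ENNReal.toReal_zero, zero_div, Real.zero_rpow]
      have : N ≠ 0 := by omega
      positivity
    rw [this, zero_pow (by omega)]
    simp
  rw [measure_sdiff (self_subset_thickening hε A) hA.nullMeasurableSet hfin]
  refine le_trans ?_ (tsub_le_tsub_right
    (EuclideanSpace.le_volume_thickening hA hne hr hε
      (volume_ball_ballRadius (by omega) hfin).symm) _)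
  rw [← volume_ball_ballRadius (by omega) hfin, volume_ball_eq (by omega) (by positivity),
    volume_ball_eq (by omega) hr, ← ENNReal.ofReal_sub _ (by positivity),
    ← ENNReal.ofReal_mul (by positivity)]
  refine ENNReal.ofReal_le_ofReal ?_
  have key : ballRadius A ^ N + N * ballRadius A ^ (N - 1) * ε ≤ (ballRadius A + ε) ^ N := by
    obtain ⟨k, rfl⟩ : ∃ k, N = k + 1 := ⟨N - 1, by omega⟩
    generalize ballRadius A = r at hr
    have hB : ∀ m : ℕ, r ^ (m + 1) + ((m + 1 : ℕ) : ℝ) * r ^ m * ε ≤ (r + ε) ^ (m + 1) := by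
      intro m
      induction m with
      | zero => simp
      | succ m ih =>
        rw [pow_succ (r + ε)]
        refine le_trans ?_ (mul_le_mul_of_nonneg_right ih (by positivity))
        have : 0 ≤ ((m + 1 : ℕ) : ℝ) * r ^ m * ε * ε := by positivity
        push_cast at this ⊢
        ring_nf at this ⊢
        linarith
    simpa using hB k
  nlinarith

variable {N : ℕ} {u : EuclideanSpace ℝ (Fin N) → ℝ}

theorem volume_lt_top_of_hasCompactSupport (hu : HasCompactSupport u) {t : ℝ} (ht : 0 ≤ t) :
    volume {x | t < u x} < ∞ := by
  refine lt_of_le_of_lt (measure_mono ?_) hu.isCompact.measure_lt_top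
  intro x hx
  refine subset_tsupport u ?_
  exact (lt_of_le_of_lt ht hx).ne'

theorem perimeter_superlevel_le (hN : 2 ≤ N) (hus : HasCompactSupport u)
    {L : NNReal} (huL : LipschitzWith L u) {g : EuclideanSpace ℝ (Fin N) → ℝ}
    (hg : ∀ᵐ x, ∀ c : ℝ, g x < c → ∀ᶠ ε in 𝓝[>] (0 : ℝ), ∀ y ∈ ball x ε, u y ≤ u x + c * ε)
    {F : Set ℝ} (hF : IsClosed F) :
    ∫⁻ t in F ∩ Ioi 0, ENNReal.ofReal (N * omega N * ballRadius {x | t < u x} ^ (N - 1)) ≤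
      ∫⁻ x in u ⁻¹' F, ENNReal.ofReal (g x) := by
  have huc := huL.continuous
  let ε : ℕ → ℝ := fun k => 1 / ((k : ℝ) + 1)
  have hε : ∀ k, 0 < ε k := fun k => by positivity
  have hε1 : ∀ k, ε k ≤ 1 := fun k => by
    simp only [ε]; rw [div_le_one (by positivity)]; linarith [(Nat.cast_nonneg k : (0 : ℝ) ≤ k)]
  have hεlim : Tendsto ε atTop (𝓝[>] 0) :=
    tendsto_nhdsWithin_iff.2 ⟨tendsto_one_div_add_atTop_nhds_zero_nat, Eventually.of_forall hε⟩
  let S : ℕ → Set (EuclideanSpace ℝ (Fin N) × ℝ) := fun k =>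
    {z | z.2 ∈ F ∩ Ioi 0 ∧ u z.1 ≤ z.2 ∧ z.1 ∈ thickening (ε k) {x | z.2 < u x}}
  have hS : ∀ k, MeasurableSet (S k) := by
    intro k
    refine ((hF.measurableSet.inter measurableSet_Ioi).preimage measurable_snd).inter
      ((measurableSet_le (huc.measurable.comp measurable_fst) measurable_snd).inter ?_)
    refine IsOpen.measurableSet ?_
    have : {z : EuclideanSpace ℝ (Fin N) × ℝ | z.1 ∈ thickening (ε k) {x | z.2 < u x}} =
        ⋃ y, (ball y (ε k)) ×ˢ (Iio (u y)) := by
      ext z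
      simp only [mem_thickening_iff, mem_ofPred_eq, mem_iUnion, mem_prod, mem_ball, mem_Iio]
      exact ⟨fun ⟨y, h1, h2⟩ => ⟨y, h2, h1⟩, fun ⟨y, h1, h2⟩ => ⟨y, h2, h1⟩⟩
    change IsOpen {z : EuclideanSpace ℝ (Fin N) × ℝ | z.1 ∈ thickening (ε k) {x | z.2 < u x}}
    rw [this]
    exact isOpen_iUnion fun y => isOpen_ball.prod isOpen_Iio
  let f : ℕ → EuclideanSpace ℝ (Fin N) → ℝ≥0∞ := fun k x =>
    (ENNReal.ofReal (ε k))⁻¹ * volume (Prod.mk x ⁻¹' S k)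
  have hfm : ∀ k, Measurable (f k) := fun k =>
    (measurable_measure_prodMk_left (hS k)).const_mul _
  -- lower bound of the integrals by the isoperimetric inequality
  have hlow : ∀ k, ∫⁻ t in F ∩ Ioi 0,
      ENNReal.ofReal (N * omega N * ballRadius {x | t < u x} ^ (N - 1)) ≤ ∫⁻ x, f k x := by
    intro k
    have h0 : ENNReal.ofReal (ε k) ≠ 0 := by simpa using hε k
    rw [lintegral_const_mul _ (measurable_measure_prodMk_left (hS k)), ← Measure.prod_apply (hS k),
      Measure.prod_apply_symm (hS k), ← ENNReal.div_eq_inv_mul,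
      ENNReal.le_div_iff_mul_le (Or.inl h0) (Or.inl ENNReal.ofReal_ne_top),
      ← lintegral_mul_const' _ _ ENNReal.ofReal_ne_top]
    rw [← lintegral_indicator (hF.measurableSet.inter measurableSet_Ioi)]
    refine lintegral_mono fun t => ?_
    by_cases ht : t ∈ F ∩ Ioi 0
    · rw [indicator_of_mem ht]
      refine (le_volume_thickening_diff hN (measurableSet_lt measurable_const huc.measurable)
        (volume_lt_top_of_hasCompactSupport hus (le_of_lt ht.2)).ne (hε k)).trans
        (measure_mono ?_)
      rintro x ⟨h1, h2⟩
      exact ⟨ht, not_lt.1 h2, h1⟩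
    · rw [indicator_of_notMem ht]
      exact zero_le
  have hsub : ∀ k x, Prod.mk x ⁻¹' S k ⊆ Ico (u x) (u x + L * ε k) := by
    rintro k x t ⟨ht, h1, h2⟩
    refine ⟨h1, ?_⟩
    obtain ⟨y, hy, hxy⟩ := mem_thickening_iff.1 h2
    have := huL.dist_le_mul y x
    rw [Real.dist_eq, dist_comm] at this
    have h3 := le_abs_self (u y - u x)
    have h4 : (L : ℝ) * dist x y ≤ L * ε k := by gcongr
    have h5 : t < u y := hy
    linarith
  have hdiv : ∀ k (c : ℝ), (ENNReal.ofReal (ε k))⁻¹ * ENNReal.ofReal (c * ε k) = ENNReal.ofReal c := by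
    intro k c
    rw [← ENNReal.ofReal_inv_of_pos (hε k), ← ENNReal.ofReal_mul (inv_nonneg.2 (hε k).le)]
    congr 1
    field_simp [(hε k).ne']
  have hbd : ∀ k, f k ≤ᵐ[volume] (cthickening 1 (tsupport u)).indicator fun _ => ENNReal.ofReal L := by
    intro k
    refine ae_of_all _ fun x => ?_
    by_cases hx : x ∈ cthickening 1 (tsupport u)
    · rw [indicator_of_mem hx, ← hdiv k]
      refine mul_le_mul_right ((measure_mono (hsub k x)).trans ?_) _
      simp
    · have : Prod.mk x ⁻¹' S k = ∅ := by
        rw [eq_empty_iff_forall_notMem]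
        rintro t ⟨ht, h1, h2⟩
        refine hx ?_
        obtain ⟨y, hy, hxy⟩ := mem_thickening_iff.1 h2
        refine mem_cthickening_of_dist_le x y 1 _ (subset_tsupport u ?_) (hxy.le.trans (hε1 k))
        exact (lt_trans ht.2 hy).ne'
      simp [f, this]
  have hfin : ∫⁻ x, (cthickening 1 (tsupport u)).indicator (fun _ => ENNReal.ofReal L) x ≠ ∞ := by
    rw [lintegral_indicator isClosed_cthickening.measurableSet, lintegral_const]
    refine ENNReal.mul_ne_top ENNReal.ofReal_ne_top ?_
    rw [Measure.restrict_apply_univ]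
    exact (hus.isCompact.cthickening).measure_lt_top.ne
  calc _ ≤ limsup (fun k => ∫⁻ x, f k x) atTop :=
        le_limsup_of_le (by isBoundedDefault) fun b hb => by
          obtain ⟨k, hk⟩ := hb.exists
          exact (hlow k).trans hk
    _ ≤ ∫⁻ x, limsup (fun k => f k x) atTop := limsup_lintegral_le _ hfm hbd hfin
    _ ≤ ∫⁻ x, (u ⁻¹' F).indicator (fun x => ENNReal.ofReal (g x)) x := by
        refine lintegral_mono_ae ?_
        filter_upwards [hg] with x hx
        by_cases hxF : u x ∈ F
        · rw [indicator_of_mem (show x ∈ u ⁻¹' F from hxF)]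
          refine le_of_forall_gt_imp_ge_of_dense fun b hb => ?_
          rcases eq_or_ne b ∞ with rfl | hbt
          · exact le_top
          have hgb : g x < b.toReal := by
            by_contra! h
            exact absurd (ENNReal.ofReal_le_ofReal h) (by
              rw [ENNReal.ofReal_toReal hbt]; exact not_le.2 hb)
          refine limsup_le_of_le (by isBoundedDefault) ?_
          filter_upwards [hεlim.eventually (hx _ hgb)] with k hk
          rw [← ENNReal.ofReal_toReal hbt, ← hdiv k]
          refine mul_le_mul_right ((measure_mono (t := Ico (u x) (u x + b.toReal * ε k)) ?_).trans
            (by simp)) _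
          rintro t ⟨-, h1, h2⟩
          obtain ⟨y, hy, hxy⟩ := mem_thickening_iff.1 h2
          exact ⟨h1, lt_of_lt_of_le hy (hk y (by rwa [mem_ball, dist_comm]))⟩
        · rw [indicator_of_notMem (show x ∉ u ⁻¹' F from hxF)]
          refine limsup_le_of_le (by isBoundedDefault) ?_
          obtain ⟨δ, hδ, hball⟩ := Metric.isOpen_iff.1 hF.isOpen_compl (u x) hxF
          have hlim : Tendsto (fun k => (L : ℝ) * ε k) atTop (𝓝 0) := by
            simpa using (tendsto_nhdsWithin_iff.1 hεlim).1.const_mul (L : ℝ)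
          filter_upwards [hlim.eventually (gt_mem_nhds hδ)] with k hk
          have : Prod.mk x ⁻¹' S k = ∅ := by
            rw [eq_empty_iff_forall_notMem]
            intro t ht
            have h1 := hsub k x ht
            refine hball (a := t) ?_ ht.1.1
            rw [mem_ball, Real.dist_eq, abs_lt]
            constructor <;> linarith [h1.1, h1.2]
          simp [f, this]
    _ = _ := lintegral_indicator (hF.preimage huc).measurableSet _

end Rearrangement

namespace Rearrangement

/-- A primitive of a continuous function bounded below by a positive constant is invertible, with
differentiable inverse. -/
theorem exists_inverse_primitive {W : ℝ → ℝ} (hW : Continuous W) {c : ℝ} (hc : 0 < c)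
    (hcW : ∀ y, c ≤ W y) :
    ∃ T : ℝ → ℝ, Continuous T ∧ StrictMono T ∧ (∀ y, T (∫ z in (0 : ℝ)..y, W z) = y) ∧
      ∀ z, HasDerivAt T (W (T z))⁻¹ z := by
  set G : ℝ → ℝ := fun y => ∫ z in (0 : ℝ)..y, W z with hG
  have hintegrable : ∀ a b, IntervalIntegrable W volume a b := fun a b => hW.intervalIntegrable a b
  have hder : ∀ y, HasDerivAt G (W y) y := fun y =>
    intervalIntegral.integral_hasDerivAt_right (hintegrable _ _)
      (hW.stronglyMeasurableAtFilter _ _) hW.continuousAt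
  have hlow : ∀ x y, x ≤ y → c * (y - x) ≤ G y - G x := by
    intro x y hxy
    rw [hG]
    simp only
    rw [intervalIntegral.integral_interval_sub_left (hintegrable _ _) (hintegrable _ _)]
    have := intervalIntegral.integral_mono_on (f := fun _ => c) hxy (by simp) (hintegrable x y)
      (fun z _ => hcW z)
    simpa [mul_comm] using this
  have hmono : StrictMono G := by
    intro x y hxy
    have := hlow x y hxy.le
    have : 0 < c * (y - x) := by have := sub_pos.2 hxy; positivity
    linarith
  have hcont : Continuous G := continuous_iff_continuousAt.2 fun y => (hder y).continuousAt
  have h0 : G 0 = 0 := by simp [hG]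
  have hsurj : Function.Surjective G := by
    refine hcont.surjective ?_ ?_
    · refine tendsto_atTop_mono' (f₁ := fun y => c * y) _ ?_
        (tendsto_id.const_mul_atTop hc)
      filter_upwards [eventually_ge_atTop 0] with y hy
      have := hlow 0 y hy
      simp only [h0, sub_zero] at this
      exact this
    · refine tendsto_atBot_mono' (f₂ := G) (f₁ := fun y => c * y) _ ?_
        (tendsto_id.const_mul_atBot hc)
      filter_upwards [eventually_le_atBot 0] with y hy
      have := hlow y 0 hy
      simp only [h0, zero_sub] at this
      linarith
  let e := hmono.orderIsoOfSurjective G hsurj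
  refine ⟨e.symm, e.symm.continuous, e.symm.strictMono, fun y => e.symm_apply_apply y, fun z => ?_⟩
  refine HasDerivAt.of_local_left_inverse e.symm.continuous.continuousAt (hder _)
    (lt_of_lt_of_le hc (hcW _)).ne' (Eventually.of_forall fun y => ?_)
  exact e.apply_symm_apply y

/-- For a monotone nonnegative function the integral of the derivative is at most the value at the
right endpoint. -/
theorem lintegral_deriv_le_of_monotoneOn {H : ℝ → ℝ} (hH : MonotoneOn H (Ici 0)) (h0 : 0 ≤ H 0)
    {x : ℝ} (hx : 0 ≤ x) :
    ∫⁻ y in Ioo 0 x, ENNReal.ofReal (deriv H y) ≤ ENNReal.ofReal (H x) := by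
  have hH' : MonotoneOn H (uIcc 0 x) := hH.mono (by rw [uIcc_of_le hx]; exact Icc_subset_Ici_self)
  have hintegrable := hH'.intervalIntegrable_deriv
  have hle := hH'.intervalIntegral_deriv_mem_uIcc
  have hHx : H 0 ≤ H x := hH self_mem_Ici hx hx
  rw [uIcc_of_le (sub_nonneg.2 hHx)] at hle
  rw [intervalIntegrable_iff_integrableOn_Ioo_of_le hx] at hintegrable
  rw [← ofReal_integral_eq_lintegral_ofReal hintegrable]
  · refine ENNReal.ofReal_le_ofReal ?_
    rw [← integral_Ioc_eq_integral_Ioo, ← intervalIntegral.integral_of_le hx]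
    linarith [hle.2]
  · refine (ae_restrict_iff' measurableSet_Ioo).2 (ae_of_all _ fun y hy => ?_)
    rw [← derivWithin_of_mem_nhds (Ici_mem_nhds hy.1)]
    exact hH.derivWithin_nonneg

end Rearrangement

namespace Rearrangement

theorem setLIntegral_eq_of_subset {α : Type*} [MeasurableSpace α] {μ : Measure α} {s t : Set α}
    {f : α → ℝ≥0∞} (ht : MeasurableSet t) (hs : MeasurableSet s) (hst : s ⊆ t)
    (h : ∀ x ∈ t \ s, f x = 0) : ∫⁻ x in t, f x ∂μ = ∫⁻ x in s, f x ∂μ := by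
  rw [← lintegral_indicator ht, ← lintegral_indicator hs]
  refine lintegral_congr fun x => ?_
  by_cases hx : x ∈ s
  · rw [indicator_of_mem hx, indicator_of_mem (hst hx)]
  · rw [indicator_of_notMem hx]
    by_cases hx' : x ∈ t
    · rw [indicator_of_mem hx', h x ⟨hx', hx⟩]
    · rw [indicator_of_notMem hx']

/-- The arithmetic-geometric mean step of the mass transport argument. -/
theorem rpow_inv_le_deriv_term {n σ m d : ℝ} (hn : 1 < n) (hσ : 0 < σ) (hm : 0 < m) (hd : 0 ≤ d) :
    d ^ (1 / n) ≤ d * (1 / n) * σ ^ (1 / n - 1) * m ^ (1 - 1 / n) +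
      σ ^ (1 / n) * ((1 - 1 / n) * m ^ (1 - 1 / n - 1)) := by
  have hn0 : 0 < n := by linarith
  have h1 : 1 / n < 1 := by rw [div_lt_one hn0]; exact hn
  have h0 : 0 < 1 / n := by positivity
  have key := Real.geom_mean_le_arith_mean2_weighted (w₁ := 1 / n) (w₂ := 1 - 1 / n)
    (p₁ := d * (σ ^ (1 / n - 1) * m ^ (1 - 1 / n))) (p₂ := σ ^ (1 / n) * m ^ (-(1 / n)))
    h0.le (by linarith) (by positivity) (by positivity) (by ring)
  have e : (d * (σ ^ (1 / n - 1) * m ^ (1 - 1 / n))) ^ (1 / n) *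
      (σ ^ (1 / n) * m ^ (-(1 / n))) ^ (1 - 1 / n) = d ^ (1 / n) := by
    rw [Real.mul_rpow hd (by positivity), Real.mul_rpow (by positivity) (by positivity),
      Real.mul_rpow (by positivity) (by positivity), ← Real.rpow_mul hσ.le, ← Real.rpow_mul hm.le,
      ← Real.rpow_mul hσ.le, ← Real.rpow_mul hm.le]
    have e1 : σ ^ ((1 / n - 1) * (1 / n)) * σ ^ (1 / n * (1 - 1 / n)) = 1 := by
      rw [← Real.rpow_add hσ, show (1 / n - 1) * (1 / n) + 1 / n * (1 - 1 / n) = 0 by ring,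
        Real.rpow_zero]
    have e2 : m ^ ((1 - 1 / n) * (1 / n)) * m ^ (-(1 / n) * (1 - 1 / n)) = 1 := by
      rw [← Real.rpow_add hm, show (1 - 1 / n) * (1 / n) + -(1 / n) * (1 - 1 / n) = 0 by ring,
        Real.rpow_zero]
    linear_combination d ^ (1 / n) * (m ^ ((1 - 1 / n) * (1 / n)) *
      m ^ (-(1 / n) * (1 - 1 / n))) * e1 + d ^ (1 / n) * e2
  rw [e] at key
  rw [show 1 - 1 / n - 1 = -(1 / n) by ring]
  linarith

/-- One-dimensional mass transport of the density `v ^ q` onto the density `W` on `(0, Y)`. -/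
theorem exists_transport {n q γ : ℝ} (hn : 1 < n) (hq : 0 < q) (hγ : 0 < γ)
    (hqγ : q / n + γ = q) {v m W : ℝ → ℝ} (hv : Antitone v) (hv0 : ∀ x, 0 ≤ v x)
    (hvm : ∀ t, 0 ≤ t → ∀ x, 0 ≤ x → (t < v x ↔ x < m t)) (hm0 : 0 < m 0)
    (hWc : ContinuousOn W (Ici 0)) (hWpos : ∀ y, 0 ≤ y → 0 < W y) {Y : ℝ} (hY : 0 < Y)
    {A : ℝ} (hA : A = (∫ y in (0 : ℝ)..Y, W y) / (∫ x in (0 : ℝ)..m 0, v x ^ q)) :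
    0 < A ∧ ∃ S : ℝ → ℝ, Measurable S ∧ (∀ x, 0 ≤ x → 0 ≤ S x) ∧
      (∀ ψ : ℝ → ℝ≥0∞, ∫⁻ x in Ioi 0, ψ (S x) * ENNReal.ofReal (v x ^ q) ≤
        ENNReal.ofReal A⁻¹ * ∫⁻ y in Ioi 0, ψ y * ENNReal.ofReal (W y)) ∧
      ENNReal.ofReal (A ^ (1 / n - 1)) * ∫⁻ y in Ioo 0 Y, ENNReal.ofReal (W y ^ (1 - 1 / n)) ≤
        ENNReal.ofReal γ * ∫⁻ t in Ioi 0,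
          ENNReal.ofReal (S (m t) ^ (1 / n) * m t ^ (1 - 1 / n)) *
            ENNReal.ofReal (t ^ (γ - 1)) := by
  have hn0 : 0 < n := by linarith
  have hn1 : 1 / n < 1 := by rw [div_lt_one hn0]; exact hn
  have hni : 0 < 1 / n := by positivity
  set m0 := m 0 with hm0def
  -- the truncated profile
  let Wt : ℝ → ℝ := fun y => W (max 0 (min y Y))
  have hWtc : Continuous Wt := hWc.comp_continuous (by fun_prop) fun y => mem_Ici.2 (le_max_left _ _)
  have hWt : ∀ y ∈ Icc 0 Y, Wt y = W y := fun y hy => by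
    simp only [Wt]; rw [min_eq_left hy.2, max_eq_right hy.1]
  obtain ⟨c, hc, hcW⟩ : ∃ c, 0 < c ∧ ∀ y, c ≤ Wt y := by
    obtain ⟨z, hz, hmin⟩ := isCompact_Icc.exists_isMinOn (nonempty_Icc.2 hY.le)
      (hWc.mono Icc_subset_Ici_self)
    refine ⟨W z, hWpos z hz.1, fun y => hmin ⟨le_max_left _ _, ?_⟩⟩
    exact max_le hY.le (min_le_right _ _)
  obtain ⟨T, hTc, hTm, hT, hTd⟩ := exists_inverse_primitive hWtc hc hcW
  -- the source density
  let V : ℝ → ℝ := fun x => v x ^ q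
  have hVa : Antitone V := fun x y h => Real.rpow_le_rpow (hv0 y) (hv h) hq.le
  have hV0 : ∀ x, 0 ≤ V x := fun x => Real.rpow_nonneg (hv0 x) _
  have hvpos : ∀ x, 0 ≤ x → x < m0 → 0 < v x := fun x hx h => (hvm 0 le_rfl x hx).2 h
  have hvz : ∀ x, m0 ≤ x → v x = 0 := fun x h => le_antisymm
    (not_lt.1 fun h' => absurd ((hvm 0 le_rfl x (hm0.le.trans h)).1 h') (not_lt.2 h)) (hv0 x)
  have hVint : ∀ a b, IntervalIntegrable V volume a b := fun a b => hVa.intervalIntegrable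
  have hD : 0 < ∫ x in (0 : ℝ)..m0, V x :=
    intervalIntegral.intervalIntegral_pos_of_pos_on (hVint _ _)
      (fun x hx => Real.rpow_pos_of_pos (hvpos x hx.1.le hx.2) _) hm0
  have hWYint : (∫ y in (0 : ℝ)..Y, W y) = ∫ y in (0 : ℝ)..Y, Wt y :=
    intervalIntegral.integral_congr fun y hy => by
      rw [uIcc_of_le hY.le] at hy; exact (hWt y hy).symm
  have hWY : 0 < ∫ y in (0 : ℝ)..Y, W y := by
    rw [hWYint]
    exact intervalIntegral.intervalIntegral_pos_of_pos_on (hWtc.intervalIntegrable _ _)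
      (fun x _ => lt_of_lt_of_le hc (hcW x)) hY
  have hApos : 0 < A := hA ▸ div_pos hWY hD
  let F : ℝ → ℝ := fun x => A * ∫ y in (0 : ℝ)..x, V y
  have hFmono : Monotone F := by
    intro x y hxy
    refine mul_le_mul_of_nonneg_left ?_ hApos.le
    rw [← sub_nonneg, intervalIntegral.integral_interval_sub_left (hVint _ _) (hVint _ _)]
    exact intervalIntegral.integral_nonneg hxy fun z _ => hV0 z
  have hFc : Continuous F := (intervalIntegral.continuous_primitive hVint 0).const_mul A
  let S : ℝ → ℝ := fun x => T (F x)
  have hSm : Monotone S := fun x y h => hTm.monotone (hFmono h)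
  have hSc : Continuous S := hTc.comp hFc
  have hS0 : S 0 = 0 := by
    have := hT 0
    simp only [intervalIntegral.integral_same] at this
    simp [S, F, this]
  have hSY : S m0 = Y := by
    have : F m0 = ∫ y in (0 : ℝ)..Y, Wt y := by
      simp only [F]
      rw [hA, div_mul_cancel₀ _ hD.ne', hWYint]
    simp only [S]
    rw [this, hT]
  have hSstrict : StrictMonoOn S (Icc 0 m0) := by
    intro x hx y hy hxy
    refine hTm (mul_lt_mul_of_pos_left ?_ hApos)
    rw [← sub_pos, intervalIntegral.integral_interval_sub_left (hVint _ _) (hVint _ _)]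
    exact intervalIntegral.intervalIntegral_pos_of_pos_on (hVint _ _)
      (fun z hz => Real.rpow_pos_of_pos (hvpos z (hx.1.trans hz.1.le) (hz.2.trans_le hy.2)) _) hxy
  have hSIoo : ∀ x ∈ Ioo 0 m0, S x ∈ Ioo 0 Y := fun x hx =>
    ⟨hS0 ▸ hSstrict (left_mem_Icc.2 hm0.le) (Ioo_subset_Icc_self hx) hx.1,
      hSY ▸ hSstrict (Ioo_subset_Icc_self hx) (right_mem_Icc.2 hm0.le) hx.2⟩
  -- points of differentiability
  let s : Set ℝ := {x | x ∈ Ioo 0 m0 ∧ ContinuousAt V x}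
  have hcount : {x | ¬ ContinuousAt V x}.Countable := hVa.countable_not_continuousAt
  have hsm : MeasurableSet s :=
    measurableSet_Ioo.inter (hcount.measurableSet.of_compl)
  have hsae : s =ᵐ[volume] Ioo 0 m0 := by
    have : ∀ᵐ x : ℝ, ContinuousAt V x := hcount.ae_notMem volume |>.mono fun x hx => by
      simpa using hx
    filter_upwards [this] with x hx
    exact propext ⟨fun h => h.1, fun h => ⟨h, hx⟩⟩
  have hSd : ∀ x ∈ s, HasDerivAt S (A * V x / W (S x)) x := by
    rintro x ⟨hx, hxc⟩
    have h1 : HasDerivAt F (A * V x) x :=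
      (intervalIntegral.integral_hasDerivAt_right (hVint _ _)
        (hVa.measurable.stronglyMeasurable.stronglyMeasurableAtFilter) hxc).const_mul A
    have h2 := (hTd (F x)).comp x h1
    have h3 := hSIoo x hx
    have h4 : Wt (T (F x)) = W (S x) := hWt _ (Ioo_subset_Icc_self h3)
    rw [h4] at h2
    rwa [inv_mul_eq_div] at h2
  have hSinj : InjOn S s := (hSstrict.mono fun x hx => Ioo_subset_Icc_self hx.1).injOn
  have hsub : ∀ g : ℝ → ℝ≥0∞, ∫⁻ y in S '' s, g y =
      ∫⁻ x in s, ENNReal.ofReal (A * V x / W (S x)) * g (S x) := by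
    intro g
    rw [lintegral_image_eq_lintegral_abs_deriv_mul hsm
      (fun x hx => (hSd x hx).hasDerivWithinAt) hSinj]
    refine setLIntegral_congr_fun hsm fun x hx => ?_
    have := hWpos _ (hSIoo x hx.1).1.le
    have := hV0 x
    rw [abs_of_nonneg (by positivity)]
  refine ⟨hApos, S, hSc.measurable, fun x hx => hS0 ▸ hSm hx, ?_, ?_⟩
  · intro ψ
    calc ∫⁻ x in Ioi 0, ψ (S x) * ENNReal.ofReal (v x ^ q)
        = ∫⁻ x in Ioo 0 m0, ψ (S x) * ENNReal.ofReal (v x ^ q) := by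
          refine setLIntegral_eq_of_subset measurableSet_Ioi
            measurableSet_Ioo Ioo_subset_Ioi_self fun x hx => ?_
          have : m0 ≤ x := not_lt.1 fun h => hx.2 ⟨hx.1, h⟩
          rw [hvz x this, Real.zero_rpow hq.ne']
          simp
      _ = ∫⁻ x in s, ψ (S x) * ENNReal.ofReal (v x ^ q) := (setLIntegral_congr hsae).symm
      _ = ∫⁻ x in s, ENNReal.ofReal A⁻¹ * (ENNReal.ofReal (A * V x / W (S x)) *
            (ψ (S x) * ENNReal.ofReal (W (S x)))) := by
          refine setLIntegral_congr_fun hsm fun x hx => ?_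
          have hw := hWpos _ (hSIoo x hx.1).1.le
          have := hV0 x
          rw [mul_left_comm (ENNReal.ofReal (A * V x / W (S x))), mul_left_comm,
            ← ENNReal.ofReal_mul (by positivity), ← ENNReal.ofReal_mul (by positivity)]
          congr 2
          field_simp
          rfl
      _ = ENNReal.ofReal A⁻¹ * ∫⁻ y in S '' s, ψ y * ENNReal.ofReal (W y) := by
          rw [lintegral_const_mul' _ _ ENNReal.ofReal_ne_top, hsub]
      _ ≤ _ := by
          refine mul_le_mul_right (lintegral_mono_set ?_) _
          rintro _ ⟨x, hx, rfl⟩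
          exact (hSIoo x hx.1).1
  · let H : ℝ → ℝ := fun x => S x ^ (1 / n) * x ^ (1 - 1 / n)
    have hHm : MonotoneOn H (Ici 0) := by
      intro x hx y hy hxy
      have h0 : 0 ≤ S x := hS0 ▸ hSm hx
      have h1 := hSm hxy
      have hx' : (0 : ℝ) ≤ x := hx
      simp only [H]
      have : 0 ≤ 1 - 1 / n := by linarith
      have hy0 := h0.trans h1
      gcongr
    have hH0 : H 0 = 0 := by simp only [H]; rw [Real.zero_rpow (x := 1 - 1 / n) (by linarith), mul_zero]
    have hderiv : ∀ x ∈ s, (A * V x / W (S x)) ^ (1 / n) ≤ deriv H x := by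
      intro x hx
      have hSx := hSIoo x hx.1
      have hw := hWpos _ hSx.1.le
      have hV := hV0 x
      have h1 : HasDerivAt (fun x => S x ^ (1 / n))
          (A * V x / W (S x) * (1 / n) * S x ^ (1 / n - 1)) x :=
        (hSd x hx).rpow_const (Or.inl hSx.1.ne')
      have h2 : HasDerivAt (fun x : ℝ => x ^ (1 - 1 / n)) ((1 - 1 / n) * x ^ (1 - 1 / n - 1)) x :=
        Real.hasDerivAt_rpow_const (Or.inl hx.1.1.ne')
      have h3 := (h1.mul h2).deriv
      have h4 : deriv H x = _ := h3
      rw [h4]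
      exact rpow_inv_le_deriv_term hn hSx.1 hx.1.1 (by positivity)
    let μ : Measure ℝ := (volume.restrict (Ioi 0)).withDensity fun x => ENNReal.ofReal (deriv H x)
    have hdm : Measurable fun x => ENNReal.ofReal (deriv H x) := (measurable_deriv H).ennreal_ofReal
    calc ENNReal.ofReal (A ^ (1 / n - 1)) * ∫⁻ y in Ioo 0 Y, ENNReal.ofReal (W y ^ (1 - 1 / n))
        ≤ ENNReal.ofReal (A ^ (1 / n - 1)) *
            ∫⁻ y in S '' s, ENNReal.ofReal (W y ^ (1 - 1 / n)) := by
          refine mul_le_mul_right (lintegral_mono_set' ?_) _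
          have hc2 : (S '' {x | ¬ ContinuousAt V x}).Countable := hcount.image S
          filter_upwards [hc2.ae_notMem volume] with y hy hyY
          obtain ⟨x, hx, rfl⟩ := intermediate_value_Ioo hm0.le hSc.continuousOn
            (by rw [hS0, hSY]; exact hyY : y ∈ Ioo (S 0) (S m0))
          refine ⟨x, ⟨hx, ?_⟩, rfl⟩
          by_contra hcon
          exact hy ⟨x, hcon, rfl⟩
      _ = ∫⁻ x in s, ENNReal.ofReal (A ^ (1 / n - 1)) * (ENNReal.ofReal (A * V x / W (S x)) *
            ENNReal.ofReal (W (S x) ^ (1 - 1 / n))) := by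
          rw [hsub, lintegral_const_mul' _ _ ENNReal.ofReal_ne_top]
      _ ≤ ∫⁻ x in s, ENNReal.ofReal (deriv H x) * ENNReal.ofReal (v x ^ γ) := by
          refine setLIntegral_mono' hsm fun x hx => ?_
          have hw := hWpos _ (hSIoo x hx.1).1.le
          have hV := hV0 x
          have hvx := hvpos x hx.1.1.le hx.1.2
          rw [← ENNReal.ofReal_mul (by positivity), ← ENNReal.ofReal_mul (by positivity),
            ← ENNReal.ofReal_mul' (by positivity)]
          refine ENNReal.ofReal_le_ofReal ?_
          refine le_trans (le_of_eq ?_) (mul_le_mul_of_nonneg_right (hderiv x hx) (by positivity))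
          rw [Real.div_rpow (by positivity) hw.le, Real.mul_rpow hApos.le hV]
          have e1 : A ^ (1 / n - 1) * A = A ^ (1 / n) := by
            rw [Real.rpow_sub_one hApos.ne', div_mul_cancel₀ _ hApos.ne']
          have e2 : W (S x) ^ (1 - 1 / n) = W (S x) / W (S x) ^ (1 / n) := by
            rw [Real.rpow_sub hw, Real.rpow_one]
          have e3 : V x ^ (1 / n) * v x ^ γ = V x := by
            simp only [V]
            rw [← Real.rpow_mul hvx.le, ← Real.rpow_add hvx]
            congr 1
            rw [mul_one_div]; exact hqγ
          rw [e2, ← e1]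
          nth_rewrite 1 [← e3]
          have : 0 < W (S x) ^ (1 / n) := by positivity
          field_simp
      _ = ∫⁻ x in Ioo 0 m0, ENNReal.ofReal (deriv H x) * ENNReal.ofReal (v x ^ γ) :=
          setLIntegral_congr hsae
      _ ≤ ∫⁻ x in Ioi 0, ENNReal.ofReal (deriv H x) * ENNReal.ofReal (v x ^ γ) :=
          lintegral_mono_set Ioo_subset_Ioi_self
      _ = ∫⁻ x, ENNReal.ofReal (v x ^ γ) ∂μ := by
          simp only [μ]
          rw [lintegral_withDensity_eq_lintegral_mul _ hdm
            ((hv.measurable.pow_const γ).ennreal_ofReal)]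
          rfl
      _ = ENNReal.ofReal γ * ∫⁻ t in Ioi 0, μ {x | t < v x} * ENNReal.ofReal (t ^ (γ - 1)) :=
          lintegral_rpow_eq_lintegral_meas_lt_mul μ (ae_of_all _ hv0) hv.measurable.aemeasurable hγ
      _ ≤ _ := by
          refine mul_le_mul_right (setLIntegral_mono' measurableSet_Ioi fun t ht => ?_) _
          refine mul_le_mul_left ?_ _
          have hms : MeasurableSet {x | t < v x} := measurableSet_lt measurable_const hv.measurable
          have hset : {x | t < v x} ∩ Ioi 0 = Ioo 0 (m t) := by
            ext x
            simp only [mem_inter_iff, mem_ofPred_eq, mem_Ioi, mem_Ioo]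
            constructor
            · rintro ⟨h1, h2⟩; exact ⟨h2, (hvm t (le_of_lt ht) x h2.le).1 h1⟩
            · rintro ⟨h1, h2⟩; exact ⟨(hvm t (le_of_lt ht) x h1.le).2 h2, h1⟩
          simp only [μ]
          rw [withDensity_apply _ hms, Measure.restrict_restrict hms, hset]
          rcases le_or_gt 0 (m t) with h | h
          · exact lintegral_deriv_le_of_monotoneOn hHm hH0.ge h
          · rw [Ioo_eq_empty (not_lt.2 h.le)]
            simp

end Rearrangement

namespace Rearrangement

/-- Integration of radial functions in polar coordinates. -/
theorem lintegral_fun_norm {N : ℕ} (hN : N ≠ 0) {ψ : ℝ → ℝ≥0∞} (hψ : Measurable ψ) :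
    ∫⁻ x : EuclideanSpace ℝ (Fin N), ψ ‖x‖ =
      ENNReal.ofReal (N * omega N) * ∫⁻ r in Ioi 0, ENNReal.ofReal (r ^ (N - 1)) * ψ r := by
  have : Nonempty (Fin N) := ⟨⟨0, Nat.pos_of_ne_zero hN⟩⟩
  set μ : Measure (EuclideanSpace ℝ (Fin N)) := volume with hμ
  have hmp := μ.measurePreserving_homeomorphUnitSphereProd
  rw [finrank_euclideanSpace_fin] at hmp
  have hm2 : Measurable fun z : sphere (0 : EuclideanSpace ℝ (Fin N)) 1 × Ioi (0 : ℝ) =>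
      ψ (z.2 : ℝ) := hψ.comp (measurable_subtype_coe.comp measurable_snd)
  calc ∫⁻ x, ψ ‖x‖ ∂μ = ∫⁻ x in ({0}ᶜ : Set (EuclideanSpace ℝ (Fin N))), ψ ‖x‖ ∂μ := by
        rw [restrict_compl_singleton]
    _ = ∫⁻ x : ({0}ᶜ : Set (EuclideanSpace ℝ (Fin N))), ψ ‖x.1‖ ∂(μ.comap (↑)) :=
        (lintegral_subtype_comap (measurableSet_singleton _).compl fun x => ψ ‖x‖).symm
    _ = ∫⁻ z, ψ (z.2 : ℝ) ∂(μ.toSphere.prod (Measure.volumeIoiPow (N - 1))) := by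
        rw [← hmp.lintegral_comp hm2]
        simp
    _ = ENNReal.ofReal (N * omega N) * ∫⁻ r, ψ (r : ℝ) ∂(Measure.volumeIoiPow (N - 1)) := by
        rw [lintegral_prod _ hm2.aemeasurable]
        simp only
        rw [lintegral_const, Measure.toSphere_apply_univ,
          mul_comm, ENNReal.ofReal_mul (by positivity), finrank_euclideanSpace_fin,
          ENNReal.ofReal_natCast, omega, ENNReal.ofReal_toReal measure_ball_lt_top.ne]
    _ = _ := by
        rw [Measure.volumeIoiPow, lintegral_withDensity_eq_lintegral_mul _ (by fun_prop)
          (g := fun r : Ioi (0 : ℝ) => ψ r) (hψ.comp measurable_subtype_coe)]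
        congr 1
        exact lintegral_subtype_comap measurableSet_Ioi
          fun r : ℝ => ENNReal.ofReal (r ^ (N - 1)) * ψ r

/-- Change of the radial variable in an integral with a radial weight. -/
theorem lintegral_radial_substitution {N : ℕ} (hN : N ≠ 0) {I : Set ℝ} (hI : MeasurableSet I)
    (hI0 : I ⊆ Ioi 0) {f w : ℝ → ℝ} {C : ℝ} (hC : 0 < C) (hf : Measurable f) (hw : Measurable w)
    (hw0 : ∀ r ∈ I, 0 ≤ w r)
    (hder : ∀ r ∈ I, HasDerivAt f (C * (r ^ (N - 1) * w r)) r) (hinj : InjOn f I)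
    {ψ : ℝ → ℝ≥0∞} (hψ : Measurable ψ) :
    ∫⁻ x in {x : EuclideanSpace ℝ (Fin N) | ‖x‖ ∈ I}, ψ (f ‖x‖) * ENNReal.ofReal (w ‖x‖) =
      ENNReal.ofReal (N * omega N / C) * ∫⁻ m in f '' I, ψ m := by
  have hω := omega_pos N
  have hmeas : Measurable (I.indicator fun r => ψ (f r) * ENNReal.ofReal (w r)) :=
    ((hψ.comp hf).mul hw.ennreal_ofReal).indicator hI
  have hset : MeasurableSet {x : EuclideanSpace ℝ (Fin N) | ‖x‖ ∈ I} := measurable_norm hI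
  rw [← lintegral_indicator hset]
  have e1 : ({x : EuclideanSpace ℝ (Fin N) | ‖x‖ ∈ I}.indicator
      fun x => ψ (f ‖x‖) * ENNReal.ofReal (w ‖x‖)) =
      fun x => (I.indicator fun r => ψ (f r) * ENNReal.ofReal (w r)) ‖x‖ := rfl
  rw [e1, lintegral_fun_norm hN hmeas, lintegral_image_eq_lintegral_abs_deriv_mul hI
    (fun r hr => (hder r hr).hasDerivWithinAt) hinj, ← lintegral_const_mul' _ _ ENNReal.ofReal_ne_top,
    ← lintegral_const_mul' _ _ ENNReal.ofReal_ne_top, ← lintegral_indicator measurableSet_Ioi,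
    ← lintegral_indicator hI]
  refine lintegral_congr fun r => ?_
  by_cases hr : r ∈ I
  · have hr0 : 0 < r := hI0 hr
    have := hw0 r hr
    rw [indicator_of_mem (hI0 hr), indicator_of_mem hr, indicator_of_mem hr,
      abs_of_nonneg (by positivity), mul_comm (ψ (f r)), ← mul_assoc, ← mul_assoc, ← mul_assoc,
      ← ENNReal.ofReal_mul (by positivity), ← ENNReal.ofReal_mul (by positivity),
      ← ENNReal.ofReal_mul (by positivity)]
    congr 2
    field_simp
  · rw [indicator_of_notMem hr]
    by_cases hr' : r ∈ Ioi (0 : ℝ)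
    · rw [indicator_of_mem hr', indicator_of_notMem hr]; simp
    · rw [indicator_of_notMem hr']

theorem lintegral_rpow_norm {N : ℕ} (hN : N ≠ 0) {s : ℝ} (hs : s < N) {ψ : ℝ → ℝ≥0∞}
    (hψ : Measurable ψ) :
    ∫⁻ x : EuclideanSpace ℝ (Fin N), ψ (‖x‖ ^ ((N : ℝ) - s)) * ENNReal.ofReal (‖x‖ ^ (-s)) =
      ENNReal.ofReal (N * omega N / (N - s)) * ∫⁻ m in Ioi 0, ψ m := by
  have : Nonempty (Fin N) := ⟨⟨0, Nat.pos_of_ne_zero hN⟩⟩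
  have ha : 0 < (N : ℝ) - s := by linarith
  have himg : (fun r : ℝ => r ^ ((N : ℝ) - s)) '' Ioi 0 = Ioi 0 := by
    ext m
    simp only [mem_image, mem_Ioi]
    constructor
    · rintro ⟨r, hr, rfl⟩; positivity
    · intro hm
      exact ⟨m ^ ((N : ℝ) - s)⁻¹, by positivity, by
        rw [← Real.rpow_mul hm.le, inv_mul_cancel₀ ha.ne', Real.rpow_one]⟩
  have key := lintegral_radial_substitution hN (I := Ioi (0 : ℝ)) measurableSet_Ioi subset_rfl
    (f := fun r => r ^ ((N : ℝ) - s)) (w := fun r => r ^ (-s)) ha (by fun_prop) (by fun_prop)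
    (fun r hr => Real.rpow_nonneg (le_of_lt hr) _) (fun r hr => ?_) ?_ hψ
  · rw [himg] at key
    rw [← key, ← setLIntegral_univ, ← setLIntegral_congr
      (ae_eq_univ.2 (by simp) : ({0}ᶜ : Set (EuclideanSpace ℝ (Fin N))) =ᵐ[volume] univ)]
    congr 2
    ext x
    simp
  · have hr0 : 0 < r := hr
    have := Real.hasDerivAt_rpow_const (x := r) (p := (N : ℝ) - s) (Or.inl hr0.ne')
    convert this using 2
    rw [← Real.rpow_natCast, ← Real.rpow_add hr0, Nat.cast_pred (Nat.pos_of_ne_zero hN)]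
    congr 1; ring
  · exact (Real.strictMonoOn_rpow_Ici_of_exponent_pos ha).injOn.mono Ioi_subset_Ici_self

end Rearrangement

namespace Rearrangement

variable {N : ℕ} {u : EuclideanSpace ℝ (Fin N) → ℝ}

/-- The radius of the ball with the volume of the superlevel set of a nonnegative function. -/
def levelRadius (u : EuclideanSpace ℝ (Fin N) → ℝ) (t : ℝ) : ℝ :=
  ballRadius {x | max t 0 < u x}

theorem levelRadius_nonneg (t : ℝ) : 0 ≤ levelRadius u t := ballRadius_nonneg _

theorem volume_superlevel_lt_top (hu : HasCompactSupport u) (t : ℝ) :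
    volume {x | max t 0 < u x} < ∞ :=
  volume_lt_top_of_hasCompactSupport hu (le_max_right _ _)

theorem levelRadius_antitone (hu : HasCompactSupport u) : Antitone (levelRadius u) := by
  intro t t' h
  refine ballRadius_mono (fun x hx => ?_) (volume_superlevel_lt_top hu t).ne
  exact lt_of_le_of_lt (max_le_max_right 0 h) hx

theorem exists_gt_lt_levelRadius (hN : N ≠ 0) (hu : HasCompactSupport u) {r t : ℝ} (hr : 0 ≤ r)
    (ht : 0 ≤ t) (h : r < levelRadius u t) : ∃ t', t < t' ∧ r < levelRadius u t' := by
  by_contra! hcon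
  have hω := omega_pos N
  have hU : {x | t < u x} = ⋃ k : ℕ, {x | max (t + 1 / ((k : ℝ) + 1)) 0 < u x} := by
    ext x
    simp only [mem_ofPred_eq, mem_iUnion]
    constructor
    · intro hx
      obtain ⟨k, hk⟩ := exists_nat_one_div_lt (sub_pos.2 hx)
      refine ⟨k, max_lt (by linarith) (lt_of_le_of_lt ht hx)⟩
    · rintro ⟨k, hk⟩
      have : (0 : ℝ) < 1 / ((k : ℝ) + 1) := by positivity
      linarith [(max_lt_iff.1 hk).1]
  have hmono : Monotone fun k : ℕ => {x | max (t + 1 / ((k : ℝ) + 1)) 0 < u x} := by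
    intro k l hkl x (hx : max (t + 1 / ((k : ℝ) + 1)) 0 < u x)
    refine lt_of_le_of_lt (max_le_max_right 0 ?_) hx
    have : 1 / ((l : ℝ) + 1) ≤ 1 / ((k : ℝ) + 1) := by gcongr
    linarith
  have h1 : volume {x | t < u x} ≤ ENNReal.ofReal (omega N * r ^ N) := by
    rw [hU, hmono.measure_iUnion]
    refine iSup_le fun k => ?_
    have hk := hcon (t + 1 / ((k : ℝ) + 1)) (by
      have : (0 : ℝ) < 1 / ((k : ℝ) + 1) := by positivity
      linarith)
    rw [← volume_ball_ballRadius hN (volume_superlevel_lt_top hu _).ne,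
      volume_ball_eq hN (ballRadius_nonneg _)]
    refine ENNReal.ofReal_le_ofReal ?_
    have := levelRadius_nonneg (u := u) (t + 1 / ((k : ℝ) + 1))
    exact mul_le_mul_of_nonneg_left (pow_le_pow_left₀ this hk _) hω.le
  have h2 : volume {x | t < u x} = volume {x | max t 0 < u x} := by rw [max_eq_left ht]
  rw [h2, ← volume_ball_ballRadius hN (volume_superlevel_lt_top hu _).ne,
      volume_ball_eq hN (ballRadius_nonneg _), ENNReal.ofReal_le_ofReal_iff (by positivity)] at h1
  exact absurd (le_of_mul_le_mul_left h1 hω) (not_le.2 (pow_lt_pow_left₀ h hr hN))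

theorem exists_levelRadius_eq_zero (hN : N ≠ 0) (hu : HasCompactSupport u) (huc : Continuous u) :
    ∃ M, 0 ≤ M ∧ ∀ t, M ≤ t → levelRadius u t = 0 := by
  obtain ⟨M, hM⟩ := hu.exists_bound_of_continuous huc
  refine ⟨M, (norm_nonneg _).trans (hM 0), fun t ht => ?_⟩
  have : {x | max t 0 < u x} = ∅ := by
    rw [eq_empty_iff_forall_notMem]
    intro x hx
    have h1 := hM x
    have h2 : max t 0 < u x := hx
    rw [Real.norm_eq_abs] at h1
    linarith [le_abs_self (u x), le_max_left t 0]
  rw [levelRadius, this, ballRadius, measure_empty, ENNReal.toReal_zero, zero_div, Real.zero_rpow]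
  simpa using hN

/-- An integrated form of the coarea and isoperimetric inequalities. -/
theorem lintegral_perimeter_mul_le (hN : 2 ≤ N) (hus : HasCompactSupport u)
    {L : NNReal} (huL : LipschitzWith L u) {g : EuclideanSpace ℝ (Fin N) → ℝ} (hgm : Measurable g)
    (hg : ∀ᵐ x, ∀ c : ℝ, g x < c → ∀ᶠ ε in 𝓝[>] (0 : ℝ), ∀ y ∈ ball x ε, u y ≤ u x + c * ε)
    {φ : ℝ → ℝ≥0∞} (hφ : Measurable φ) :
    ∫⁻ t in Ioi 0, ENNReal.ofReal (N * omega N * levelRadius u t ^ (N - 1)) * φ t ≤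
      ∫⁻ x, ENNReal.ofReal (g x) * φ (u x) := by
  have huc := huL.continuous
  have hω := omega_pos N
  let P : ℝ → ℝ≥0∞ := fun t => ENNReal.ofReal (N * omega N * levelRadius u t ^ (N - 1))
  have hPa : Antitone P := by
    intro t t' h
    refine ENNReal.ofReal_le_ofReal ?_
    have := levelRadius_antitone hus h
    have := levelRadius_nonneg (u := u) t'
    gcongr
  let μ : Measure ℝ := (volume.restrict (Ioi 0)).withDensity P
  let ν : Measure ℝ := (volume.withDensity fun x => ENNReal.ofReal (g x)).map u
  have hfin : IsFiniteMeasure μ := by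
    obtain ⟨M, hM, hM0⟩ := exists_levelRadius_eq_zero (by omega) hus huc
    refine ⟨?_⟩
    rw [withDensity_apply _ MeasurableSet.univ, Measure.restrict_univ]
    calc ∫⁻ t in Ioi 0, P t ≤ ∫⁻ t in Ioi 0, (Iio M).indicator (fun _ => P 0) t := by
          refine setLIntegral_mono' measurableSet_Ioi fun t ht => ?_
          by_cases h : t < M
          · rw [indicator_of_mem (mem_Iio.2 h)]
            exact hPa (le_of_lt ht)
          · simp only [P]
            rw [hM0 t (not_lt.1 h), zero_pow (by omega)]
            simp
      _ < ∞ := by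
          rw [lintegral_indicator measurableSet_Iio, lintegral_const,
            Measure.restrict_restrict measurableSet_Iio, Measure.restrict_apply_univ]
          refine ENNReal.mul_lt_top ENNReal.ofReal_lt_top ?_
          rw [inter_comm, Ioi_inter_Iio, Real.volume_Ioo]
          exact ENNReal.ofReal_lt_top
  have hclosed : ∀ F : Set ℝ, IsClosed F → μ F ≤ ν F := by
    intro F hF
    have := perimeter_superlevel_le hN hus huL hg hF
    simp only [μ, ν]
    rw [Measure.map_apply huc.measurable hF.measurableSet,
      withDensity_apply _ (hF.measurableSet.preimage huc.measurable),
      withDensity_apply _ hF.measurableSet, Measure.restrict_restrict hF.measurableSet]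
    refine le_trans (le_of_eq ?_) this
    refine setLIntegral_congr_fun (hF.measurableSet.inter measurableSet_Ioi) fun t ht => ?_
    simp only [P, levelRadius]
    rw [max_eq_left (le_of_lt ht.2)]
  have hle : μ ≤ ν := by
    refine Measure.le_iff.2 fun A hA => ?_
    refine le_of_forall_lt fun r hr => ?_
    obtain ⟨K, hKA, hK, hrK⟩ := hA.exists_lt_isClosed_of_ne_top (measure_ne_top μ A) hr
    exact hrK.trans_le ((hclosed K hK).trans (measure_mono hKA))
  calc ∫⁻ t in Ioi 0, P t * φ t = ∫⁻ t, φ t ∂μ := by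
        rw [lintegral_withDensity_eq_lintegral_mul _ hPa.measurable hφ]; rfl
    _ ≤ ∫⁻ t, φ t ∂ν := lintegral_mono' hle le_rfl
    _ = _ := by
        rw [lintegral_map hφ huc.measurable,
          lintegral_withDensity_eq_lintegral_mul _ hgm.ennreal_ofReal
            (g := fun x => φ (u x)) (hφ.comp huc.measurable)]
        rfl

/-- The decreasing rearrangement, as a function of the `a`-th power of the radius. -/
def profile (u : EuclideanSpace ℝ (Fin N) → ℝ) (a x : ℝ) : ℝ :=
  sSup {t | 0 ≤ t ∧ max x 0 < levelRadius u t ^ a}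

section Profile

variable {a : ℝ}

theorem bddAbove_profile (hN : N ≠ 0) (hu : HasCompactSupport u) (huc : Continuous u) (ha : 0 < a)
    (x : ℝ) : BddAbove {t | 0 ≤ t ∧ max x 0 < levelRadius u t ^ a} := by
  obtain ⟨M, hM, hM0⟩ := exists_levelRadius_eq_zero hN hu huc
  refine ⟨M, fun t ht => ?_⟩
  by_contra! h
  have h2 := ht.2
  rw [hM0 t h.le, Real.zero_rpow ha.ne'] at h2
  exact absurd h2 (not_lt.2 (le_max_right _ _))

theorem profile_nonneg (x : ℝ) : 0 ≤ profile u a x :=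
  Real.sSup_nonneg fun _ ht => ht.1

theorem profile_antitone (hN : N ≠ 0) (hu : HasCompactSupport u) (huc : Continuous u)
    (ha : 0 < a) : Antitone (profile u a) := by
  intro x y hxy
  rcases ({t | 0 ≤ t ∧ max y 0 < levelRadius u t ^ a}).eq_empty_or_nonempty with h | h
  · rw [profile, h, Real.sSup_empty]
    exact profile_nonneg x
  · refine csSup_le_csSup (bddAbove_profile hN hu huc ha x) h fun t ht => ⟨ht.1, ?_⟩
    exact lt_of_le_of_lt (max_le_max_right 0 hxy) ht.2

theorem lt_profile_iff (hN : N ≠ 0) (hu : HasCompactSupport u) (huc : Continuous u)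
    (ha : 0 < a) {t : ℝ} (ht : 0 ≤ t) {x : ℝ} (hx : 0 ≤ x) :
    t < profile u a x ↔ x < levelRadius u t ^ a := by
  constructor
  · intro h
    have hne : ({t | 0 ≤ t ∧ max x 0 < levelRadius u t ^ a}).Nonempty := by
      by_contra hcon
      rw [not_nonempty_iff_eq_empty] at hcon
      rw [profile, hcon, Real.sSup_empty] at h
      linarith
    obtain ⟨t', ⟨h1, h2⟩, h3⟩ := exists_lt_of_lt_csSup hne h
    rw [max_eq_left hx] at h2
    exact h2.trans_le
      (Real.rpow_le_rpow (levelRadius_nonneg _) (levelRadius_antitone hu h3.le) ha.le)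
  · intro h
    have hr : x ^ a⁻¹ < levelRadius u t := by
      rwa [Real.rpow_inv_lt_iff_of_pos hx (levelRadius_nonneg _) ha]
    obtain ⟨t', h1, h2⟩ := exists_gt_lt_levelRadius hN hu (Real.rpow_nonneg hx _) ht hr
    rw [Real.rpow_inv_lt_iff_of_pos hx (levelRadius_nonneg _) ha] at h2
    exact h1.trans_le (le_csSup (bddAbove_profile hN hu huc ha x)
      ⟨ht.trans h1.le, by rwa [max_eq_left hx]⟩)

theorem superlevel_profile_norm (hN : N ≠ 0) (hu : HasCompactSupport u) (huc : Continuous u)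
    (ha : 0 < a) (t : ℝ) :
    {x : EuclideanSpace ℝ (Fin N) | max t 0 < profile u a (‖x‖ ^ a)} =
      ball 0 (levelRadius u t) := by
  ext x
  rw [mem_ofPred_eq, lt_profile_iff hN hu huc ha (le_max_right _ _)
    (Real.rpow_nonneg (norm_nonneg _) _), mem_ball_zero_iff,
    Real.rpow_lt_rpow_iff (norm_nonneg _) (levelRadius_nonneg _) ha]
  simp [levelRadius]

/-- Equimeasurability of a nonnegative function and its rearrangement. -/
theorem map_restrict_eq_map_profile (hN : N ≠ 0) (hu : HasCompactSupport u) (huc : Continuous u)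
    (ha : 0 < a) :
    (volume.restrict {x | 0 < u x}).map u =
      (volume.restrict {x : EuclideanSpace ℝ (Fin N) | 0 < profile u a (‖x‖ ^ a)}).map
        fun x => profile u a (‖x‖ ^ a) := by
  have hvm : Measurable fun x : EuclideanSpace ℝ (Fin N) => profile u a (‖x‖ ^ a) :=
    (profile_antitone hN hu huc ha).measurable.comp (measurable_norm.pow_const a)
  have h1 : ∀ t, (volume.restrict {x | 0 < u x}).map u (Ioi t) =
      volume (ball (0 : EuclideanSpace ℝ (Fin N)) (levelRadius u t)) := by
    intro t
    rw [Measure.map_apply huc.measurable measurableSet_Ioi,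
      Measure.restrict_apply (measurableSet_Ioi.preimage huc.measurable), levelRadius,
      volume_ball_ballRadius hN (volume_superlevel_lt_top hu _).ne]
    congr 1
    ext x
    simp
  have h2 : ∀ t, (volume.restrict {x : EuclideanSpace ℝ (Fin N) |
      0 < profile u a (‖x‖ ^ a)}).map (fun x => profile u a (‖x‖ ^ a)) (Ioi t) =
      volume (ball (0 : EuclideanSpace ℝ (Fin N)) (levelRadius u t)) := by
    intro t
    rw [Measure.map_apply hvm measurableSet_Ioi,
      Measure.restrict_apply (measurableSet_Ioi.preimage hvm),
      ← superlevel_profile_norm hN hu huc ha]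
    congr 1
    ext x
    simp
  have : IsFiniteMeasure (volume.restrict {x | 0 < u x}) :=
    ⟨by simpa using volume_lt_top_of_hasCompactSupport hu le_rfl⟩
  set κ := (volume.restrict {x | 0 < u x}).map u with hκ
  set κ' := (volume.restrict {x : EuclideanSpace ℝ (Fin N) | 0 < profile u a (‖x‖ ^ a)}).map
        fun x => profile u a (‖x‖ ^ a) with hκ'
  have huniv : κ univ = κ' univ := by
    have e : ∀ t : ℝ, (univ : Set ℝ) = Iic t ∪ Ioi t := fun t => Iic_union_Ioi.symm
    have e1 : κ univ = κ (Ioi (-1)) := by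
      rw [hκ, Measure.map_apply huc.measurable MeasurableSet.univ,
        Measure.map_apply huc.measurable measurableSet_Ioi,
        Measure.restrict_apply' (measurableSet_lt measurable_const huc.measurable),
        Measure.restrict_apply' (measurableSet_lt measurable_const huc.measurable)]
      congr 1
      ext x
      simp only [preimage_univ, univ_inter, mem_ofPred_eq, mem_inter_iff, mem_preimage, mem_Ioi]
      constructor
      · intro h; exact ⟨by linarith, h⟩
      · exact fun h => h.2
    have e2 : κ' univ = κ' (Ioi (-1)) := by
      rw [hκ', Measure.map_apply hvm MeasurableSet.univ,
        Measure.map_apply hvm measurableSet_Ioi,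
        Measure.restrict_apply' (measurableSet_lt measurable_const hvm),
        Measure.restrict_apply' (measurableSet_lt measurable_const hvm)]
      congr 1
      ext x
      simp only [preimage_univ, univ_inter, mem_ofPred_eq, mem_inter_iff, mem_preimage, mem_Ioi]
      constructor
      · intro h; exact ⟨by linarith, h⟩
      · exact fun h => h.2
    rw [e1, e2, h1, h2]
  have hfin' : IsFiniteMeasure κ' := ⟨by rw [← huniv]; exact measure_lt_top κ univ⟩
  refine Measure.ext_of_Iic _ _ fun t => ?_
  rw [← compl_Ioi, measure_compl measurableSet_Ioi (measure_ne_top _ _),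
    measure_compl measurableSet_Ioi (measure_ne_top _ _), h1, h2, huniv]

theorem levelRadius_profile_of_volume_eq_zero (hN : N ≠ 0) (hu : HasCompactSupport u)
    (huc : Continuous u) (ha : 0 < a) {x : EuclideanSpace ℝ (Fin N)}
    (hx : 0 < profile u a (‖x‖ ^ a)) (h0 : volume {y | u y = profile u a (‖x‖ ^ a)} = 0) :
    levelRadius u (profile u a (‖x‖ ^ a)) = ‖x‖ := by
  have hvm : Measurable fun x : EuclideanSpace ℝ (Fin N) => profile u a (‖x‖ ^ a) :=
    (profile_antitone hN hu huc ha).measurable.comp (measurable_norm.pow_const a)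
  set t := profile u a (‖x‖ ^ a) with ht
  have hxa : 0 ≤ ‖x‖ ^ a := Real.rpow_nonneg (norm_nonneg _) _
  refine le_antisymm ?_ ?_
  · by_contra! h
    have := (lt_profile_iff hN hu huc ha hx.le hxa).2 (Real.rpow_lt_rpow (norm_nonneg _) h ha)
    exact lt_irrefl _ this
  · have hnull : volume {y : EuclideanSpace ℝ (Fin N) | profile u a (‖y‖ ^ a) = t} = 0 := by
      have := congrArg (fun κ => κ {t}) (map_restrict_eq_map_profile hN hu huc ha)
      rw [Measure.map_apply huc.measurable (measurableSet_singleton t),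
        Measure.map_apply hvm (measurableSet_singleton t),
        Measure.restrict_apply (huc.measurable (measurableSet_singleton t)),
        Measure.restrict_apply (hvm (measurableSet_singleton t))] at this
      have e1 : u ⁻¹' {t} ∩ {x | 0 < u x} ⊆ {y | u y = t} := fun y hy => hy.1
      have e2 : {y : EuclideanSpace ℝ (Fin N) | profile u a (‖y‖ ^ a) = t} ⊆
          (fun x => profile u a (‖x‖ ^ a)) ⁻¹' {t} ∩ {x | 0 < profile u a (‖x‖ ^ a)} := by
        intro y hy
        refine ⟨hy, ?_⟩
        have h : profile u a (‖y‖ ^ a) = t := hy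
        rw [mem_ofPred_eq, h]
        exact hx
      exact measure_mono_null e2 (this ▸ measure_mono_null e1 h0)
    have hsub : ball (0 : EuclideanSpace ℝ (Fin N)) ‖x‖ ⊆
        ball 0 (levelRadius u t) ∪ {y | profile u a (‖y‖ ^ a) = t} := by
      intro y hy
      rw [mem_ball_zero_iff] at hy
      rcases lt_or_ge ‖y‖ (levelRadius u t) with h | h
      · left; simpa using h
      · right
        refine le_antisymm (not_lt.1 fun hcon => ?_) ?_
        · have := (lt_profile_iff hN hu huc ha hx.le
            (Real.rpow_nonneg (norm_nonneg y) a)).1 hcon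
          rw [Real.rpow_lt_rpow_iff (norm_nonneg _) (levelRadius_nonneg _) ha] at this
          linarith
        · exact profile_antitone hN hu huc ha (Real.rpow_le_rpow (norm_nonneg _) hy.le ha.le)
    have hle := (measure_mono hsub).trans (measure_union_le (μ := volume) _ _)
    rw [hnull, add_zero, volume_ball_eq hN (norm_nonneg _), volume_ball_eq hN (levelRadius_nonneg _),
      ENNReal.ofReal_le_ofReal_iff (mul_nonneg (omega_pos N).le
        (pow_nonneg (levelRadius_nonneg _) _))] at hle
    exact le_of_pow_le_pow_left₀ hN (levelRadius_nonneg _)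
      (le_of_mul_le_mul_left hle (omega_pos N))

/-- Composition with a function of the level that vanishes on the levels with positive volume. -/
theorem lintegral_comp_le_profile (hN : N ≠ 0) (hu : HasCompactSupport u) (huc : Continuous u)
    (ha : 0 < a) {ψ : ℝ → ℝ≥0∞} (hψm : Measurable ψ) (hψ0 : ∀ t, t ≤ 0 → ψ t = 0)
    (hψP : ∀ t, volume {x | u x = t} ≠ 0 → ψ t = 0) {Ψ : EuclideanSpace ℝ (Fin N) → ℝ≥0∞}
    (hΨ : ∀ x t, 0 < t → profile u a (‖x‖ ^ a) = t → levelRadius u t = ‖x‖ → ψ t ≤ Ψ x) :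
    ∫⁻ x, ψ (u x) ≤ ∫⁻ x, Ψ x := by
  have hvm : Measurable fun x : EuclideanSpace ℝ (Fin N) => profile u a (‖x‖ ^ a) :=
    (profile_antitone hN hu huc ha).measurable.comp (measurable_norm.pow_const a)
  have e1 : ∫⁻ x, ψ (u x) = ∫⁻ t, ψ t ∂((volume.restrict {x | 0 < u x}).map u) := by
    rw [lintegral_map hψm huc.measurable, ← lintegral_indicator
      (measurableSet_lt measurable_const huc.measurable)]
    refine lintegral_congr fun x => ?_
    by_cases hx : 0 < u x
    · rw [indicator_of_mem (by exact hx)]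
    · rw [indicator_of_notMem (by exact hx), hψ0 _ (not_lt.1 hx)]
  rw [e1, map_restrict_eq_map_profile hN hu huc ha, lintegral_map hψm hvm]
  refine (setLIntegral_mono' (measurableSet_lt measurable_const hvm) fun x hx => ?_).trans
    (setLIntegral_le_lintegral _ _)
  by_cases h0 : volume {y | u y = profile u a (‖x‖ ^ a)} = 0
  · exact hΨ x _ hx rfl (levelRadius_profile_of_volume_eq_zero hN hu huc ha hx h0)
  · rw [hψP _ h0]
    exact zero_le

end Profile

end Rearrangement

namespace Rearrangement

variable {N : ℕ} {u : EuclideanSpace ℝ (Fin N) → ℝ}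

/-- Among the sets of given volume, balls have the largest integral of `‖x‖ ^ (-s)`. -/
theorem setLIntegral_rpow_norm_le (hN : N ≠ 0) {s : ℝ} (hs : 0 ≤ s)
    {S : Set (EuclideanSpace ℝ (Fin N))} (hS : MeasurableSet S) (hfin : volume S ≠ ∞) :
    ∫⁻ x in S, ENNReal.ofReal (‖x‖ ^ (-s)) ≤
      ∫⁻ x in ball (0 : EuclideanSpace ℝ (Fin N)) (ballRadius S), ENNReal.ofReal (‖x‖ ^ (-s)) := by
  have hvol := volume_ball_ballRadius hN hfin
  have : Nonempty (Fin N) := ⟨⟨0, Nat.pos_of_ne_zero hN⟩⟩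
  rcases (ballRadius_nonneg S).eq_or_lt with h0 | hr
  · rw [← h0, ball_zero, measure_empty] at hvol
    rw [Measure.restrict_eq_zero.2 hvol.symm]
    simp
  set r := ballRadius S
  set B := ball (0 : EuclideanSpace ℝ (Fin N)) r
  have hB : MeasurableSet B := measurableSet_ball
  have hd : volume (S \ B) = volume (B \ S) := by
    have h1 := measure_sdiff_add_inter (μ := volume) S hB
    have h2 := measure_sdiff_add_inter (μ := volume) B hS
    rw [inter_comm] at h2
    have h3 : volume (S ∩ B) ≠ ∞ := measure_ne_top_of_subset inter_subset_left hfin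
    rw [← h1, ← h2] at hvol
    exact (ENNReal.add_left_inj h3).1 hvol.symm
  rw [← lintegral_inter_add_sdiff _ S hB, ← lintegral_inter_add_sdiff _ B hS, inter_comm B S]
  refine add_le_add le_rfl ?_
  calc ∫⁻ x in S \ B, ENNReal.ofReal (‖x‖ ^ (-s))
      ≤ ∫⁻ _ in S \ B, ENNReal.ofReal (r ^ (-s)) := by
        refine setLIntegral_mono' (hS.diff hB) fun x hx => ENNReal.ofReal_le_ofReal ?_
        have : r ≤ ‖x‖ := by simpa [B] using hx.2
        exact Real.rpow_le_rpow_of_nonpos hr this (by linarith)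
    _ = ∫⁻ _ in B \ S, ENNReal.ofReal (r ^ (-s)) := by
        rw [lintegral_const, lintegral_const, Measure.restrict_apply_univ,
          Measure.restrict_apply_univ, hd]
    _ ≤ ∫⁻ x in B \ S, ENNReal.ofReal (‖x‖ ^ (-s)) := by
        refine setLIntegral_mono_ae' (hB.diff hS) ?_
        have hne : ∀ᵐ x : EuclideanSpace ℝ (Fin N), x ≠ 0 := by
          simp [ae_iff]
        filter_upwards [hne] with x hx0 hx
        have h1 : ‖x‖ < r := by simpa [B] using hx.1
        exact ENNReal.ofReal_le_ofReal
          (Real.rpow_le_rpow_of_nonpos (norm_pos_iff.2 hx0) h1.le (by linarith))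

theorem setLIntegral_ball_rpow_norm (hN : N ≠ 0) {s : ℝ} (hs : s < N) {r : ℝ} (hr : 0 ≤ r) :
    ∫⁻ x in ball (0 : EuclideanSpace ℝ (Fin N)) r, ENNReal.ofReal (‖x‖ ^ (-s)) =
      ENNReal.ofReal (N * omega N / (N - s)) * ENNReal.ofReal (r ^ ((N : ℝ) - s)) := by
  have ha : 0 < (N : ℝ) - s := by linarith
  have key := lintegral_rpow_norm hN hs (ψ := (Iio (r ^ ((N : ℝ) - s))).indicator 1)
    (measurable_one.indicator measurableSet_Iio)
  rw [lintegral_indicator_one measurableSet_Iio, Measure.restrict_apply measurableSet_Iio,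
    inter_comm, Ioi_inter_Iio, Real.volume_Ioo, sub_zero] at key
  rw [← key, ← lintegral_indicator measurableSet_ball]
  refine lintegral_congr fun x => ?_
  by_cases hx : ‖x‖ < r
  · rw [indicator_of_mem (by simpa using hx), indicator_of_mem
      (mem_Iio.2 (Real.rpow_lt_rpow (norm_nonneg _) hx ha)), Pi.one_apply, one_mul]
  · rw [indicator_of_notMem (by simpa using hx), indicator_of_notMem, zero_mul]
    exact fun h => hx ((Real.rpow_lt_rpow_iff (norm_nonneg _) hr ha).1 h)

/-- The Hardy–Littlewood inequality for the weight `‖x‖ ^ (-s)`. -/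
theorem lintegral_rpow_mul_rpow_norm_le (hN : N ≠ 0) (hu : HasCompactSupport u)
    (huc : Continuous u) (hu0 : ∀ x, 0 ≤ u x) {s q : ℝ} (hs : 0 ≤ s) (hsN : s < N) (hq : 0 < q) :
    ∫⁻ x, ENNReal.ofReal (u x ^ q) * ENNReal.ofReal (‖x‖ ^ (-s)) ≤
      ENNReal.ofReal (N * omega N / (N - s)) *
        ∫⁻ m in Ioi 0, ENNReal.ofReal (profile u ((N : ℝ) - s) m ^ q) := by
  have ha : 0 < (N : ℝ) - s := by linarith
  have hva := profile_antitone hN hu huc ha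
  let ν : Measure (EuclideanSpace ℝ (Fin N)) :=
    volume.withDensity fun x => ENNReal.ofReal (‖x‖ ^ (-s))
  have hνm : Measurable fun x : EuclideanSpace ℝ (Fin N) => ENNReal.ofReal (‖x‖ ^ (-s)) := by
    fun_prop
  have e1 : ∫⁻ x, ENNReal.ofReal (u x ^ q) * ENNReal.ofReal (‖x‖ ^ (-s)) =
      ∫⁻ x, ENNReal.ofReal (u x ^ q) ∂ν := by
    rw [lintegral_withDensity_eq_lintegral_mul _ hνm
      ((huc.measurable.pow_const q).ennreal_ofReal)]
    simp only [Pi.mul_apply, mul_comm]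
  rw [e1, lintegral_rpow_eq_lintegral_meas_lt_mul ν (ae_of_all _ hu0) huc.measurable.aemeasurable hq,
    lintegral_rpow_eq_lintegral_meas_lt_mul (volume.restrict (Ioi 0))
      (ae_of_all _ fun m => profile_nonneg m) hva.measurable.aemeasurable hq, mul_left_comm]
  refine mul_le_mul_right ?_ _
  rw [← lintegral_const_mul' _ _ ENNReal.ofReal_ne_top]
  refine setLIntegral_mono' measurableSet_Ioi fun t (ht : 0 < t) => ?_
  rw [← mul_assoc]
  refine mul_le_mul_left ?_ _
  have hms : MeasurableSet {x | t < u x} := measurableSet_lt measurable_const huc.measurable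
  have hset : {m | t < profile u ((N : ℝ) - s) m} ∩ Ioi 0 =
      Ioo 0 (levelRadius u t ^ ((N : ℝ) - s)) := by
    ext m
    simp only [mem_inter_iff, mem_ofPred_eq, mem_Ioi, mem_Ioo]
    constructor
    · rintro ⟨h1, h2⟩; exact ⟨h2, (lt_profile_iff hN hu huc ha ht.le h2.le).1 h1⟩
    · rintro ⟨h1, h2⟩; exact ⟨(lt_profile_iff hN hu huc ha ht.le h1.le).2 h2, h1⟩
  rw [Measure.restrict_apply' measurableSet_Ioi, hset, Real.volume_Ioo, sub_zero,
    ← setLIntegral_ball_rpow_norm hN hsN (levelRadius_nonneg t)]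
  simp only [ν]
  rw [withDensity_apply _ hms, levelRadius, max_eq_left ht.le]
  exact setLIntegral_rpow_norm_le hN hs hms (volume_lt_top_of_hasCompactSupport hu ht.le).ne

end Rearrangement

namespace Bliss

/-- The Bliss density with exponents `k`, `n`. -/
def density (k n m : ℝ) : ℝ := (1 + m ^ k) ^ (-n)

variable {k n : ℝ}

theorem density_pos {m : ℝ} (hm : 0 ≤ m) : 0 < density k n m := by
  have := Real.rpow_nonneg hm k
  unfold density; positivity

theorem continuous_density (hk : 0 ≤ k) : ContinuousOn (density k n) (Ici 0) := by
  refine ContinuousOn.rpow_const ?_ fun m hm => ?_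
  · exact continuousOn_const.add (continuousOn_id.rpow_const fun _ _ => Or.inr hk)
  · have := Real.rpow_nonneg (mem_Ici.1 hm) k
    left; positivity

theorem integrableOn_density (hk : 0 < k) (hkn : 1 < k * n) :
    IntegrableOn (density k n) (Ioi 0) := by
  have hn : 0 < n := pos_of_mul_pos_right (one_pos.trans hkn) hk.le
  rw [← Ioc_union_Ioi_eq_Ioi zero_le_one, integrableOn_union]
  constructor
  · refine (((continuous_density hk.le).mono Icc_subset_Ici_self).integrableOn_Icc).mono_set
      Ioc_subset_Icc_self
  · have hm : AEStronglyMeasurable (density k n) (volume.restrict (Ioi 1)) :=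
      ((continuous_density hk.le).mono
        (Ioi_subset_Ici zero_le_one)).aestronglyMeasurable measurableSet_Ioi
    refine Integrable.mono' (g := fun m => m ^ (-(k * n)))
      (integrableOn_Ioi_rpow_of_lt (by linarith) one_pos) hm ?_
    refine (ae_restrict_iff' measurableSet_Ioi).2 (ae_of_all _ fun m (hm : 1 < m) => ?_)
    have hm0 : 0 < m := by linarith
    rw [Real.norm_of_nonneg (density_pos hm0.le).le, density, ← mul_neg, Real.rpow_mul hm0.le]
    have := Real.rpow_pos_of_pos hm0 k
    exact Real.rpow_le_rpow_of_nonpos this (by linarith) (by linarith)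

theorem density_sub_one_eq {m : ℝ} (hm : 0 ≤ m) :
    density k (n - 1) m = density k n m + m ^ k * density k n m := by
  have := Real.rpow_nonneg hm k
  rw [density, density, neg_sub, sub_eq_add_neg, add_comm 1 (-n), Real.rpow_add (by positivity), Real.rpow_one]
  ring

theorem density_rpow {m : ℝ} (hm : 0 ≤ m) (hn : n ≠ 0) :
    density k n m ^ (1 - 1 / n) = density k (n - 1) m := by
  have := Real.rpow_nonneg hm k
  rw [density, density, ← Real.rpow_mul (by positivity)]
  congr 1
  field_simp

theorem integrableOn_density_self (hk : 0 < k) (hkn : 1 < k * (n - 1)) :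
    IntegrableOn (density k n) (Ioi 0) :=
  integrableOn_density hk (by nlinarith)

theorem integrableOn_rpow_mul_density (hk : 0 < k) (hkn : 1 < k * (n - 1)) :
    IntegrableOn (fun m => m ^ k * density k n m) (Ioi 0) := by
  refine ((integrableOn_density hk hkn).sub (integrableOn_density_self hk hkn)).congr_fun
    (fun m hm => ?_) measurableSet_Ioi
  simp only [Pi.sub_apply]
  rw [density_sub_one_eq (le_of_lt hm)]
  ring

/-- An integration by parts relating the integrals of the Bliss densities. -/
theorem integral_density_sub_one (hk : 0 < k) (hkn : 1 < k * (n - 1)) :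
    ∫ m in Ioi 0, density k (n - 1) m = (n - 1) * k * ∫ m in Ioi 0, m ^ k * density k n m := by
  have hn1 : 0 < n - 1 := pos_of_mul_pos_right (one_pos.trans hkn) hk.le
  have hd : ∀ m ∈ Ioi (0 : ℝ), HasDerivAt (fun m => m * density k (n - 1) m)
      (density k (n - 1) m - (n - 1) * k * (m ^ k * density k n m)) m := by
    intro m hm
    have hm0 : 0 < m := hm
    have hmk := Real.rpow_pos_of_pos hm0 k
    have h1 : HasDerivAt (fun m : ℝ => 1 + m ^ k) (k * m ^ (k - 1)) m :=
      (Real.hasDerivAt_rpow_const (Or.inl hm0.ne')).const_add 1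
    have h2 := h1.rpow_const (p := -(n - 1)) (Or.inl (by positivity))
    have h3 := (hasDerivAt_id m).mul h2
    refine h3.congr_deriv ?_
    simp only [id, density]
    rw [show -(n - 1) - 1 = -n by ring, Real.rpow_sub_one hm0.ne']
    field_simp
    ring
  have hintegrable := (integrableOn_density hk hkn).sub
    ((integrableOn_rpow_mul_density hk hkn).const_mul ((n - 1) * k))
  have hlim : Tendsto (fun m => m * density k (n - 1) m) atTop (𝓝 0) := by
    have h1 : Tendsto (fun m : ℝ => m ^ (-(k * (n - 1) - 1))) atTop (𝓝 0) :=
      tendsto_rpow_neg_atTop (by linarith)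
    refine tendsto_of_tendsto_of_tendsto_of_le_of_le' tendsto_const_nhds h1 ?_ ?_
    · filter_upwards [eventually_ge_atTop 0] with m hm
      exact mul_nonneg hm (density_pos hm).le
    · filter_upwards [eventually_gt_atTop 0] with m hm
      have hmk := Real.rpow_pos_of_pos hm k
      have : density k (n - 1) m ≤ m ^ (-(k * (n - 1))) := by
        rw [density, ← mul_neg, Real.rpow_mul hm.le]
        exact Real.rpow_le_rpow_of_nonpos hmk (by linarith) (by linarith)
      calc m * density k (n - 1) m ≤ m * m ^ (-(k * (n - 1))) := by gcongr
        _ = _ := by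
          rw [show -(k * (n - 1) - 1) = 1 + -(k * (n - 1)) by ring, Real.rpow_add hm, Real.rpow_one]
  have hcont : ContinuousWithinAt (fun m => m * density k (n - 1) m) (Ici 0) 0 :=
    (continuousOn_id.mul (continuous_density hk.le)) 0 self_mem_Ici
  have := integral_Ioi_of_hasDerivAt_of_tendsto hcont hd hintegrable hlim
  rw [integral_sub (integrableOn_density hk hkn)
    ((integrableOn_rpow_mul_density hk hkn).const_mul _), integral_const_mul] at this
  linarith

theorem integral_density_pos (hk : 0 < k) (hkn : 1 < k * (n - 1)) :
    0 < ∫ m in Ioi 0, density k n m := by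
  refine (setIntegral_pos_iff_support_of_nonneg_ae ?_ (integrableOn_density_self hk hkn)).2 ?_
  · exact (ae_restrict_iff' measurableSet_Ioi).2
      (ae_of_all _ fun m hm => (density_pos (le_of_lt hm)).le)
  · have : Ioi (0 : ℝ) ⊆ Function.support (density k n) ∩ Ioi 0 :=
      fun m hm => ⟨(density_pos (le_of_lt hm)).ne', hm⟩
    refine lt_of_lt_of_le ?_ (measure_mono this)
    simp

theorem integral_rpow_mul_density_pos (hk : 0 < k) (hkn : 1 < k * (n - 1)) :
    0 < ∫ m in Ioi 0, m ^ k * density k n m := by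
  have hpos : ∀ m ∈ Ioi (0 : ℝ), 0 < m ^ k * density k n m := fun m hm =>
    mul_pos (Real.rpow_pos_of_pos hm _) (density_pos (le_of_lt hm))
  refine (setIntegral_pos_iff_support_of_nonneg_ae ?_ (integrableOn_rpow_mul_density hk hkn)).2 ?_
  · exact (ae_restrict_iff' measurableSet_Ioi).2 (ae_of_all _ fun m hm => (hpos m hm).le)
  · have : Ioi (0 : ℝ) ⊆ Function.support (fun m => m ^ k * density k n m) ∩ Ioi 0 :=
      fun m hm => ⟨(hpos m hm).ne', hm⟩
    refine lt_of_lt_of_le ?_ (measure_mono this)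
    simp

end Bliss

namespace Rearrangement

section SharpSobolev

variable {N : ℕ} {u g : EuclideanSpace ℝ (Fin N) → ℝ} {p s n q γ k : ℝ}

open scoped Classical in
/-- The coupling of the perimeter inequality with a transport map `S`, after Hölder's inequality. -/
theorem lintegral_transport_le (hN : 2 ≤ N) (hp : 1 < p) (hsN : s < N) (hn : 1 < n)
    (hγp : (γ - 1) * (p / (p - 1)) = q) (hk : 1 / n * (p / (p - 1)) = k)
    (hexp : (((N : ℝ) - s) * (1 - 1 / n) - (N - 1)) * (p / (p - 1)) = -s)
    (hus : HasCompactSupport u) {L : NNReal} (huL : LipschitzWith L u) (hgm : Measurable g)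
    (hg : ∀ᵐ x, ∀ c, g x < c → ∀ᶠ ε in 𝓝[>] (0 : ℝ), ∀ y ∈ ball x ε, u y ≤ u x + c * ε)
    {S : ℝ → ℝ} (hSm : Measurable S) (hS0 : ∀ x, 0 ≤ x → 0 ≤ S x) :
    ENNReal.ofReal (N * omega N) * ∫⁻ t in Ioi 0,
        ENNReal.ofReal (S (levelRadius u t ^ ((N : ℝ) - s)) ^ (1 / n) *
          (levelRadius u t ^ ((N : ℝ) - s)) ^ (1 - 1 / n)) * ENNReal.ofReal (t ^ (γ - 1)) ≤
      (∫⁻ x, ENNReal.ofReal (g x) ^ p) ^ (1 / p) *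
        (ENNReal.ofReal (N * omega N / (N - s)) * ∫⁻ m in Ioi 0, ENNReal.ofReal (S m ^ k) *
          ENNReal.ofReal (profile u ((N : ℝ) - s) m ^ q)) ^ (1 / (p / (p - 1))) := by
  have hN0 : N ≠ 0 := by omega
  have huc := huL.continuous
  set a : ℝ := (N : ℝ) - s
  have ha : 0 < a := by simp only [a]; linarith
  have hni : 1 / n < 1 := by rw [div_lt_one (by linarith)]; exact hn
  have hp' : 0 < p / (p - 1) := div_pos (by linarith) (by linarith)
  let P : Set ℝ := {t | 0 < volume {x | u x = t}}
  have hP : P.Countable := Measure.countable_meas_level_set_pos huc.measurable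
  have hr : Measurable (levelRadius u) := (levelRadius_antitone hus).measurable
  let φ : ℝ → ℝ≥0∞ := fun t => if t ∈ P ∪ Iic 0 then 0 else
    ENNReal.ofReal (S (levelRadius u t ^ a) ^ (1 / n) * (levelRadius u t ^ a) ^ (1 - 1 / n) *
      t ^ (γ - 1) / levelRadius u t ^ (N - 1))
  have hφ : Measurable φ := by
    refine Measurable.ite (hP.measurableSet.union measurableSet_Iic) measurable_const ?_
    refine Measurable.ennreal_ofReal ?_
    have h1 : Measurable fun t => levelRadius u t ^ a := hr.pow_const a
    have h2 := hSm.comp h1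
    exact (((h2.pow_const _).mul (h1.pow_const _)).mul (measurable_id.pow_const _)).div
      (hr.pow_const _)
  have hω : 0 ≤ N * omega N := by have := omega_pos N; positivity
  have hmass : ENNReal.ofReal (N * omega N) * ∫⁻ t in Ioi 0,
        ENNReal.ofReal (S (levelRadius u t ^ a) ^ (1 / n) *
          (levelRadius u t ^ a) ^ (1 - 1 / n)) * ENNReal.ofReal (t ^ (γ - 1)) =
      ∫⁻ t in Ioi 0, ENNReal.ofReal (N * omega N * levelRadius u t ^ (N - 1)) * φ t := by
    rw [← lintegral_const_mul' _ _ ENNReal.ofReal_ne_top]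
    refine lintegral_congr_ae ((ae_restrict_iff' measurableSet_Ioi).2 ?_)
    have : ∀ᵐ t : ℝ, t ∉ P := by
      rw [ae_iff]; simpa using hP.measure_zero volume
    filter_upwards [this] with t ht (ht0 : 0 < t)
    have hr0 := levelRadius_nonneg (u := u) t
    have hm0 : 0 ≤ levelRadius u t ^ a := Real.rpow_nonneg hr0 _
    have hSt := hS0 _ hm0
    have hH : 0 ≤ S (levelRadius u t ^ a) ^ (1 / n) * (levelRadius u t ^ a) ^ (1 - 1 / n) := by
      positivity
    simp only [φ]
    rw [if_neg (by simp [ht, ht0]), ← ENNReal.ofReal_mul hH, ← ENNReal.ofReal_mul hω,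
      ← ENNReal.ofReal_mul (by positivity)]
    congr 1
    rcases hr0.eq_or_lt with h | h
    · rw [← h, Real.zero_rpow ha.ne', Real.zero_rpow (by linarith : 1 - 1 / n ≠ 0)]
      simp
    · field_simp
  rw [hmass]
  refine (lintegral_perimeter_mul_le hN hus huL hgm hg hφ).trans ?_
  have hpq : p.HolderConjugate (p / (p - 1)) := Real.HolderConjugate.conjExponent hp
  refine (ENNReal.lintegral_mul_le_Lp_mul_Lq volume hpq
    hgm.ennreal_ofReal.aemeasurable (hφ.comp huc.measurable).aemeasurable).trans ?_
  refine mul_le_mul_right (ENNReal.rpow_le_rpow ?_ (by positivity)) _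
  have hvm : Measurable (profile u a) := (profile_antitone hN0 hus huc ha).measurable
  have hΨm : Measurable fun m => ENNReal.ofReal (S m ^ k) * ENNReal.ofReal (profile u a m ^ q) :=
    (hSm.pow_const k).ennreal_ofReal.mul (hvm.pow_const q).ennreal_ofReal
  rw [← lintegral_rpow_norm hN0 hsN hΨm]
  refine lintegral_comp_le_profile (ψ := fun t => φ t ^ (p / (p - 1))) hN0 hus huc ha
    (hφ.pow_const _) (fun t ht => ?_) (fun t ht => ?_) fun x t ht hpt hrt => ?_
  · simp only [φ]; rw [if_pos (show t ∈ P ∪ Iic 0 from Or.inr ht),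
      ENNReal.zero_rpow_of_pos hp']
  · simp only [φ]; rw [if_pos (show t ∈ P ∪ Iic 0 from Or.inl (pos_iff_ne_zero.2 ht)),
      ENNReal.zero_rpow_of_pos hp']
  · have hx0 := norm_nonneg x
    by_cases htP : t ∈ P ∪ Iic 0
    · simp only [φ]; rw [if_pos htP, ENNReal.zero_rpow_of_pos hp']; exact zero_le
    simp only [φ]
    rw [if_neg htP, hrt, hpt]
    have hm0 : 0 ≤ ‖x‖ ^ a := Real.rpow_nonneg hx0 _
    have hSt := hS0 _ hm0
    rcases hx0.eq_or_lt with h | h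
    · rw [← h, Real.zero_rpow ha.ne', Real.zero_rpow (by linarith : 1 - 1 / n ≠ 0)]
      simp [ENNReal.zero_rpow_of_pos hp']
    rw [ENNReal.ofReal_rpow_of_nonneg (by positivity) hp'.le, ← ENNReal.ofReal_mul (by positivity),
      ← ENNReal.ofReal_mul (by positivity)]
    refine (congrArg ENNReal.ofReal ?_).le
    rw [← Real.rpow_natCast, Nat.cast_sub (by omega), Nat.cast_one, Real.div_rpow (by positivity)
      (by positivity), Real.mul_rpow (by positivity) (by positivity),
      Real.mul_rpow (by positivity) (by positivity), ← Real.rpow_mul hSt, ← Real.rpow_mul hx0,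
      ← Real.rpow_mul hx0, ← Real.rpow_mul hx0, ← Real.rpow_mul ht.le, hγp, hk, mul_right_comm,
      mul_div_assoc, ← Real.rpow_sub h, ← sub_mul, hexp]

end SharpSobolev

end Rearrangement

namespace Rearrangement

section SharpSobolev

variable {N : ℕ} {u g : EuclideanSpace ℝ (Fin N) → ℝ} {p s n q γ k : ℝ}

theorem lintegral_profile_rpow (hN : N ≠ 0) (hus : HasCompactSupport u) (huc : Continuous u)
    {a : ℝ} (ha : 0 < a) (hq : 0 < q) :
    ∫⁻ m in Ioi 0, ENNReal.ofReal (profile u a m ^ q) =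
      ENNReal.ofReal (∫ m in (0 : ℝ)..(levelRadius u 0 ^ a), profile u a m ^ q) := by
  have hva := profile_antitone hN hus huc ha
  have hm0 : 0 ≤ levelRadius u 0 ^ a := Real.rpow_nonneg (levelRadius_nonneg 0) _
  have hanti : Antitone fun m => profile u a m ^ q := fun x y hxy =>
    Real.rpow_le_rpow (profile_nonneg y) (hva hxy) hq.le
  rw [intervalIntegral.integral_of_le hm0, ofReal_integral_eq_lintegral_ofReal
    (hanti.antitoneOn _ |>.intervalIntegrable).1
    (ae_of_all _ fun m => Real.rpow_nonneg (profile_nonneg m) _)]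
  rw [← Ioc_union_Ioi_eq_Ioi hm0, lintegral_union measurableSet_Ioi
    (Set.disjoint_left.2 fun x hx hx' => (not_lt.2 hx.2 hx'))]
  rw [setLIntegral_congr_fun (g := fun _ => 0) measurableSet_Ioi, lintegral_zero, add_zero]
  intro m (hm : _ < m)
  have h1 : ¬ 0 < profile u a m := fun h =>
    (not_lt.2 hm.le) ((lt_profile_iff hN hus huc ha le_rfl (hm0.trans hm.le)).1 h)
  have h2 : profile u a m = 0 := le_antisymm (not_lt.1 h1) (profile_nonneg m)
  simp [h2, Real.zero_rpow hq.ne']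

theorem transport_estimate (hN : 2 ≤ N) (hp : 1 < p) (hsN : s < N) (hn : 1 < n) (hγ : 0 < γ)
    (hq : 0 < q) (hqn : 1 / q = 1 / p - 1 / n) (hqγ : q / n + γ = q)
    (hγp : (γ - 1) * (p / (p - 1)) = q) (hk : 1 / n * (p / (p - 1)) = k)
    (hkn : 1 < k * (n - 1))
    (hexp : (((N : ℝ) - s) * (1 - 1 / n) - (N - 1)) * (p / (p - 1)) = -s)
    (hus : HasCompactSupport u) {L : NNReal} (huL : LipschitzWith L u) (hgm : Measurable g)
    (hg : ∀ᵐ x, ∀ c, g x < c → ∀ᶠ ε in 𝓝[>] (0 : ℝ), ∀ y ∈ ball x ε, u y ≤ u x + c * ε)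
    (hpos : 0 < levelRadius u 0) (hE : ∫⁻ x, ENNReal.ofReal (g x) ^ p ≠ ∞)
    {D : ℝ} (hD : D = ∫ m in (0 : ℝ)..(levelRadius u 0 ^ ((N : ℝ) - s)),
      profile u ((N : ℝ) - s) m ^ q) :
    0 < D ∧ N * omega N * ((n - 1) * k * ∫ m in Ioi 0, m ^ k * Bliss.density k n m) ≤
      γ * (∫⁻ x, ENNReal.ofReal (g x) ^ p).toReal ^ (1 / p) *
        (N * omega N / (N - s) * ∫ m in Ioi 0, m ^ k * Bliss.density k n m) ^ (1 / (p / (p - 1))) *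
        ((∫ m in Ioi 0, Bliss.density k n m) / D) ^ (1 / q) := by
  have hN0 : N ≠ 0 := by omega
  have huc := huL.continuous
  set a : ℝ := (N : ℝ) - s
  have ha : 0 < a := by simp only [a]; linarith
  have hp1 : 0 < p - 1 := by linarith
  have hp' : 0 < p / (p - 1) := by positivity
  have hk0 : 0 < k := hk ▸ (by positivity)
  have hva := profile_antitone hN0 hus huc ha
  have hv0 : ∀ x, 0 ≤ profile u a x := profile_nonneg
  have hvm : ∀ t, 0 ≤ t → ∀ x, 0 ≤ x → (t < profile u a x ↔ x < levelRadius u t ^ a) :=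
    fun t ht x hx => lt_profile_iff hN0 hus huc ha ht hx
  have hm0 : 0 < levelRadius u 0 ^ a := Real.rpow_pos_of_pos hpos _
  have hWc : ContinuousOn (Bliss.density k n) (Ici 0) := Bliss.continuous_density hk0.le
  have hWpos : ∀ y, 0 ≤ y → 0 < Bliss.density k n y := fun y => Bliss.density_pos
  have hω : 0 < N * omega N := by have := omega_pos N; positivity
  set I := ∫ m in Ioi 0, m ^ k * Bliss.density k n m with hI
  have hI0 : 0 < I := Bliss.integral_rpow_mul_density_pos hk0 hkn
  have hIint := Bliss.integrableOn_rpow_mul_density hk0 hkn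
  have hIe : ∫⁻ y in Ioi 0, ENNReal.ofReal (y ^ k) * ENNReal.ofReal (Bliss.density k n y) =
      ENNReal.ofReal I := by
    rw [hI, ofReal_integral_eq_lintegral_ofReal hIint]
    · exact setLIntegral_congr_fun measurableSet_Ioi fun y (hy : 0 < y) =>
        (ENNReal.ofReal_mul (Real.rpow_nonneg hy.le _)).symm
    · exact (ae_restrict_iff' measurableSet_Ioi).2 (ae_of_all _ fun y (hy : 0 < y) =>
        mul_nonneg (Real.rpow_nonneg hy.le _) (hWpos y hy.le).le)
  have hD0 : 0 ≤ D := hD ▸ intervalIntegral.integral_nonneg hm0.le fun x _ =>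
    Real.rpow_nonneg (hv0 x) _
  set E := ∫⁻ x, ENNReal.ofReal (g x) ^ p
  set c := N * omega N / (N - s)
  have hc : 0 < c := div_pos hω ha
  have main : ∀ Y : ℝ, 0 < Y → 0 < D ∧
      N * omega N * ∫ y in (0 : ℝ)..Y, Bliss.density k (n - 1) y ≤
        γ * E.toReal ^ (1 / p) * (c * I) ^ (1 / (p / (p - 1))) *
          ((∫ y in (0 : ℝ)..Y, Bliss.density k n y) / D) ^ (1 / q) := by
    intro Y hY
    obtain ⟨hA, S, hSm, hS0, hS1, hS2⟩ := exists_transport hn hq hγ hqγ hva hv0 hvm hm0 hWc hWpos hY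
      (A := (∫ y in (0 : ℝ)..Y, Bliss.density k n y) / D) (by rw [hD])
    set G := ∫ y in (0 : ℝ)..Y, Bliss.density k n y
    set A := G / D
    have hDp : 0 < D := by
      refine hD0.lt_of_ne fun h => ?_
      simp only [A, ← h, div_zero, lt_self_iff_false] at hA
    refine ⟨hDp, ?_⟩
    have h1 := lintegral_transport_le hN hp hsN hn hγp hk hexp hus huL hgm hg hSm hS0
    have h2 := hS1 fun y => ENNReal.ofReal (y ^ k)
    rw [hIe] at h2
    have hJ : ∫⁻ y in Ioo 0 Y, ENNReal.ofReal (Bliss.density k n y ^ (1 - 1 / n)) =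
        ENNReal.ofReal (∫ y in (0 : ℝ)..Y, Bliss.density k (n - 1) y) := by
      rw [intervalIntegral.integral_of_le hY.le, ofReal_integral_eq_lintegral_ofReal,
        setLIntegral_congr Ioo_ae_eq_Ioc]
      · exact setLIntegral_congr_fun measurableSet_Ioc fun y hy => by
          rw [Bliss.density_rpow hy.1.le (by positivity)]
      · exact (Bliss.integrableOn_density hk0 hkn).mono_set Ioc_subset_Ioi_self
      · exact (ae_restrict_iff' measurableSet_Ioc).2 (ae_of_all _ fun y hy =>
          (Bliss.density_pos hy.1.le).le)
    rw [hJ] at hS2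
    have hJ0 : 0 ≤ ∫ y in (0 : ℝ)..Y, Bliss.density k (n - 1) y :=
      intervalIntegral.integral_nonneg hY.le fun y hy => (Bliss.density_pos hy.1).le
    set J := ∫ y in (0 : ℝ)..Y, Bliss.density k (n - 1) y
    have h3 : ENNReal.ofReal (N * omega N) * (ENNReal.ofReal (A ^ (1 / n - 1)) * ENNReal.ofReal J) ≤
        ENNReal.ofReal γ * (E ^ (1 / p) * (ENNReal.ofReal c *
          (ENNReal.ofReal A⁻¹ * ENNReal.ofReal I)) ^ (1 / (p / (p - 1)))) := by
      refine (mul_le_mul_right hS2 _).trans ?_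
      rw [mul_left_comm]
      refine mul_le_mul_right (h1.trans ?_) _
      exact mul_le_mul_right (ENNReal.rpow_le_rpow (mul_le_mul_right h2 _) (by positivity)) _
    have hAi : 0 ≤ A⁻¹ := by positivity
    rw [← ENNReal.ofReal_toReal hE, ← ENNReal.ofReal_mul hAi, ← ENNReal.ofReal_mul hc.le,
      ENNReal.ofReal_rpow_of_nonneg ENNReal.toReal_nonneg (by positivity),
      ENNReal.ofReal_rpow_of_nonneg (by positivity) (by positivity),
      ← ENNReal.ofReal_mul (by positivity), ← ENNReal.ofReal_mul (by positivity),
      ← ENNReal.ofReal_mul (by positivity), ← ENNReal.ofReal_mul (by positivity),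
      ENNReal.ofReal_le_ofReal_iff (by positivity)] at h3
    have hA1 : A ^ (1 / n - 1) * A ^ (1 - 1 / n) = 1 := by
      rw [← Real.rpow_add hA, show 1 / n - 1 + (1 - 1 / n) = 0 by ring, Real.rpow_zero]
    have hA2 : (A⁻¹) ^ (1 / (p / (p - 1))) * A ^ (1 - 1 / n) = A ^ (1 / q) := by
      rw [Real.inv_rpow hA.le, ← Real.rpow_neg hA.le, ← Real.rpow_add hA, hqn]
      congr 1
      field_simp
      ring
    have h4 := mul_le_mul_of_nonneg_right h3 (Real.rpow_nonneg hA.le (1 - 1 / n))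
    rw [show c * (A⁻¹ * I) = c * I * A⁻¹ by ring,
      Real.mul_rpow (by positivity) hAi] at h4
    calc N * omega N * J = N * omega N * (A ^ (1 / n - 1) * J) * A ^ (1 - 1 / n) := by
          linear_combination (-(N * omega N * J)) * hA1
      _ ≤ _ := h4
      _ = _ := by rw [← hA2]; ring
  have hDp := (main 1 one_pos).1
  refine ⟨hDp, ?_⟩
  have hlim1 : Tendsto (fun Y : ℝ => N * omega N * ∫ y in (0 : ℝ)..Y, Bliss.density k (n - 1) y)
      atTop (𝓝 (N * omega N * ∫ y in Ioi 0, Bliss.density k (n - 1) y)) :=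
    (intervalIntegral_tendsto_integral_Ioi 0 (Bliss.integrableOn_density hk0 hkn)
      tendsto_id).const_mul _
  have hlim2 : Tendsto (fun Y : ℝ => γ * E.toReal ^ (1 / p) * (c * I) ^ (1 / (p / (p - 1))) *
          ((∫ y in (0 : ℝ)..Y, Bliss.density k n y) / D) ^ (1 / q)) atTop
      (𝓝 (γ * E.toReal ^ (1 / p) * (c * I) ^ (1 / (p / (p - 1))) *
          ((∫ y in Ioi 0, Bliss.density k n y) / D) ^ (1 / q))) :=
    (((intervalIntegral_tendsto_integral_Ioi 0 (Bliss.integrableOn_density_self hk0 hkn)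
      tendsto_id).div_const D).rpow_const (Or.inr (by positivity))).const_mul _
  rw [Bliss.integral_density_sub_one hk0 hkn] at hlim1
  refine le_of_tendsto_of_tendsto hlim1 hlim2 ?_
  filter_upwards [eventually_gt_atTop 0] with Y hY using (main Y hY).2

end SharpSobolev

end Rearrangement

namespace Bliss

/-- The dimension in which the Hardy–Sobolev quotient of radial functions becomes a Sobolev
quotient. -/
def dim (N : ℕ) (p s : ℝ) : ℝ := p * (N - s) / (p - s)

/-- The exponent of the Bliss density of the Hardy–Sobolev extremals, in the variable
`‖x‖ ^ (N - s)`. -/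
def expo (N : ℕ) (p s : ℝ) : ℝ := (p - s) / ((p - 1) * (N - s))

/-- The exponent `(N - p) / (p - 1)` of the fundamental solution of the `p`-Laplacian. -/
def kap (N : ℕ) (p : ℝ) : ℝ := (N - p) / (p - 1)

/-- The ratio between the measure `‖x‖ ^ (-s) dx` and the Lebesgue measure in the variable
`‖x‖ ^ (N - s)`. -/
def sphereConst (N : ℕ) (s : ℝ) : ℝ := N * Rearrangement.omega N / (N - s)

/-- The energy of the Hardy–Sobolev extremals. -/
def energy (N : ℕ) (p s : ℝ) : ℝ :=
  kap N p ^ p * (sphereConst N s *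
    ∫ m in Ioi 0, m ^ expo N p s * density (expo N p s) (dim N p s) m)

/-- The mass of the Hardy–Sobolev extremals. -/
def mass (N : ℕ) (p s : ℝ) : ℝ :=
  sphereConst N s * ∫ m in Ioi 0, density (expo N p s) (dim N p s) m

/-- The value of the best Hardy–Sobolev constant. -/
def const (N : ℕ) (p s : ℝ) : ℝ := energy N p s / mass N p s ^ (p / HS.pstar N p s)

section

variable {N : ℕ} {p s : ℝ}

theorem kap_pos (hp : 1 < p) (hpN : p < N) : 0 < kap N p :=
  div_pos (by linarith) (by linarith)

theorem expo_pos (hp : 1 < p) (hpN : p < N) (hsp : s < p) : 0 < expo N p s :=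
  div_pos (by linarith) (mul_pos (by linarith) (by linarith))

theorem one_lt_dim (hp : 1 < p) (hpN : p < N) (hsp : s < p) : 1 < dim N p s := by
  rw [dim, lt_div_iff₀ (by linarith)]
  nlinarith

theorem one_lt_expo_mul_dim_sub_one (hp : 1 < p) (hpN : p < N) (hsp : s < p) :
    1 < expo N p s * (dim N p s - 1) := by
  have h1 : 0 < p - s := by linarith
  have h2 : 0 < p - 1 := by linarith
  have h3 : 0 < (N : ℝ) - s := by linarith
  have : expo N p s * (dim N p s - 1) = (p * (N - s) - (p - s)) / ((p - 1) * (N - s)) := by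
    rw [expo, dim]; field_simp
  rw [this, lt_div_iff₀ (by positivity)]
  nlinarith

theorem sphereConst_pos (hp : 1 < p) (hpN : p < N) (hsp : s < p) : 0 < sphereConst N s := by
  have := Rearrangement.omega_pos N
  have h : (0 : ℝ) < N := by linarith
  exact div_pos (by positivity) (by linarith)

theorem energy_pos (hp : 1 < p) (hpN : p < N) (hsp : s < p) : 0 < energy N p s :=
  mul_pos (Real.rpow_pos_of_pos (kap_pos hp hpN) _) (mul_pos (sphereConst_pos hp hpN hsp)
    (integral_rpow_mul_density_pos (expo_pos hp hpN hsp) (one_lt_expo_mul_dim_sub_one hp hpN hsp)))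

theorem mass_pos (hp : 1 < p) (hpN : p < N) (hsp : s < p) : 0 < mass N p s :=
  mul_pos (sphereConst_pos hp hpN hsp)
    (integral_density_pos (expo_pos hp hpN hsp) (one_lt_expo_mul_dim_sub_one hp hpN hsp))

theorem const_pos (hp : 1 < p) (hpN : p < N) (hsp : s < p) : 0 < const N p s :=
  div_pos (energy_pos hp hpN hsp) (Real.rpow_pos_of_pos (mass_pos hp hpN hsp) _)

theorem pstar_pos (hp : 1 < p) (hpN : p < N) (hsp : s < p) : 0 < HS.pstar N p s :=
  div_pos (mul_pos (by linarith) (by linarith)) (by linarith)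

end

end Bliss

namespace Rearrangement

variable {N : ℕ} {u g : EuclideanSpace ℝ (Fin N) → ℝ} {p s : ℝ}

open Bliss in
/-- The sharp Hardy–Sobolev inequality for Lipschitz functions with compact support, with any upper
bound `g` for the local slope in place of the gradient. -/
theorem const_mul_rpow_le (hN : 2 ≤ N) (hp : 1 < p) (hpN : p < N) (hs : 0 ≤ s) (hsp : s < p)
    (hus : HasCompactSupport u) {L : NNReal} (huL : LipschitzWith L u) (hu0 : ∀ x, 0 ≤ u x)
    (hgm : Measurable g)
    (hg : ∀ᵐ x, ∀ c, g x < c → ∀ᶠ ε in 𝓝[>] (0 : ℝ), ∀ y ∈ ball x ε, u y ≤ u x + c * ε) :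
    ENNReal.ofReal (const N p s) *
        (∫⁻ x, ENNReal.ofReal (u x ^ HS.pstar N p s) * ENNReal.ofReal (‖x‖ ^ (-s))) ^
          (p / HS.pstar N p s) ≤
      ∫⁻ x, ENNReal.ofReal (g x) ^ p := by
  have hN0 : N ≠ 0 := by omega
  have hsN : s < N := by linarith
  have huc := huL.continuous
  have ha : 0 < (N : ℝ) - s := by linarith
  have hb : 0 < (N : ℝ) - p := by linarith
  have hp1 : 0 < p - 1 := by linarith
  have hps : 0 < p - s := by linarith
  have hq := pstar_pos hp hpN hsp
  have hKpos := const_pos hp hpN hsp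
  set q := HS.pstar N p s with hqdef
  have hHL := lintegral_rpow_mul_rpow_norm_le hN0 hus huc hu0 hs hsN hq
  rw [lintegral_profile_rpow hN0 hus huc ha hq] at hHL
  set D := ∫ m in (0 : ℝ)..(levelRadius u 0 ^ ((N : ℝ) - s)), profile u ((N : ℝ) - s) m ^ q with hD
  have hpq : 0 < p / q := by positivity
  set c := sphereConst N s with hcdef
  have hc : 0 < c := sphereConst_pos hp hpN hsp
  refine (mul_le_mul_right (ENNReal.rpow_le_rpow hHL hpq.le) _).trans ?_
  rcases (levelRadius_nonneg (u := u) 0).eq_or_lt with h0 | hpos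
  · have : D = 0 := by
      rw [hD, ← h0, Real.zero_rpow ha.ne', intervalIntegral.integral_same]
    rw [this, ENNReal.ofReal_zero, mul_zero, ENNReal.zero_rpow_of_pos hpq, mul_zero]
    exact zero_le
  by_cases hE : ∫⁻ x, ENNReal.ofReal (g x) ^ p = ∞
  · rw [hE]; exact le_top
  set n := dim N p s with hn
  set k := expo N p s with hk
  have hn1 : 1 < n := one_lt_dim hp hpN hsp
  have hkn : 1 < k * (n - 1) := one_lt_expo_mul_dim_sub_one hp hpN hsp
  have hk0 : 0 < k := expo_pos hp hpN hsp
  have hni : 1 / n = (p - s) / (p * (N - s)) := by rw [hn, dim, one_div_div]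
  have hqi : 1 / q = (N - p) / (p * (N - s)) := by rw [hqdef, HS.pstar, one_div_div]
  have hqn : 1 / q = 1 / p - 1 / n := by rw [hqi, hni]; field_simp; ring
  set γ := q * (1 - 1 / n) with hγdef
  have hni1 : 1 / n < 1 := by rw [div_lt_one (by linarith)]; exact hn1
  have hγ : 0 < γ := mul_pos hq (by linarith)
  obtain ⟨hDpos, hest⟩ := transport_estimate (γ := γ) (k := k) (n := n) (q := q) hN hp hsN hn1 hγ hq
    hqn (by rw [hγdef]; ring)
    (by rw [hγdef, hni, hqdef, HS.pstar]; field_simp; ring)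
    (by rw [hni, hk, expo]; field_simp) hkn
    (by rw [hni]; field_simp; ring) hus huL hgm hg hpos hE hD
  rw [← ENNReal.ofReal_toReal hE, ← ENNReal.ofReal_mul (by exact hc.le),
    ENNReal.ofReal_rpow_of_nonneg (by exact (mul_pos hc hDpos).le) hpq.le,
    ← ENNReal.ofReal_mul hKpos.le]
  refine ENNReal.ofReal_le_ofReal ?_
  set E := (∫⁻ x, ENNReal.ofReal (g x) ^ p).toReal
  have hE0 : 0 ≤ E := ENNReal.toReal_nonneg
  have hI : 0 < ∫ m in Ioi 0, m ^ k * density k n m := integral_rpow_mul_density_pos hk0 hkn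
  have hQ : 0 < ∫ m in Ioi 0, density k n m := integral_density_pos hk0 hkn
  have hKe : const N p s = kap N p ^ p * (c * ∫ m in Ioi 0, m ^ k * density k n m) /
    (c * ∫ m in Ioi 0, density k n m) ^ (p / q) := rfl
  have hce : N * omega N / (N - s) = c := rfl
  rw [hKe]
  rw [hce] at hest ⊢
  set I := ∫ m in Ioi 0, m ^ k * density k n m
  set Q := ∫ m in Ioi 0, density k n m
  have hκ : 0 < kap N p := kap_pos hp hpN
  have hNω : N * omega N = c * (N - s) := by rw [← hce]; field_simp
  have hκγ : (N - s) * ((n - 1) * k) = γ * kap N p := by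
    rw [hγdef, hqdef, HS.pstar, hn, dim, hk, expo, kap]; field_simp
  have h1 : kap N p * (c * I) ≤ E ^ (1 / p) * (c * I) ^ (1 / (p / (p - 1))) * (Q / D) ^ (1 / q) := by
    refine le_of_mul_le_mul_left ?_ hγ
    calc γ * (kap N p * (c * I)) = N * omega N * ((n - 1) * k * I) := by
          rw [hNω]; linear_combination (-(c * I)) * hκγ
      _ ≤ _ := hest
      _ = _ := by ring
  have hcI : 0 < c * I := by positivity
  have h2 : kap N p * (c * I) ^ (1 / p) * (D / Q) ^ (1 / q) ≤ E ^ (1 / p) := by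
    have e1 : (c * I) ^ (1 / p) * (c * I) ^ (1 / (p / (p - 1))) = c * I := by
      rw [← Real.rpow_add hcI, show 1 / p + 1 / (p / (p - 1)) = 1 by field_simp; ring,
        Real.rpow_one]
    have e2 : (D / Q) ^ (1 / q) * (Q / D) ^ (1 / q) = 1 := by
      rw [← Real.mul_rpow (by positivity) (by positivity), div_mul_div_cancel₀ hQ.ne',
        div_self hDpos.ne', Real.one_rpow]
    refine le_of_mul_le_mul_right ?_
      (mul_pos (Real.rpow_pos_of_pos hcI (1 / (p / (p - 1))))
        (Real.rpow_pos_of_pos (div_pos hQ hDpos) (1 / q)))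
    calc _ = kap N p * ((c * I) ^ (1 / p) * (c * I) ^ (1 / (p / (p - 1)))) *
          ((D / Q) ^ (1 / q) * (Q / D) ^ (1 / q)) := by ring
      _ = kap N p * (c * I) := by rw [e1, e2, mul_one]
      _ ≤ _ := h1
      _ = _ := by ring
  have h3 := Real.rpow_le_rpow (by positivity) h2 (by linarith : 0 ≤ p)
  rw [← Real.rpow_mul hE0, one_div_mul_cancel (by linarith), Real.rpow_one,
    Real.mul_rpow (by positivity) (by positivity), Real.mul_rpow (by positivity) (by positivity),
    ← Real.rpow_mul hcI.le, one_div_mul_cancel (by linarith), Real.rpow_one,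
    ← Real.rpow_mul (by positivity), one_div_mul_eq_div] at h3
  refine le_trans (le_of_eq ?_) h3
  rw [div_mul_eq_mul_div, mul_div_assoc, ← Real.div_rpow (by positivity) (by positivity),
    mul_div_mul_left _ _ hc.ne']

end Rearrangement

namespace BallModel

/-- The radial change of variables from `[0, R)` onto `[0, ∞)` which transports the fundamental
solution of the `p`-Laplacian on the ball to the one on the whole space. -/
def stretch (R κ r : ℝ) : ℝ := r * (1 - (r / R) ^ κ) ^ (-(1 / κ))

/-- The inverse of `stretch`. -/
def squeeze (R κ ρ : ℝ) : ℝ := ρ * (1 + (ρ / R) ^ κ) ^ (-(1 / κ))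

variable {R κ : ℝ}

theorem one_sub_pos (hR : 0 < R) (hκ : 0 < κ) {r : ℝ} (hr : 0 ≤ r) (hrR : r < R) :
    0 < 1 - (r / R) ^ κ := by
  have : (r / R) ^ κ < 1 := Real.rpow_lt_one (by positivity) (by rwa [div_lt_one hR]) hκ
  linarith

theorem div_rpow_stretch (hR : 0 < R) (hκ : 0 < κ) {r : ℝ} (hr : 0 ≤ r) (hrR : r < R) :
    (stretch R κ r / R) ^ κ = (r / R) ^ κ / (1 - (r / R) ^ κ) := by
  have h := one_sub_pos hR hκ hr hrR
  rw [stretch, mul_div_right_comm, Real.mul_rpow (by positivity) (by positivity),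
    ← Real.rpow_mul h.le, show -(1 / κ) * κ = -1 by field_simp, Real.rpow_neg_one, div_eq_mul_inv _ (1 - _)]

theorem squeeze_stretch (hR : 0 < R) (hκ : 0 < κ) {r : ℝ} (hr : 0 ≤ r) (hrR : r < R) :
    squeeze R κ (stretch R κ r) = r := by
  have h := one_sub_pos hR hκ hr hrR
  rw [squeeze, div_rpow_stretch hR hκ hr hrR,
    show 1 + (r / R) ^ κ / (1 - (r / R) ^ κ) = (1 - (r / R) ^ κ)⁻¹ by field_simp; ring,
    Real.inv_rpow h.le, stretch, mul_assoc, mul_inv_cancel₀ (by positivity), mul_one]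

theorem one_add_pos (hR : 0 < R) {ρ : ℝ} (hρ : 0 ≤ ρ) : 0 < 1 + (ρ / R) ^ κ := by
  positivity

theorem div_rpow_squeeze (hR : 0 < R) (hκ : 0 < κ) {ρ : ℝ} (hρ : 0 ≤ ρ) :
    (squeeze R κ ρ / R) ^ κ = (ρ / R) ^ κ / (1 + (ρ / R) ^ κ) := by
  have h := one_add_pos (κ := κ) hR hρ
  rw [squeeze, mul_div_right_comm, Real.mul_rpow (by positivity) (by positivity),
    ← Real.rpow_mul h.le, show -(1 / κ) * κ = -1 by field_simp, Real.rpow_neg_one, div_eq_mul_inv _ (1 + _)]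

theorem one_sub_squeeze (hR : 0 < R) (hκ : 0 < κ) {ρ : ℝ} (hρ : 0 ≤ ρ) :
    1 - (squeeze R κ ρ / R) ^ κ = (1 + (ρ / R) ^ κ)⁻¹ := by
  have h := one_add_pos (κ := κ) hR hρ
  rw [div_rpow_squeeze hR hκ hρ]
  field_simp
  ring

theorem stretch_squeeze (hR : 0 < R) (hκ : 0 < κ) {ρ : ℝ} (hρ : 0 ≤ ρ) :
    stretch R κ (squeeze R κ ρ) = ρ := by
  have h := one_add_pos (κ := κ) hR hρ
  rw [stretch, one_sub_squeeze hR hκ hρ, Real.inv_rpow h.le, squeeze, mul_assoc,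
    mul_inv_cancel₀ (by positivity), mul_one]

theorem squeeze_nonneg (hR : 0 < R) {ρ : ℝ} (hρ : 0 ≤ ρ) : 0 ≤ squeeze R κ ρ := by
  have h := one_add_pos (κ := κ) hR hρ
  unfold squeeze; positivity

theorem squeeze_pos (hR : 0 < R) {ρ : ℝ} (hρ : 0 < ρ) : 0 < squeeze R κ ρ := by
  have h := one_add_pos (κ := κ) hR hρ.le
  unfold squeeze; positivity

theorem squeeze_lt (hR : 0 < R) (hκ : 0 < κ) {ρ : ℝ} (hρ : 0 ≤ ρ) : squeeze R κ ρ < R := by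
  have h := one_add_pos (κ := κ) hR hρ
  have h1 : (squeeze R κ ρ / R) ^ κ < 1 := by
    have := one_sub_squeeze hR hκ hρ
    have : 0 < (1 + (ρ / R) ^ κ)⁻¹ := by positivity
    linarith
  by_contra! h2
  exact absurd (Real.one_le_rpow ((one_le_div hR).2 h2) hκ.le) (not_le.2 h1)

theorem stretch_pos (hR : 0 < R) (hκ : 0 < κ) {r : ℝ} (hr : 0 < r) (hrR : r < R) :
    0 < stretch R κ r := by
  have h := one_sub_pos hR hκ hr.le hrR
  unfold stretch; positivity

theorem continuousOn_squeeze (hR : 0 < R) (hκ : 0 < κ) : ContinuousOn (squeeze R κ) (Ici 0) := by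
  refine continuousOn_id.mul (ContinuousOn.rpow_const ?_ fun ρ hρ =>
    Or.inl (one_add_pos hR hρ).ne')
  exact continuousOn_const.add ((continuousOn_id.div_const R).rpow_const fun _ _ => Or.inr hκ.le)

theorem measurable_squeeze : Measurable (squeeze R κ) := by
  unfold squeeze; fun_prop

theorem hasDerivAt_squeeze (hR : 0 < R) (hκ : 0 < κ) {ρ : ℝ} (hρ : 0 < ρ) :
    HasDerivAt (squeeze R κ) ((squeeze R κ ρ / ρ) ^ (κ + 1)) ρ := by
  have h := one_add_pos (κ := κ) hR hρ.le
  have h1 : HasDerivAt (fun ρ : ℝ => (ρ / R) ^ κ) (1 / R * κ * (ρ / R) ^ (κ - 1)) ρ :=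
    ((hasDerivAt_id ρ).div_const R).rpow_const (Or.inl (div_pos hρ hR).ne')
  have h2 := (h1.const_add 1).rpow_const (p := -(1 / κ)) (Or.inl h.ne')
  refine ((hasDerivAt_id ρ).mul h2).congr_deriv ?_
  have e : squeeze R κ ρ / ρ = (1 + (ρ / R) ^ κ) ^ (-(1 / κ)) := by
    rw [squeeze]; field_simp
  rw [e, ← Real.rpow_mul h.le, show -(1 / κ) * (κ + 1) = -(1 / κ) - 1 by field_simp; ring,
    Real.rpow_sub_one h.ne', Real.rpow_sub_one (by positivity)]
  simp only [id]
  field_simp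
  ring

theorem squeeze_div_le_one (hR : 0 < R) (hκ : 0 < κ) {ρ : ℝ} (hρ : 0 < ρ) :
    squeeze R κ ρ / ρ ≤ 1 := by
  have e : squeeze R κ ρ / ρ = (1 + (ρ / R) ^ κ) ^ (-(1 / κ)) := by
    rw [squeeze]; field_simp
  rw [e]
  refine Real.rpow_le_one_of_one_le_of_nonpos ?_ (by rw [neg_nonpos]; positivity)
  have : 0 ≤ (ρ / R) ^ κ := by positivity
  linarith

theorem abs_squeeze_sub_le (hR : 0 < R) (hκ : 0 < κ) {x y : ℝ} (hx : 0 ≤ x) (hy : 0 ≤ y) :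
    |squeeze R κ x - squeeze R κ y| ≤ |x - y| := by
  have hd : ∀ ρ, 0 < ρ → 0 ≤ (squeeze R κ ρ / ρ) ^ (κ + 1) ∧ (squeeze R κ ρ / ρ) ^ (κ + 1) ≤ 1 :=
    fun ρ hρ => by
      have h0 : 0 ≤ squeeze R κ ρ / ρ := div_nonneg (squeeze_nonneg hR hρ.le) hρ.le
      exact ⟨by positivity, Real.rpow_le_one h0 (squeeze_div_le_one hR hκ hρ) (by linarith)⟩
  have hm : MonotoneOn (squeeze R κ) (Ici 0) := by
    refine monotoneOn_of_deriv_nonneg (convex_Ici 0) (continuousOn_squeeze hR hκ) ?_ ?_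
    · rw [interior_Ici]
      exact fun ρ hρ => (hasDerivAt_squeeze hR hκ hρ).differentiableAt.differentiableWithinAt
    · rw [interior_Ici]
      exact fun ρ hρ => by rw [(hasDerivAt_squeeze hR hκ hρ).deriv]; exact (hd ρ hρ).1
  have hm' : MonotoneOn (fun ρ => ρ - squeeze R κ ρ) (Ici 0) := by
    refine monotoneOn_of_deriv_nonneg (convex_Ici 0)
      (continuousOn_id.sub (continuousOn_squeeze hR hκ)) ?_ ?_
    · rw [interior_Ici]
      exact fun ρ hρ => (differentiableAt_id.sub
        (hasDerivAt_squeeze hR hκ hρ).differentiableAt).differentiableWithinAt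
    · rw [interior_Ici]
      intro ρ hρ
      rw [((hasDerivAt_id' ρ).fun_sub (hasDerivAt_squeeze hR hκ hρ)).deriv]
      linarith [(hd ρ hρ).2]
  wlog hxy : x ≤ y generalizing x y
  · rw [abs_sub_comm, abs_sub_comm x]; exact this hy hx (le_of_not_ge hxy)
  have h1 := hm hx hy hxy
  have h2 := hm' hx hy hxy
  rw [abs_sub_comm, abs_sub_comm x, abs_of_nonneg (by linarith), abs_of_nonneg (by linarith)]
  simp only at h2
  linarith

section Potential

variable {N : ℕ} {p s : ℝ}

theorem hasDerivAt_rpow_stretch (hp : 1 < p) (hpN : p < N) (hR : 0 < R) {r : ℝ}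
    (hr : 0 < r) (hrR : r < R) :
    HasDerivAt (fun r => r ^ ((N : ℝ) - s) *
        (1 - (r / R) ^ Bliss.kap N p) ^ (-((N - s) / Bliss.kap N p)))
      ((N - s) * (r ^ (N - 1) * (r ^ (-s) * (1 - (r / R) ^ Bliss.kap N p) ^ (-(HS.beta N p s))))) r := by
  have hκ := Bliss.kap_pos hp hpN
  have hβ : -(HS.beta N p s) = -((N - s) / Bliss.kap N p) - 1 := by
    have : 0 < (N : ℝ) - p := by linarith
    have : 0 < p - 1 := by linarith
    rw [HS.beta, Bliss.kap]; field_simp; ring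
  rw [hβ]
  set κ := Bliss.kap N p
  have h := one_sub_pos hR hκ hr.le hrR
  have hN1 : 1 ≤ N := by
    have : (1 : ℝ) < N := by linarith
    exact_mod_cast this.le
  have h1 : HasDerivAt (fun ρ : ℝ => (ρ / R) ^ κ) (1 / R * κ * (r / R) ^ (κ - 1)) r :=
    ((hasDerivAt_id r).div_const R).rpow_const (Or.inl (div_pos hr hR).ne')
  have h2 := (h1.const_sub 1).rpow_const (p := -((N - s) / κ)) (Or.inl h.ne')
  have h3 : HasDerivAt (fun r : ℝ => r ^ ((N : ℝ) - s)) (((N : ℝ) - s) * r ^ ((N : ℝ) - s - 1)) r :=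
    Real.hasDerivAt_rpow_const (Or.inl hr.ne')
  refine (h3.mul h2).congr_deriv ?_
  have e : r ^ (N - 1) * (r ^ (-s)) = r ^ ((N : ℝ) - s) / r := by
    rw [← Real.rpow_natCast, ← Real.rpow_add hr, ← Real.rpow_sub_one hr.ne', Nat.cast_sub hN1]
    congr 1; push_cast; ring
  rw [← mul_assoc (r ^ (N - 1)), e, Real.rpow_sub_one h.ne', Real.rpow_sub_one hr.ne',
    Real.rpow_sub_one (by positivity : r / R ≠ 0)]
  field_simp
  ring

theorem stretch_rpow (hR : 0 < R) (hκ : 0 < κ) {r : ℝ} (hr : 0 ≤ r) (hrR : r < R) (a : ℝ) :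
    stretch R κ r ^ a = r ^ a * (1 - (r / R) ^ κ) ^ (-(a / κ)) := by
  have h := one_sub_pos hR hκ hr hrR
  rw [stretch, Real.mul_rpow hr (by positivity), ← Real.rpow_mul h.le]
  congr 2
  ring

/-- The change of variables `squeeze` turns the measure `V₁ dx` on the ball into the measure
`‖x‖ ^ (-s) dx` on the whole space. -/
theorem setLIntegral_ball_potential (hp : 1 < p) (hpN : p < N) (hsp : s < p)
    (hR : 0 < R) {φ : ℝ → ℝ≥0∞} (hφ : Measurable φ) :
    ∫⁻ x in ball (0 : EuclideanSpace ℝ (Fin N)) R, φ ‖x‖ * ENNReal.ofReal (HS.Va N p s R 1 x) =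
      ∫⁻ x : EuclideanSpace ℝ (Fin N), φ (squeeze R (Bliss.kap N p) ‖x‖) *
        ENNReal.ofReal (‖x‖ ^ (-s)) := by
  have hκ := Bliss.kap_pos hp hpN
  have hN : N ≠ 0 := by rintro rfl; norm_num at hpN; linarith
  have : Nonempty (Fin N) := ⟨⟨0, Nat.pos_of_ne_zero hN⟩⟩
  have ha : 0 < (N : ℝ) - s := by linarith
  set κ := Bliss.kap N p with hκdef
  set a : ℝ := (N : ℝ) - s with hadef
  have hψ : Measurable fun m => φ (squeeze R κ (m ^ (1 / a))) :=
    hφ.comp (measurable_squeeze.comp (measurable_id.pow_const _))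
  have hinv : ∀ x : ℝ, 0 ≤ x → (x ^ a) ^ (1 / a) = x := fun x hx => by
    rw [← Real.rpow_mul hx, mul_one_div_cancel ha.ne', Real.rpow_one]
  have hinv' : ∀ x : ℝ, 0 ≤ x → (x ^ (1 / a)) ^ a = x := fun x hx => by
    rw [← Real.rpow_mul hx, one_div_mul_cancel ha.ne', Real.rpow_one]
  let f : ℝ → ℝ := fun r => r ^ a * (1 - (r / R) ^ κ) ^ (-(a / κ))
  let w : ℝ → ℝ := fun r => r ^ (-s) * (1 - (r / R) ^ κ) ^ (-(HS.beta N p s))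
  have hf : ∀ r ∈ Ioo 0 R, f r = stretch R κ r ^ a := fun r hr =>
    (stretch_rpow hR hκ hr.1.le hr.2 a).symm
  have hleft : ∀ r ∈ Ioo 0 R, squeeze R κ (f r ^ (1 / a)) = r := fun r hr => by
    rw [hf r hr, hinv _ (stretch_pos hR hκ hr.1 hr.2).le, squeeze_stretch hR hκ hr.1.le hr.2]
  have himg : f '' Ioo 0 R = Ioi 0 := by
    ext m
    constructor
    · rintro ⟨r, hr, rfl⟩
      rw [hf r hr]
      exact Real.rpow_pos_of_pos (stretch_pos hR hκ hr.1 hr.2) _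
    · intro (hm : 0 < m)
      have hm' : 0 < m ^ (1 / a) := by positivity
      refine ⟨squeeze R κ (m ^ (1 / a)), ⟨squeeze_pos hR hm', squeeze_lt hR hκ hm'.le⟩, ?_⟩
      rw [hf _ ⟨squeeze_pos hR hm', squeeze_lt hR hκ hm'.le⟩, stretch_squeeze hR hκ hm'.le,
        hinv' _ hm.le]
  have key := Rearrangement.lintegral_radial_substitution (N := N) hN (I := Ioo 0 R)
    measurableSet_Ioo (fun r hr => hr.1) (f := f) (w := w) ha (by fun_prop) (by fun_prop)
    (fun r hr => by
      have := one_sub_pos hR hκ hr.1.le hr.2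
      have := hr.1
      positivity)
    (fun r hr => hasDerivAt_rpow_stretch hp hpN hR hr.1 hr.2)
    (fun r hr r' hr' h => by rw [← hleft r hr, ← hleft r' hr', h]) hψ
  rw [himg, ← Rearrangement.lintegral_rpow_norm hN (by linarith : s < N) hψ] at key
  have hset : ({x | ‖x‖ ∈ Ioo 0 R} : Set (EuclideanSpace ℝ (Fin N))) =ᵐ[volume] ball 0 R := by
    have : ∀ᵐ x : EuclideanSpace ℝ (Fin N), x ≠ 0 := by simp [ae_iff]
    filter_upwards [this] with x hx
    refine propext ?_
    change ‖x‖ ∈ Ioo 0 R ↔ x ∈ ball 0 R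
    simp [hx]
  rw [← setLIntegral_congr hset]
  refine Eq.trans ?_ (key.trans ?_)
  · refine setLIntegral_congr_fun ?_ fun x hx => ?_
    · exact measurable_norm measurableSet_Ioo
    · rw [hleft _ hx, HS.Va, one_mul]
      rfl
  · refine lintegral_congr fun x => ?_
    rw [hinv _ (norm_nonneg x)]

end Potential

end BallModel

theorem eventually_abs_le_of_hasFDerivAt {E : Type*} [NormedAddCommGroup E] [NormedSpace ℝ E]
    {h : E → ℝ} {h' : E →L[ℝ] ℝ} {x : E} {c : ℝ} (hh : HasFDerivAt h h' x) (hc : ‖h'‖ < c) :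
    ∀ᶠ ε in 𝓝[>] (0 : ℝ), ∀ y ∈ ball x ε, |h y| ≤ |h x| + c * ε := by
  have h1 := (hasFDerivAt_iff_isLittleO.1 hh).def (sub_pos.2 hc)
  obtain ⟨δ, hδ, hball⟩ := Metric.eventually_nhds_iff.1 h1
  filter_upwards [Ioo_mem_nhdsGT hδ] with ε hε y hy
  have hy1 : ‖y - x‖ < ε := by rwa [← dist_eq_norm]
  have h2 := hball ((mem_ball.1 hy).trans hε.2)
  rw [Real.norm_eq_abs] at h2
  have h3 : |h' (y - x)| ≤ ‖h'‖ * ‖y - x‖ := h'.le_opNorm _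
  have h4 : |h y| ≤ |h x| + |h' (y - x)| + |h y - h x - h' (y - x)| := by
    have : h y = h x + h' (y - x) + (h y - h x - h' (y - x)) := by ring
    calc |h y| = _ := congrArg _ this
      _ ≤ _ := abs_add_three _ _ _
  have h5 : c * ‖y - x‖ ≤ c * ε :=
    mul_le_mul_of_nonneg_left hy1.le ((norm_nonneg _).trans hc.le)
  linarith

theorem le_integral_div_rpow_integral {α : Type*} [MeasurableSpace α] {μ : Measure α} {K r : ℝ}
    (hK : 0 < K) (hr : 0 < r) {F G : α → ℝ} (hF0 : 0 ≤ᵐ[μ] F) (hFm : AEStronglyMeasurable F μ)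
    (hG0 : 0 ≤ᵐ[μ] G) (hG : Integrable G μ) (hF : ∫⁻ x, ENNReal.ofReal (F x) ∂μ ≠ 0)
    (h : ENNReal.ofReal K * (∫⁻ x, ENNReal.ofReal (F x) ∂μ) ^ r ≤ ∫⁻ x, ENNReal.ofReal (G x) ∂μ) :
    K ≤ (∫ x, G x ∂μ) / (∫ x, F x ∂μ) ^ r := by
  have hKF : ∫⁻ x, ENNReal.ofReal (G x) ∂μ ≠ ∞ := by
    rw [← ofReal_integral_eq_lintegral_ofReal hG hG0]; exact ENNReal.ofReal_ne_top
  have hFt : ∫⁻ x, ENNReal.ofReal (F x) ∂μ ≠ ∞ := by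
    intro ht
    rw [ht, ENNReal.top_rpow_of_pos hr, ENNReal.mul_top (by simpa using hK)] at h
    exact hKF (top_le_iff.1 h)
  rw [integral_eq_lintegral_of_nonneg_ae hF0 hFm, integral_eq_lintegral_of_nonneg_ae hG0 hG.1,
    ENNReal.toReal_rpow, le_div_iff₀]
  · have := ENNReal.toReal_mono hKF h
    rwa [ENNReal.toReal_mul, ENNReal.toReal_ofReal hK.le] at this
  · exact ENNReal.toReal_pos (by
      rw [Ne, ENNReal.rpow_eq_zero_iff]
      rintro (h | h)
      · exact hF h.1
      · exact hFt h.1) (ENNReal.rpow_ne_top_of_nonneg hr.le hFt)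

namespace Rearrangement

variable {N : ℕ} {u : EuclideanSpace ℝ (Fin N) → ℝ} {p s : ℝ}

theorem const_mul_rpow_le_fderiv (hN : 2 ≤ N) (hp : 1 < p) (hpN : p < N) (hs : 0 ≤ s) (hsp : s < p)
    (hus : HasCompactSupport u) {L : NNReal} (huL : LipschitzWith L u)
    (hd : ∀ᵐ x, DifferentiableAt ℝ u x) :
    ENNReal.ofReal (Bliss.const N p s) *
        (∫⁻ x, ENNReal.ofReal (|u x| ^ HS.pstar N p s) * ENNReal.ofReal (‖x‖ ^ (-s))) ^
          (p / HS.pstar N p s) ≤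
      ∫⁻ x, ENNReal.ofReal ‖fderiv ℝ u x‖ ^ p := by
  refine const_mul_rpow_le (u := fun x => |u x|) hN hp hpN hs hsp (hus.comp_left abs_zero)
    (L := L) (LipschitzWith.of_dist_le_mul fun x y => ?_) (fun x => abs_nonneg _)
    (measurable_fderiv ℝ u).norm ?_
  · exact (abs_abs_sub_abs_le_abs_sub _ _).trans (huL.dist_le_mul x y)
  · filter_upwards [hd] with x hx c hc using eventually_abs_le_of_hasFDerivAt hx.hasFDerivAt hc

theorem lintegral_rpow_mul_ne_zero {U : Set (EuclideanSpace ℝ (Fin N))} (hU : IsOpen U)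
    (huc : Continuous u) {x₀ : EuclideanSpace ℝ (Fin N)} (hx₀ : x₀ ∈ U) (hu0 : u x₀ ≠ 0) {q : ℝ}
    {w : EuclideanSpace ℝ (Fin N) → ℝ} (hw : ∀ᵐ x ∂volume.restrict U, 0 < w x)
    (hwm : Measurable w) :
    ∫⁻ x in U, ENNReal.ofReal (|u x| ^ q * w x) ≠ 0 := by
  intro h
  have hm : Measurable fun x => ENNReal.ofReal (|u x| ^ q * w x) :=
    ((huc.abs.measurable.pow_const q).mul hwm).ennreal_ofReal
  rw [lintegral_eq_zero_iff hm] at h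
  have h1 : ∀ᵐ x ∂volume.restrict U, u x = 0 := by
    filter_upwards [h, hw] with x hx hwx
    by_contra hux
    have : 0 < |u x| ^ q * w x := mul_pos (Real.rpow_pos_of_pos (abs_pos.2 hux) _) hwx
    simp only [Pi.zero_apply, ENNReal.ofReal_eq_zero] at hx
    linarith
  rw [ae_restrict_iff' hU.measurableSet, ae_iff] at h1
  have hopen : IsOpen (U ∩ {x | u x ≠ 0}) := hU.inter (isOpen_ne_fun huc continuous_const)
  refine (hopen.measure_pos volume ⟨x₀, hx₀, hu0⟩).ne' (measure_mono_null ?_ h1)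
  rintro x ⟨hx, hux⟩ h
  exact hux (h hx)

theorem integrable_norm_fderiv_rpow (hp : 0 < p) (hu : ContDiff ℝ (⊤ : ℕ∞) u)
    (hus : HasCompactSupport u) : Integrable fun x => ‖fderiv ℝ u x‖ ^ p := by
  refine Continuous.integrable_of_hasCompactSupport ?_ ?_
  · exact ((hu.continuous_fderiv (by simp)).norm).rpow_const fun _ => Or.inr hp.le
  · exact (hus.fderiv ℝ).comp_left (g := fun z => ‖z‖ ^ p) (by simp [hp.ne'])

theorem ae_ne_zero (hN : N ≠ 0) : ∀ᵐ x : EuclideanSpace ℝ (Fin N), x ≠ 0 := by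
  have : Nonempty (Fin N) := ⟨⟨0, Nat.pos_of_ne_zero hN⟩⟩
  simp [ae_iff]

/-- The lower bound for the best constant in the Hardy–Sobolev inequality. -/
theorem const_le_HSC (hN : 2 ≤ N) (hp : 1 < p) (hpN : p < N) (hs : 0 ≤ s) (hsp : s < p)
    {u₀ : EuclideanSpace ℝ (Fin N) → ℝ} (hu₀ : ContDiff ℝ (⊤ : ℕ∞) u₀)
    (hus₀ : HasCompactSupport u₀) (hne₀ : u₀ ≠ 0) :
    Bliss.const N p s ≤ HS.HSC N p s := by
  refine le_csInf ⟨_, u₀, ⟨hu₀, hus₀, hne₀⟩, rfl⟩ ?_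
  rintro _ ⟨u, ⟨hu, hus, hne⟩, rfl⟩
  have hN0 : N ≠ 0 := by omega
  have hq := Bliss.pstar_pos hp hpN hsp
  have huc := hu.continuous
  obtain ⟨L, huL⟩ := hu.lipschitzWith_of_hasCompactSupport hus (by simp)
  obtain ⟨x₀, hx₀⟩ := Function.ne_iff.1 hne
  have hwm : Measurable fun x : EuclideanSpace ℝ (Fin N) => ‖x‖ ^ (-s) := by fun_prop
  have hF0 : ∀ x, 0 ≤ |u x| ^ HS.pstar N p s * ‖x‖ ^ (-s) := fun x => by positivity
  refine le_integral_div_rpow_integral (Bliss.const_pos hp hpN hsp) (div_pos (by linarith) hq)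
    (ae_of_all _ hF0) ((huc.abs.measurable.pow_const _).mul hwm).aestronglyMeasurable
    (ae_of_all _ fun x => by positivity) (integrable_norm_fderiv_rpow (by linarith) hu hus) ?_ ?_
  · rw [← Measure.restrict_univ (μ := volume)]
    refine lintegral_rpow_mul_ne_zero isOpen_univ huc (mem_univ x₀) hx₀ ?_ hwm
    rw [Measure.restrict_univ]
    filter_upwards [ae_ne_zero hN0] with x hx using Real.rpow_pos_of_pos (norm_pos_iff.2 hx) _
  · have := const_mul_rpow_le_fderiv hN hp hpN hs hsp hus huL
      (ae_of_all _ fun x => (hu.differentiable (by simp)) x)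
    simpa only [ENNReal.ofReal_rpow_of_nonneg (norm_nonneg _) (by linarith : 0 ≤ p),
      ← ENNReal.ofReal_mul (Real.rpow_nonneg (abs_nonneg _) _)] using this

end Rearrangement

namespace BallModel

variable {N : ℕ} {u : EuclideanSpace ℝ (Fin N) → ℝ} {p s R : ℝ} {e : EuclideanSpace ℝ (Fin N)}

theorem abs_fderiv_le_of_isRadial (hu : Differentiable ℝ u) (hr : HS.IsRadial u) (he : ‖e‖ = 1)
    {x : EuclideanSpace ℝ (Fin N)} (hx : x ≠ 0) :
    |fderiv ℝ u (‖x‖ • e) e| ≤ ‖fderiv ℝ u x‖ := by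
  have hx0 : ‖x‖ ≠ 0 := norm_ne_zero_iff.2 hx
  set e' := ‖x‖⁻¹ • x with he'
  have hn : ‖e'‖ = 1 := by rw [he', norm_smul, norm_inv, norm_norm, inv_mul_cancel₀ hx0]
  have hxe : ‖x‖ • e' = x := by rw [he', smul_smul, mul_inv_cancel₀ hx0, one_smul]
  have hd : ∀ v : EuclideanSpace ℝ (Fin N), HasDerivAt (fun r : ℝ => u (r • v))
      (fderiv ℝ u (‖x‖ • v) v) ‖x‖ := fun v => by
    have h1 : HasDerivAt (fun r : ℝ => r • v) v ‖x‖ := by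
      simpa using (hasDerivAt_id ‖x‖).smul_const v
    exact (hu _).hasFDerivAt.comp_hasDerivAt ‖x‖ h1
  have heq : (fun r : ℝ => u (r • e)) = fun r : ℝ => u (r • e') := by
    funext r
    exact hr _ _ (by rw [norm_smul, norm_smul, he, hn])
  have h2 := hd e
  rw [heq] at h2
  rw [h2.unique (hd e'), hxe]
  simpa [hn] using (fderiv ℝ u x).le_opNorm e'

theorem hasCompactSupport_comp_squeeze {κ R' : ℝ} (hR : 0 < R) (hκ : 0 < κ) (hR' : R' < R)
    (hu : ∀ x, R' ≤ ‖x‖ → u x = 0) (he : ‖e‖ = 1) :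
    HasCompactSupport fun y : EuclideanSpace ℝ (Fin N) => u (squeeze R κ ‖y‖ • e) := by
  refine HasCompactSupport.intro
    (isCompact_closedBall (0 : EuclideanSpace ℝ (Fin N)) (R * (1 - (max R' 0 / R) ^ κ) ^ (-(1 / κ))))
    fun y hy => hu _ ?_
  have h0 := squeeze_nonneg (κ := κ) hR (norm_nonneg y)
  rw [norm_smul, he, mul_one, Real.norm_of_nonneg h0]
  by_contra! h
  refine hy ?_
  have hm : max R' 0 < R := max_lt hR' hR
  have h1 := one_sub_pos hR hκ (le_max_right R' 0) hm
  rw [mem_closedBall_zero_iff, ← stretch_squeeze hR hκ (norm_nonneg y), stretch]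
  have h2 : squeeze R κ ‖y‖ ≤ max R' 0 := h.le.trans (le_max_left _ _)
  refine mul_le_mul (squeeze_lt hR hκ (norm_nonneg y)).le ?_ ?_ hR.le
  · refine Real.rpow_le_rpow_of_nonpos h1 ?_ (by rw [neg_nonpos]; positivity)
    gcongr
  · exact Real.rpow_nonneg (one_sub_pos hR hκ h0 (h2.trans_lt hm)).le _

theorem lipschitzWith_comp_squeeze {κ : ℝ} (hR : 0 < R) (hκ : 0 < κ) {L : NNReal}
    (hu : LipschitzWith L u) (he : ‖e‖ = 1) :
    LipschitzWith L fun y : EuclideanSpace ℝ (Fin N) => u (squeeze R κ ‖y‖ • e) := by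
  refine LipschitzWith.of_dist_le_mul fun x y => (hu.dist_le_mul _ _).trans ?_
  refine mul_le_mul_of_nonneg_left ?_ L.2
  rw [dist_eq_norm, ← sub_smul, norm_smul, he, mul_one, dist_eq_norm]
  exact (abs_squeeze_sub_le hR hκ (norm_nonneg x) (norm_nonneg y)).trans (abs_norm_sub_norm_le x y)

theorem hasFDerivAt_comp_squeeze {κ : ℝ} (hR : 0 < R) (hκ : 0 < κ) (hu : Differentiable ℝ u)
    {y : EuclideanSpace ℝ (Fin N)} (hy : y ≠ 0) :
    HasFDerivAt (fun y : EuclideanSpace ℝ (Fin N) => u (squeeze R κ ‖y‖ • e))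
      ((fderiv ℝ u (squeeze R κ ‖y‖ • e) ((squeeze R κ ‖y‖ / ‖y‖) ^ (κ + 1) • e)) •
        fderiv ℝ (fun z : EuclideanSpace ℝ (Fin N) => ‖z‖) y) y := by
  have h1 : HasDerivAt (fun ρ => squeeze R κ ρ • e) ((squeeze R κ ‖y‖ / ‖y‖) ^ (κ + 1) • e) ‖y‖ :=
    (hasDerivAt_squeeze hR hκ (norm_pos_iff.2 hy)).smul_const e
  have h2 := (hu (squeeze R κ ‖y‖ • e)).hasFDerivAt.comp_hasDerivAt ‖y‖ h1
  exact h2.comp_hasFDerivAt y ((contDiffAt_norm ℝ hy (n := 1)).differentiableAt (by simp)).hasFDerivAt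

theorem norm_fderiv_comp_squeeze_le {κ : ℝ} (hR : 0 < R) (hκ : 0 < κ) (hu : Differentiable ℝ u)
    {y : EuclideanSpace ℝ (Fin N)} (hy : y ≠ 0) :
    ‖fderiv ℝ (fun y : EuclideanSpace ℝ (Fin N) => u (squeeze R κ ‖y‖ • e)) y‖ ≤
      (squeeze R κ ‖y‖ / ‖y‖) ^ (κ + 1) * |fderiv ℝ u (squeeze R κ ‖y‖ • e) e| := by
  rw [(hasFDerivAt_comp_squeeze hR hκ hu hy).fderiv, norm_smul, map_smul, smul_eq_mul,
    Real.norm_eq_abs, abs_mul, abs_of_nonneg (Real.rpow_nonneg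
      (div_nonneg (squeeze_nonneg hR (norm_nonneg y)) (norm_nonneg y)) _)]
  have h1 : ‖fderiv ℝ (fun z : EuclideanSpace ℝ (Fin N) => ‖z‖) y‖ ≤ (1 : NNReal) :=
    norm_fderiv_le_of_lipschitz ℝ lipschitzWith_one_norm
  refine mul_le_of_le_one_right (mul_nonneg (Real.rpow_nonneg
      (div_nonneg (squeeze_nonneg hR (norm_nonneg y)) (norm_nonneg y)) _) (abs_nonneg _)) h1

/-- The change of variables `squeeze` does not increase the energy of radial functions. -/
theorem lintegral_fderiv_comp_squeeze_le (hp : 1 < p) (hpN : p < N) (hR : 0 < R)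
    (hu : ContDiff ℝ (⊤ : ℕ∞) u) (hr : HS.IsRadial u) (he : ‖e‖ = 1) :
    ∫⁻ y, ENNReal.ofReal ‖fderiv ℝ (fun y : EuclideanSpace ℝ (Fin N) =>
        u (squeeze R (Bliss.kap N p) ‖y‖ • e)) y‖ ^ p ≤
      ∫⁻ x in ball 0 R, ENNReal.ofReal ‖fderiv ℝ u x‖ ^ p := by
  have hN : N ≠ 0 := by rintro rfl; norm_num at hpN; linarith
  have hp0 : 0 ≤ p := by linarith
  have hκ := Bliss.kap_pos hp hpN
  have hd := hu.differentiable (by simp)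
  have hβ : (Bliss.kap N p + 1) * p = Bliss.kap N p * HS.beta N p 0 := by
    have : 0 < (N : ℝ) - p := by linarith
    have : 0 < p - 1 := by linarith
    rw [HS.beta, Bliss.kap]; field_simp; ring
  set κ := Bliss.kap N p with hκd
  let φ : ℝ → ℝ≥0∞ := fun r =>
    ENNReal.ofReal (|fderiv ℝ u (r • e) e| ^ p * (1 - (r / R) ^ κ) ^ HS.beta N p 0)
  have hφ : Measurable φ := by
    have h1 : Continuous fun r : ℝ => |fderiv ℝ u (r • e) e| :=
      (((hu.continuous_fderiv (by simp)).comp (continuous_id.smul continuous_const)).clm_apply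
        continuous_const).abs
    have h2 := h1.measurable
    fun_prop
  have key := setLIntegral_ball_potential (s := 0) hp hpN (by linarith) hR hφ
  calc _ ≤ ∫⁻ y : EuclideanSpace ℝ (Fin N), φ (squeeze R κ ‖y‖) * ENNReal.ofReal (‖y‖ ^ (-(0 : ℝ))) := by
        refine lintegral_mono_ae ?_
        filter_upwards [Rearrangement.ae_ne_zero hN] with y hy
        have hy0 := norm_pos_iff.2 hy
        have h1 := norm_fderiv_comp_squeeze_le (e := e) hR hκ hd hy
        have ht := one_add_pos (κ := κ) hR hy0.le
        have hpos := squeeze_nonneg (κ := κ) hR hy0.le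
        rw [neg_zero, Real.rpow_zero, ENNReal.ofReal_one, mul_one,
          ENNReal.ofReal_rpow_of_nonneg (norm_nonneg _) hp0]
        refine ENNReal.ofReal_le_ofReal ((Real.rpow_le_rpow (norm_nonneg _) h1 hp0).trans_eq ?_)
        have e1 : squeeze R κ ‖y‖ / ‖y‖ = (1 + (‖y‖ / R) ^ κ) ^ (-(1 / κ)) := by
          rw [squeeze]; field_simp
        rw [Real.mul_rpow (by positivity) (abs_nonneg _), ← Real.rpow_mul (by positivity), hβ,
          one_sub_squeeze hR hκ hy0.le, e1, ← Real.rpow_mul ht.le, Real.inv_rpow ht.le,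
          ← Real.rpow_neg ht.le, mul_comm]
        congr 2
        field_simp
    _ = _ := key.symm
    _ ≤ _ := by
        refine setLIntegral_mono_ae' measurableSet_ball ?_
        filter_upwards [Rearrangement.ae_ne_zero hN] with x hx hxR
        have h1 := one_sub_pos hR hκ (norm_nonneg x) (mem_ball_zero_iff.1 hxR)
        rw [ENNReal.ofReal_rpow_of_nonneg (norm_nonneg _) hp0, HS.Va, neg_zero, Real.rpow_zero,
          one_mul, one_mul, ← ENNReal.ofReal_mul (by positivity)]
        refine ENNReal.ofReal_le_ofReal ?_
        have e1 : (1 - (‖x‖ / R) ^ κ) ^ HS.beta N p 0 *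
            (1 - (‖x‖ / R) ^ (((N : ℝ) - p) / (p - 1))) ^ (-HS.beta N p 0) = 1 := by
          rw [show ((N : ℝ) - p) / (p - 1) = κ from rfl, ← Real.rpow_add h1, add_neg_cancel,
            Real.rpow_zero]
        rw [mul_assoc, e1, mul_one]
        exact Real.rpow_le_rpow (abs_nonneg _) (abs_fderiv_le_of_isRadial hd hr he hx) hp0

theorem measurable_potential : Measurable (HS.Va N p s R 1) := by
  unfold HS.Va; fun_prop

theorem potential_pos (hp : 1 < p) (hpN : p < N) (hR : 0 < R) {x : EuclideanSpace ℝ (Fin N)}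
    (hx : x ≠ 0) (hxR : ‖x‖ < R) : 0 < HS.Va N p s R 1 x := by
  have h1 := one_sub_pos hR (Bliss.kap_pos hp hpN) (norm_nonneg x) hxR
  rw [HS.Va, one_mul]
  exact mul_pos (Real.rpow_pos_of_pos (norm_pos_iff.2 hx) _) (Real.rpow_pos_of_pos h1 _)

/-- The improved Hardy–Sobolev inequality for radial functions on the ball. -/
theorem const_le_quotV (hN : 2 ≤ N) (hp : 1 < p) (hpN : p < N) (hs : 0 ≤ s) (hsp : s < p)
    (hR : 0 < R) (hu : HS.IsTest N R u) (hr : HS.IsRadial u) (hne : u ≠ 0) :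
    Bliss.const N p s ≤ HS.quotV N p s R 1 u := by
  obtain ⟨hu, hus, huR⟩ := hu
  have hN0 : N ≠ 0 := by omega
  have hp0 : 0 ≤ p := by linarith
  have hq := Bliss.pstar_pos hp hpN hsp
  have hκ := Bliss.kap_pos hp hpN
  have huc := hu.continuous
  have hd := hu.differentiable (by simp)
  obtain ⟨L, huL⟩ := hu.lipschitzWith_of_hasCompactSupport hus (by simp)
  obtain ⟨x₀, hx₀⟩ := Function.ne_iff.1 hne
  obtain ⟨R', hR', huR'⟩ := exists_lt_subset_ball (isClosed_tsupport u) huR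
  let e : EuclideanSpace ℝ (Fin N) := EuclideanSpace.single ⟨0, by omega⟩ 1
  have he : ‖e‖ = 1 := by simp [e]
  have hpos : ∀ᵐ x ∂volume.restrict (ball (0 : EuclideanSpace ℝ (Fin N)) R),
      0 < HS.Va N p s R 1 x := by
    rw [ae_restrict_iff' measurableSet_ball]
    filter_upwards [Rearrangement.ae_ne_zero hN0] with x hx hxR
    exact potential_pos hp hpN hR hx (mem_ball_zero_iff.1 hxR)
  refine le_integral_div_rpow_integral (Bliss.const_pos hp hpN hsp) (div_pos (by linarith) hq)
    ?_ ((huc.abs.measurable.pow_const _).mul measurable_potential).aestronglyMeasurable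
    (ae_of_all _ fun x => by positivity)
    (Rearrangement.integrable_norm_fderiv_rpow (by linarith) hu hus).integrableOn ?_ ?_
  · filter_upwards [hpos] with x hx using by positivity
  · exact Rearrangement.lintegral_rpow_mul_ne_zero isOpen_ball huc
      (huR (subset_tsupport u hx₀)) hx₀ hpos measurable_potential
  · have h1 := Rearrangement.const_mul_rpow_le_fderiv hN hp hpN hs hsp
      (hasCompactSupport_comp_squeeze (e := e) hR hκ hR' (fun x hx => by
        by_contra h
        exact absurd (mem_ball_zero_iff.1 (huR' (subset_tsupport u h))) (not_lt.2 hx)) he)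
      (lipschitzWith_comp_squeeze hR hκ huL he) (by
        filter_upwards [Rearrangement.ae_ne_zero hN0] with y hy using
          (hasFDerivAt_comp_squeeze hR hκ hd hy).differentiableAt)
    have h2 := h1.trans (lintegral_fderiv_comp_squeeze_le hp hpN hR hu hr he)
    have hφ : Measurable fun r : ℝ => ENNReal.ofReal (|u (r • e)| ^ HS.pstar N p s) := by
      have : Measurable fun r : ℝ => |u (r • e)| :=
        (huc.comp (continuous_id.smul continuous_const)).abs.measurable
      fun_prop
    rw [← setLIntegral_ball_potential hp hpN hsp hR hφ] at h2
    simp only [ENNReal.ofReal_rpow_of_nonneg (norm_nonneg _) hp0,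
      ← ENNReal.ofReal_mul (Real.rpow_nonneg (abs_nonneg _) _)] at h2
    refine Eq.trans_le ?_ h2
    congr 2
    refine lintegral_congr fun x => ?_
    rw [hr x (‖x‖ • e) (by rw [norm_smul, he, norm_norm, mul_one])]

end BallModel

namespace BallModel

variable {N : ℕ} {p s R lam : ℝ}

/-- The radial change of variables under which `Ulam` becomes a power of the Bliss density. -/
def massVar (N : ℕ) (p s R lam r : ℝ) : ℝ :=
  lam ^ ((N : ℝ) - s) * (r ^ ((N : ℝ) - s) *
    (1 - (r / R) ^ Bliss.kap N p) ^ (-((N - s) / Bliss.kap N p)))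

theorem massVar_nonneg (hp : 1 < p) (hpN : p < N) (hR : 0 < R) (hlam : 0 < lam) {r : ℝ}
    (hr : 0 ≤ r) (hrR : r < R) : 0 ≤ massVar N p s R lam r := by
  have h := one_sub_pos hR (Bliss.kap_pos hp hpN) hr hrR
  unfold massVar; positivity

theorem massVar_pos (hp : 1 < p) (hpN : p < N) (hR : 0 < R) (hlam : 0 < lam) {r : ℝ}
    (hr : 0 < r) (hrR : r < R) : 0 < massVar N p s R lam r := by
  have h := one_sub_pos hR (Bliss.kap_pos hp hpN) hr.le hrR
  unfold massVar; positivity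

theorem massVar_squeeze (hp : 1 < p) (hpN : p < N) (hR : 0 < R) {ρ : ℝ} (hρ : 0 ≤ ρ) :
    massVar N p s R lam (squeeze R (Bliss.kap N p) ρ) =
      lam ^ ((N : ℝ) - s) * ρ ^ ((N : ℝ) - s) := by
  have hκ := Bliss.kap_pos hp hpN
  rw [massVar, ← stretch_rpow hR hκ (squeeze_nonneg hR hρ) (squeeze_lt hR hκ hρ),
    stretch_squeeze hR hκ hρ]

theorem measurable_massVar : Measurable (massVar N p s R lam) := by
  unfold massVar; fun_prop

theorem massVar_rpow_expo (hp : 1 < p) (hpN : p < N) (hsp : s < p) (hR : 0 < R) (hlam : 0 < lam)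
    {r : ℝ} (hr : 0 ≤ r) (hrR : r < R) :
    massVar N p s R lam r ^ Bliss.expo N p s = (lam * r) ^ ((p - s) / (p - 1)) *
      (1 - (r / R) ^ (((N : ℝ) - p) / (p - 1))) ^ (-((p - s) / ((N : ℝ) - p))) := by
  have h := one_sub_pos hR (Bliss.kap_pos hp hpN) hr hrR
  have h1 : 0 < p - 1 := by linarith
  have h2 : 0 < (N : ℝ) - s := by linarith
  have h3 : 0 < (N : ℝ) - p := by linarith
  rw [massVar, Real.mul_rpow (by positivity) (by positivity),
    Real.mul_rpow (by positivity) (by positivity), ← Real.rpow_mul hlam.le, ← Real.rpow_mul hr,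
    ← Real.rpow_mul h.le, Real.mul_rpow hlam.le hr, mul_assoc]
  have e1 : ((N : ℝ) - s) * Bliss.expo N p s = (p - s) / (p - 1) := by
    rw [Bliss.expo]; field_simp
  have e2 : -((N - s) / Bliss.kap N p) * Bliss.expo N p s = -((p - s) / ((N : ℝ) - p)) := by
    rw [Bliss.expo, Bliss.kap]; field_simp
  rw [e1, e2]
  rfl

theorem Ulam_eq (hp : 1 < p) (hpN : p < N) (hsp : s < p) (hR : 0 < R) (hlam : 0 < lam)
    {x : EuclideanSpace ℝ (Fin N)} (hx : ‖x‖ < R) :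
    Ulam N p s R lam x = lam ^ (((N : ℝ) - p) / p) *
      (1 + massVar N p s R lam ‖x‖ ^ Bliss.expo N p s) ^ (-(((N : ℝ) - p) / (p - s))) := by
  rw [Ulam, if_pos hx, massVar_rpow_expo hp hpN hsp hR hlam (norm_nonneg x) hx]

theorem Ulam_rpow_pstar (hp : 1 < p) (hpN : p < N) (hsp : s < p) (hR : 0 < R) (hlam : 0 < lam)
    {x : EuclideanSpace ℝ (Fin N)} (hx : ‖x‖ < R) :
    Ulam N p s R lam x ^ HS.pstar N p s = lam ^ ((N : ℝ) - s) *
      Bliss.density (Bliss.expo N p s) (Bliss.dim N p s) (massVar N p s R lam ‖x‖) := by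
  have hm := massVar_nonneg (s := s) hp hpN hR hlam (norm_nonneg x) hx
  have h1 : 0 < p - s := by linarith
  have h3 : 0 < (N : ℝ) - p := by linarith
  rw [Ulam_eq hp hpN hsp hR hlam hx, Real.mul_rpow (by positivity) (by positivity),
    ← Real.rpow_mul hlam.le, ← Real.rpow_mul (by positivity), Bliss.density]
  congr 2 <;> rw [HS.pstar]
  · field_simp
  · rw [Bliss.dim]; field_simp

/-- Integrals of functions of `massVar` over the ball with respect to the potential `V₁`. -/
theorem setLIntegral_comp_massVar (hp : 1 < p) (hpN : p < N) (hsp : s < p) (hR : 0 < R)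
    (hlam : 0 < lam) {F : ℝ → ℝ} (hF : Measurable F) (hF0 : ∀ m, 0 < m → 0 ≤ F m)
    (hFi : IntegrableOn F (Ioi 0)) :
    ∫⁻ x in ball (0 : EuclideanSpace ℝ (Fin N)) R,
        ENNReal.ofReal (lam ^ ((N : ℝ) - s) * F (massVar N p s R lam ‖x‖)) *
          ENNReal.ofReal (HS.Va N p s R 1 x) =
      ENNReal.ofReal (Bliss.sphereConst N s * ∫ m in Ioi 0, F m) := by
  have hN : N ≠ 0 := by rintro rfl; norm_num at hpN; linarith
  have hL : 0 < lam ^ ((N : ℝ) - s) := by positivity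
  rw [setLIntegral_ball_potential (φ := fun r => ENNReal.ofReal (lam ^ ((N : ℝ) - s) *
      F (massVar N p s R lam r))) hp hpN hsp hR
    ((measurable_const.mul (hF.comp measurable_massVar)).ennreal_ofReal)]
  have e1 : ∀ x : EuclideanSpace ℝ (Fin N),
      massVar N p s R lam (squeeze R (Bliss.kap N p) ‖x‖) =
        lam ^ ((N : ℝ) - s) * ‖x‖ ^ ((N : ℝ) - s) := fun x =>
    massVar_squeeze hp hpN hR (norm_nonneg x)
  simp only [e1]
  rw [Rearrangement.lintegral_rpow_norm (ψ := fun m => ENNReal.ofReal (lam ^ ((N : ℝ) - s) *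
      F (lam ^ ((N : ℝ) - s) * m))) hN (by linarith)
    ((measurable_const.mul (hF.comp (measurable_const.mul measurable_id))).ennreal_ofReal)]
  set Λ := lam ^ ((N : ℝ) - s)
  have hi : IntegrableOn (fun m => Λ * F (Λ * m)) (Ioi 0) := by
    have := (integrableOn_Ioi_comp_mul_left_iff F 0 hL).2 (by rwa [mul_zero])
    exact this.const_mul Λ
  rw [← ofReal_integral_eq_lintegral_ofReal hi ((ae_restrict_iff' measurableSet_Ioi).2
    (ae_of_all _ fun m (hm : 0 < m) => mul_nonneg hL.le (hF0 _ (mul_pos hL hm)))),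
    integral_const_mul, integral_comp_mul_left_Ioi F 0 hL, mul_zero, smul_eq_mul,
    mul_inv_cancel_left₀ hL.ne', ENNReal.ofReal_mul (Bliss.sphereConst_pos hp hpN hsp).le]
  rfl

end BallModel

namespace BallModel

variable {N : ℕ} {p s R lam : ℝ}

theorem profile_deriv_rpow (hp : 1 < p) (hpN : p < N) (hsp : s < p) (hlam : 0 < lam) {r h y : ℝ}
    (hr : 0 < r) (hh : 0 < h) (hy : 0 < y) {m : ℝ}
    (hm : m = lam ^ ((N : ℝ) - s) * (r ^ ((N : ℝ) - s) * h ^ (-((N - s) / Bliss.kap N p)))) :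
    (lam ^ (((N : ℝ) - p) / p) * (((N : ℝ) - p) / (p - s) * y ^ (-(((N : ℝ) - p) / (p - s)) - 1) *
        (Bliss.expo N p s * m ^ (Bliss.expo N p s - 1) * (lam ^ ((N : ℝ) - s) *
          ((N - s) * (r ^ (N - 1) * (r ^ (-s) * h ^ (-(HS.beta N p s))))))))) ^ p =
      lam ^ ((N : ℝ) - s) * (Bliss.kap N p ^ p * (m ^ Bliss.expo N p s * y ^ (-Bliss.dim N p s))) *
        (r ^ (-s) * h ^ (-(HS.beta N p s))) := by
  have h1 : 0 < p - s := by linarith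
  have h2 : 0 < p - 1 := by linarith
  have h3 : 0 < (N : ℝ) - p := by linarith
  have h4 : 0 < (N : ℝ) - s := by linarith
  have hp0 : 0 < p := by linarith
  have hN1 : 1 ≤ N := by
    rcases Nat.eq_zero_or_pos N with rfl | h
    · norm_num at hpN; linarith
    · exact h
  have hκ := Bliss.kap_pos hp hpN
  obtain ⟨l, rfl⟩ : ∃ l, Real.exp l = lam := ⟨_, Real.exp_log hlam⟩
  obtain ⟨ρ, rfl⟩ : ∃ l, Real.exp l = r := ⟨_, Real.exp_log hr⟩
  obtain ⟨η, rfl⟩ : ∃ l, Real.exp l = h := ⟨_, Real.exp_log hh⟩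
  obtain ⟨τ, rfl⟩ : ∃ l, Real.exp l = y := ⟨_, Real.exp_log hy⟩
  simp only [← Real.exp_mul, ← Real.exp_add] at hm
  rw [hm, ← Real.rpow_natCast, Nat.cast_sub hN1, Nat.cast_one]
  simp only [← Real.exp_mul, ← Real.exp_add]
  have e : ∀ A B C D E F G : ℝ, Real.exp A * (B * Real.exp C * (D * Real.exp E * (Real.exp F *
      ((N - s) * Real.exp G)))) = B * D * (N - s) * Real.exp (A + C + E + F + G) := by
    intros; simp only [Real.exp_add]; ring
  have e' : ∀ A B C G : ℝ, Real.exp A * (B * Real.exp C) * Real.exp G = B * Real.exp (A + C + G) := by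
    intros; simp only [Real.exp_add]; ring
  have e2 : ((N : ℝ) - p) / (p - s) * Bliss.expo N p s * (N - s) = Bliss.kap N p := by
    rw [Bliss.expo, Bliss.kap]; field_simp
  rw [e, e', e2, Real.mul_rpow hκ.le (Real.exp_pos _).le, ← Real.exp_mul]
  congr 2
  rw [Bliss.expo, Bliss.kap, Bliss.dim, HS.beta]
  field_simp
  ring

/-- The profile of `Ulam`. -/
def profile (N : ℕ) (p s R lam r : ℝ) : ℝ :=
  lam ^ (((N : ℝ) - p) / p) *
    (1 + massVar N p s R lam r ^ Bliss.expo N p s) ^ (-(((N : ℝ) - p) / (p - s)))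

theorem hasDerivAt_profile (hp : 1 < p) (hpN : p < N) (hR : 0 < R) (hlam : 0 < lam)
    {r : ℝ} (hr : 0 < r) (hrR : r < R) :
    HasDerivAt (profile N p s R lam) (-(lam ^ (((N : ℝ) - p) / p) * (((N : ℝ) - p) / (p - s) *
      (1 + massVar N p s R lam r ^ Bliss.expo N p s) ^ (-(((N : ℝ) - p) / (p - s)) - 1) *
        (Bliss.expo N p s * massVar N p s R lam r ^ (Bliss.expo N p s - 1) * (lam ^ ((N : ℝ) - s) *
          ((N - s) * (r ^ (N - 1) * (r ^ (-s) *
            (1 - (r / R) ^ Bliss.kap N p) ^ (-(HS.beta N p s)))))))))) r := by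
  have hm := massVar_pos (s := s) hp hpN hR hlam hr hrR
  have h1 := ((hasDerivAt_rpow_stretch (s := s) hp hpN hR hr hrR).const_mul
    (lam ^ ((N : ℝ) - s))).rpow_const (p := Bliss.expo N p s) (Or.inl hm.ne')
  have h2 := ((h1.const_add 1).rpow_const (p := -(((N : ℝ) - p) / (p - s))) (Or.inl
    (by have := Real.rpow_nonneg hm.le (Bliss.expo N p s); unfold massVar at this; positivity))).const_mul
      (lam ^ (((N : ℝ) - p) / p))
  refine h2.congr_deriv ?_
  rw [massVar]
  ring

section

variable (hp : 1 < p) (hpN : p < N) (hsp : s < p) (hR : 0 < R) (hlam : 0 < lam)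
  {x : EuclideanSpace ℝ (Fin N)}

include hp hpN hsp hR hlam

theorem hasFDerivAt_Ulam (hx0 : x ≠ 0) (hxR : ‖x‖ < R) :
    HasFDerivAt (Ulam N p s R lam)
      (deriv (profile N p s R lam) ‖x‖ • fderiv ℝ (fun y : EuclideanSpace ℝ (Fin N) => ‖y‖) x) x := by
  have h1 := (hasDerivAt_profile (s := s) hp hpN hR hlam (norm_pos_iff.2 hx0) hxR)
  have h2 : HasFDerivAt (fun y : EuclideanSpace ℝ (Fin N) => ‖y‖) _ x :=
    ((contDiffAt_norm ℝ hx0).differentiableAt one_ne_zero).hasFDerivAt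
  refine (h1.differentiableAt.hasDerivAt.comp_hasFDerivAt x h2).congr_of_eventuallyEq ?_
  filter_upwards [(continuous_norm.isOpen_preimage _ isOpen_Iio).mem_nhds hxR] with y hy
  exact Ulam_eq hp hpN hsp hR hlam hy

theorem norm_gradient_Ulam_rpow (hx0 : x ≠ 0) (hxR : ‖x‖ < R) :
    ‖gradient (Ulam N p s R lam) x‖ ^ p = lam ^ ((N : ℝ) - s) * (Bliss.kap N p ^ p *
      (massVar N p s R lam ‖x‖ ^ Bliss.expo N p s * Bliss.density (Bliss.expo N p s)
        (Bliss.dim N p s) (massVar N p s R lam ‖x‖))) * HS.Va N p s R 1 x := by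
  have hr := norm_pos_iff.2 hx0
  have : Nontrivial (EuclideanSpace ℝ (Fin N)) := ⟨x, 0, hx0⟩
  have hm := massVar_pos (s := s) hp hpN hR hlam hr hxR
  have hh := one_sub_pos hR (Bliss.kap_pos hp hpN) hr.le hxR
  have h1 : 0 < p - s := by linarith
  have h3 : 0 < (N : ℝ) - p := by linarith
  have h4 : 0 < (N : ℝ) - s := by linarith
  have hk := Bliss.expo_pos hp hpN hsp
  rw [gradient, LinearIsometryEquiv.norm_map, (hasFDerivAt_Ulam hp hpN hsp hR hlam hx0 hxR).fderiv,
    norm_smul, norm_fderiv_norm ((contDiffAt_norm ℝ hx0).differentiableAt one_ne_zero), mul_one,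
    (hasDerivAt_profile hp hpN hR hlam hr hxR).deriv, norm_neg, Real.norm_of_nonneg
      (by positivity),
    profile_deriv_rpow (m := massVar N p s R lam ‖x‖) hp hpN hsp hlam hr hh (by positivity) rfl, HS.Va, one_mul]
  rfl

theorem contDiffAt_Ulam (hx0 : x ≠ 0) (hxR : ‖x‖ < R) :
    ContDiffAt ℝ (⊤ : ℕ∞) (Ulam N p s R lam) x := by
  have hr := norm_pos_iff.2 hx0
  have hm := massVar_pos (s := s) hp hpN hR hlam hr hxR
  have hh := one_sub_pos hR (Bliss.kap_pos hp hpN) hr.le hxR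
  have h0 : ContDiffAt ℝ (⊤ : ℕ∞) (fun y : EuclideanSpace ℝ (Fin N) => ‖y‖) x :=
    contDiffAt_norm ℝ hx0
  have h1 : ContDiffAt ℝ (⊤ : ℕ∞)
      (fun y : EuclideanSpace ℝ (Fin N) => massVar N p s R lam ‖y‖) x := by
    unfold massVar
    refine contDiffAt_const.mul ((h0.rpow_const_of_ne hr.ne').mul
      ((contDiffAt_const.sub ((h0.div_const R).rpow_const_of_ne (by positivity))).rpow_const_of_ne
        hh.ne'))
  have h2 : ContDiffAt ℝ (⊤ : ℕ∞)
      (fun y : EuclideanSpace ℝ (Fin N) => profile N p s R lam ‖y‖) x := by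
    unfold profile
    exact contDiffAt_const.mul ((contDiffAt_const.add
      (h1.rpow_const_of_ne hm.ne')).rpow_const_of_ne (by positivity))
  refine h2.congr_of_eventuallyEq ?_
  filter_upwards [(continuous_norm.isOpen_preimage _ isOpen_Iio).mem_nhds hxR] with y hy
  exact Ulam_eq hp hpN hsp hR hlam hy

theorem Ulam_pos (hxR : ‖x‖ < R) : 0 < Ulam N p s R lam x := by
  have hm := massVar_nonneg (s := s) hp hpN hR hlam (norm_nonneg x) hxR
  rw [Ulam_eq hp hpN hsp hR hlam hxR]
  positivity

theorem Ulam_nonneg (x : EuclideanSpace ℝ (Fin N)) : 0 ≤ Ulam N p s R lam x := by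
  by_cases hxR : ‖x‖ < R
  · exact (Ulam_pos hp hpN hsp hR hlam hxR).le
  · simp [Ulam, hxR]

theorem Ulam_lt (hx0 : x ≠ 0) : Ulam N p s R lam x < lam ^ (((N : ℝ) - p) / p) := by
  by_cases hxR : ‖x‖ < R
  · have hm := massVar_pos (s := s) hp hpN hR hlam (norm_pos_iff.2 hx0) hxR
    have h3 : 0 < (N : ℝ) - p := by linarith
    have h1 : 0 < p - s := by linarith
    rw [Ulam_eq hp hpN hsp hR hlam hxR]
    refine mul_lt_of_lt_one_right (by positivity) (Real.rpow_lt_one_of_one_lt_of_neg ?_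
      (neg_lt_zero.2 (by positivity)))
    have := Real.rpow_pos_of_pos hm (Bliss.expo N p s)
    linarith
  · simp only [Ulam, hxR, if_false]
    positivity

omit hpN hlam in
theorem Ulam_zero : Ulam N p s R lam 0 = lam ^ (((N : ℝ) - p) / p) := by
  have h1 : 0 < p - s := by linarith
  have h2 : 0 < p - 1 := by linarith
  rw [Ulam, if_pos (by simpa using hR), norm_zero, mul_zero,
    Real.zero_rpow (by positivity), zero_mul, add_zero, Real.one_rpow, mul_one]

theorem continuous_Ulam : Continuous (Ulam N p s R lam) := by
  have h1 : 0 < p - s := by linarith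
  have h2 : 0 < p - 1 := by linarith
  have h3 : 0 < (N : ℝ) - p := by linarith
  have hκ : 0 < ((N : ℝ) - p) / (p - 1) := by positivity
  set h : EuclideanSpace ℝ (Fin N) → ℝ := fun x => max (1 - (‖x‖ / R) ^ (((N : ℝ) - p) / (p - 1))) 0
  set Z : EuclideanSpace ℝ (Fin N) → ℝ := fun x =>
    h x ^ ((p - s) / ((N : ℝ) - p)) + (lam * ‖x‖) ^ ((p - s) / (p - 1))
  have hh : Continuous h := by
    refine (continuous_const.sub ((continuous_norm.div_const R).rpow_const fun _ =>
      Or.inr hκ.le)).max continuous_const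
  have hZ : Continuous Z := (hh.rpow_const fun _ => Or.inr (by positivity)).add
    ((continuous_const.mul continuous_norm).rpow_const fun _ => Or.inr (by positivity))
  have hh0 : ∀ x, 0 ≤ h x := fun x => le_max_right _ _
  have hZ0 : ∀ x, 0 < Z x := fun x => by
    rcases eq_or_ne x 0 with rfl | hx
    · have : h 0 = 1 := by simp [h, Real.zero_rpow hκ.ne']
      have h0 : Z 0 = 1 := by
        simp only [Z, this, Real.one_rpow, norm_zero, mul_zero]
        rw [Real.zero_rpow (by positivity), add_zero]
      rw [h0]; exact one_pos
    · have := norm_pos_iff.2 hx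
      have := hh0 x
      simp only [Z]
      positivity
  have e : Ulam N p s R lam = fun x => lam ^ (((N : ℝ) - p) / p) *
      (h x * Z x ^ (-(((N : ℝ) - p) / (p - s)))) := by
    funext x
    rw [Ulam]
    split_ifs with hx
    · have hpos : 0 < 1 - (‖x‖ / R) ^ (((N : ℝ) - p) / (p - 1)) :=
        one_sub_pos hR hκ (norm_nonneg x) hx
      have hx1 : h x = 1 - (‖x‖ / R) ^ (((N : ℝ) - p) / (p - 1)) := max_eq_left hpos.le
      rw [← hx1] at hpos ⊢
      have e1 : 1 + (lam * ‖x‖) ^ ((p - s) / (p - 1)) * h x ^ (-((p - s) / ((N : ℝ) - p))) =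
          h x ^ (-((p - s) / ((N : ℝ) - p))) * Z x := by
        simp only [Z]
        rw [mul_add, ← Real.rpow_add hpos, neg_add_cancel, Real.rpow_zero]
        ring
      rw [e1, Real.mul_rpow (by positivity) (hZ0 x).le, ← Real.rpow_mul hpos.le]
      congr 2
      rw [show -((p - s) / ((N : ℝ) - p)) * -(((N : ℝ) - p) / (p - s)) = 1 by field_simp,
        Real.rpow_one]
    · have : h x = 0 := max_eq_right (by
        have : 1 ≤ (‖x‖ / R) ^ (((N : ℝ) - p) / (p - 1)) :=
          Real.one_le_rpow (by rw [one_le_div hR]; exact not_lt.1 hx) hκ.le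
        linarith)
      rw [this]; ring
  rw [e]
  exact continuous_const.mul (hh.mul (hZ.rpow_const fun x => Or.inl (hZ0 x).ne'))

end

end BallModel

theorem integrable_of_lintegral_ofReal_eq {α : Type*} [MeasurableSpace α] {μ : Measure α}
    {f : α → ℝ} {c : ℝ} (hf : AEStronglyMeasurable f μ) (hf0 : 0 ≤ᵐ[μ] f) (hc : 0 ≤ c)
    (h : ∫⁻ x, ENNReal.ofReal (f x) ∂μ = ENNReal.ofReal c) :
    Integrable f μ ∧ ∫ x, f x ∂μ = c := by
  refine ⟨⟨hf, ?_⟩, ?_⟩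
  · rw [hasFiniteIntegral_iff_ofReal hf0, h]
    exact ENNReal.ofReal_lt_top
  · rw [integral_eq_lintegral_of_nonneg_ae hf0 hf, h, ENNReal.toReal_ofReal hc]

namespace BallModel

variable {N : ℕ} {p s R lam : ℝ}

theorem measurable_gradient_norm_rpow (u : EuclideanSpace ℝ (Fin N) → ℝ) :
    Measurable fun x => ‖gradient u x‖ ^ p := by
  have : (fun x => ‖gradient u x‖ ^ p) = fun x => ‖fderiv ℝ u x‖ ^ p := by
    funext x; rw [gradient, LinearIsometryEquiv.norm_map]
  rw [this]
  exact (measurable_fderiv ℝ u).norm.pow_const p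

section

variable (hp : 1 < p) (hpN : p < N) (hsp : s < p) (hR : 0 < R) (hlam : 0 < lam)

include hp hpN hsp hR hlam

theorem integral_gradient_Ulam :
    IntegrableOn (fun x => ‖gradient (Ulam N p s R lam) x‖ ^ p) (ball 0 R) ∧
      ∫ x in ball 0 R, ‖gradient (Ulam N p s R lam) x‖ ^ p = Bliss.energy N p s := by
  have hN : N ≠ 0 := by rintro rfl; norm_num at hpN; linarith
  refine integrable_of_lintegral_ofReal_eq (measurable_gradient_norm_rpow _).aestronglyMeasurable
    (ae_of_all _ fun x => by positivity) (Bliss.energy_pos hp hpN hsp).le ?_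
  have hk := Bliss.expo_pos hp hpN hsp
  have hκ := Bliss.kap_pos hp hpN
  have h := setLIntegral_comp_massVar (F := fun m => Bliss.kap N p ^ p *
    (m ^ Bliss.expo N p s * Bliss.density (Bliss.expo N p s) (Bliss.dim N p s) m))
    hp hpN hsp hR hlam (by unfold Bliss.density; fun_prop)
    (fun m hm => by have := (Bliss.density_pos (k := Bliss.expo N p s) (n := Bliss.dim N p s) hm.le).le; positivity)
    ((Bliss.integrableOn_rpow_mul_density hk
      (Bliss.one_lt_expo_mul_dim_sub_one hp hpN hsp)).const_mul _)
  rw [integral_const_mul, ← mul_assoc, mul_comm (Bliss.sphereConst N s), mul_assoc] at h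
  rw [Bliss.energy, ← h]
  refine setLIntegral_congr_fun_ae measurableSet_ball ?_
  filter_upwards [Rearrangement.ae_ne_zero hN] with x hx hxR
  rw [mem_ball_zero_iff] at hxR
  have := massVar_nonneg (s := s) hp hpN hR hlam (norm_nonneg x) hxR
  have := (Bliss.density_pos (k := Bliss.expo N p s) (n := Bliss.dim N p s) this).le
  rw [norm_gradient_Ulam_rpow hp hpN hsp hR hlam hx hxR, ENNReal.ofReal_mul (by positivity)]

theorem integral_Ulam_rpow_pstar :
    ∫ x in ball 0 R, |Ulam N p s R lam x| ^ HS.pstar N p s * HS.Va N p s R 1 x =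
      Bliss.mass N p s := by
  refine (integrable_of_lintegral_ofReal_eq (((continuous_Ulam hp hpN hsp hR
    hlam).abs.measurable.pow_const _).mul measurable_potential).aestronglyMeasurable ?_
    (Bliss.mass_pos hp hpN hsp).le ?_).2
  · have hN : N ≠ 0 := by rintro rfl; norm_num at hpN; linarith
    refine (ae_restrict_iff' measurableSet_ball).2 ?_
    filter_upwards [Rearrangement.ae_ne_zero hN] with x hx hxR
    rw [mem_ball_zero_iff] at hxR
    have := (potential_pos (s := s) hp hpN hR hx hxR).le
    exact mul_nonneg (by positivity) this
  have hk := Bliss.expo_pos hp hpN hsp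
  have h := setLIntegral_comp_massVar (F := Bliss.density (Bliss.expo N p s) (Bliss.dim N p s))
    hp hpN hsp hR hlam (by unfold Bliss.density; fun_prop)
    (fun m hm => (Bliss.density_pos hm.le).le)
    (Bliss.integrableOn_density_self hk
      (Bliss.one_lt_expo_mul_dim_sub_one hp hpN hsp))
  rw [Bliss.mass, ← h]
  refine setLIntegral_congr_fun measurableSet_ball fun x hxR => ?_
  rw [mem_ball_zero_iff] at hxR
  rw [Pi.mul_apply, abs_of_nonneg (Ulam_nonneg hp hpN hsp hR hlam x), Ulam_rpow_pstar hp hpN hsp hR hlam hxR,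
    ENNReal.ofReal_mul]
  have := massVar_nonneg (s := s) hp hpN hR hlam (norm_nonneg x) hxR
  have := (Bliss.density_pos (k := Bliss.expo N p s) (n := Bliss.dim N p s) this).le
  positivity

/-- The truncation of the mass density that appears when the weight `‖x‖ ^ (-s)` replaces `V₁`. -/
theorem integral_Ulam_rpow_pstar_mul_rpow :
    IntegrableOn (fun x => |Ulam N p s R lam x| ^ HS.pstar N p s * ‖x‖ ^ (-s)) (ball 0 R) ∧
    ∫ x in ball 0 R, |Ulam N p s R lam x| ^ HS.pstar N p s * ‖x‖ ^ (-s) =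
      Bliss.sphereConst N s * ∫ m in Ioi 0, Bliss.density (Bliss.expo N p s) (Bliss.dim N p s) m *
        (1 + (m ^ (1 / ((N : ℝ) - s)) / (lam * R)) ^ Bliss.kap N p) ^ (-(HS.beta N p s)) := by
  have hκ := Bliss.kap_pos hp hpN
  have hk := Bliss.expo_pos hp hpN hsp
  have ha : 0 < (N : ℝ) - s := by linarith
  have hβ : 0 ≤ HS.beta N p s := by
    refine div_nonneg ?_ (by linarith)
    nlinarith
  set F := fun m => Bliss.density (Bliss.expo N p s) (Bliss.dim N p s) m *
        (1 + (m ^ (1 / ((N : ℝ) - s)) / (lam * R)) ^ Bliss.kap N p) ^ (-(HS.beta N p s)) with hF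
  have hFm : Measurable F := by unfold F Bliss.density; fun_prop
  have hF0 : ∀ m, 0 ≤ m → 0 ≤ F m := fun m hm => by
    have := (Bliss.density_pos (k := Bliss.expo N p s) (n := Bliss.dim N p s) hm).le
    simp only [F]
    positivity
  have hFi : IntegrableOn F (Ioi 0) := by
    refine Integrable.mono' (Bliss.integrableOn_density_self hk
      (Bliss.one_lt_expo_mul_dim_sub_one hp hpN hsp)) hFm.aestronglyMeasurable
      ((ae_restrict_iff' measurableSet_Ioi).2 (ae_of_all _ fun m hm => ?_))
    have hm' : 0 ≤ m := le_of_lt hm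
    rw [Real.norm_of_nonneg (hF0 m hm')]
    refine mul_le_of_le_one_right (Bliss.density_pos hm').le
      (Real.rpow_le_one_of_one_le_of_nonpos ?_ (neg_nonpos.2 hβ))
    have : 0 ≤ (m ^ (1 / ((N : ℝ) - s)) / (lam * R)) ^ Bliss.kap N p := by positivity
    linarith
  refine integrable_of_lintegral_ofReal_eq (((continuous_Ulam hp hpN hsp hR
    hlam).abs.measurable.pow_const _).mul (measurable_norm.pow_const _)).aestronglyMeasurable
    (ae_of_all _ fun x => by simp only [Pi.zero_apply]; positivity)
    (mul_nonneg (Bliss.sphereConst_pos hp hpN hsp).le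
      (setIntegral_nonneg measurableSet_Ioi fun m hm => hF0 m (le_of_lt hm))) ?_
  rw [← setLIntegral_comp_massVar hp hpN hsp hR hlam hFm (fun m hm => hF0 m hm.le) hFi]
  refine setLIntegral_congr_fun measurableSet_ball fun x hxR => ?_
  rw [mem_ball_zero_iff] at hxR
  have hm := massVar_nonneg (s := s) hp hpN hR hlam (norm_nonneg x) hxR
  have hh := one_sub_pos hR hκ (norm_nonneg x) hxR
  rw [← ENNReal.ofReal_mul (mul_nonneg (by positivity) (hF0 _ hm)),
    abs_of_nonneg (Ulam_nonneg hp hpN hsp hR hlam x), Ulam_rpow_pstar hp hpN hsp hR hlam hxR, hF]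
  simp only
  have e1 : massVar N p s R lam ‖x‖ ^ (1 / ((N : ℝ) - s)) = lam * stretch R (Bliss.kap N p) ‖x‖ := by
    have h0 : 0 ≤ stretch R (Bliss.kap N p) ‖x‖ := by unfold stretch; positivity
    rw [massVar, ← stretch_rpow hR hκ (norm_nonneg x) hxR, ← Real.mul_rpow hlam.le h0,
      ← Real.rpow_mul (by positivity), mul_one_div_cancel ha.ne', Real.rpow_one]
  rw [e1, mul_div_mul_left _ _ hlam.ne', div_rpow_stretch hR hκ (norm_nonneg x) hxR,
    show 1 + (‖x‖ / R) ^ Bliss.kap N p / (1 - (‖x‖ / R) ^ Bliss.kap N p) =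
      (1 - (‖x‖ / R) ^ Bliss.kap N p)⁻¹ by field_simp; ring,
    Real.inv_rpow hh.le, ← Real.rpow_neg hh.le, neg_neg, HS.Va, one_mul]
  change _ = ENNReal.ofReal (_ * (_ * _) * (_ * (1 - (‖x‖ / R) ^ Bliss.kap N p) ^ _))
  congr 1
  rw [Real.rpow_neg hh.le]
  field_simp

end

theorem tendsto_integral_truncated_density (hp : 1 < p) (hpN : p < N) (hsp : s < p) (hR : 0 < R) :
    Tendsto (fun lam : ℝ => ∫ m in Ioi 0, Bliss.density (Bliss.expo N p s) (Bliss.dim N p s) m *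
        (1 + (m ^ (1 / ((N : ℝ) - s)) / (lam * R)) ^ Bliss.kap N p) ^ (-(HS.beta N p s))) atTop
      (𝓝 (∫ m in Ioi 0, Bliss.density (Bliss.expo N p s) (Bliss.dim N p s) m)) := by
  have hκ := Bliss.kap_pos hp hpN
  have hk := Bliss.expo_pos hp hpN hsp
  have hβ : 0 ≤ HS.beta N p s := by
    refine div_nonneg ?_ (by linarith)
    nlinarith
  refine tendsto_integral_filter_of_dominated_convergence _ (Eventually.of_forall fun lam => by
      unfold Bliss.density; fun_prop) ?_ (Bliss.integrableOn_density_self hk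
      (Bliss.one_lt_expo_mul_dim_sub_one hp hpN hsp)) ?_
  · filter_upwards [eventually_gt_atTop 0] with lam hlam
    refine (ae_restrict_iff' measurableSet_Ioi).2 (ae_of_all _ fun m hm => ?_)
    have hm' : 0 ≤ m := le_of_lt hm
    have hd := (Bliss.density_pos (k := Bliss.expo N p s) (n := Bliss.dim N p s) hm').le
    rw [Real.norm_of_nonneg (by positivity)]
    refine mul_le_of_le_one_right hd
      (Real.rpow_le_one_of_one_le_of_nonpos ?_ (neg_nonpos.2 hβ))
    have : 0 ≤ (m ^ (1 / ((N : ℝ) - s)) / (lam * R)) ^ Bliss.kap N p := by positivity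
    linarith
  · refine ae_of_all _ fun m => ?_
    have h1 : Tendsto (fun lam : ℝ => m ^ (1 / ((N : ℝ) - s)) / (lam * R)) atTop (𝓝 0) :=
      tendsto_const_nhds.div_atTop (tendsto_id.atTop_mul_const hR)
    have h2 := h1.rpow_const (p := Bliss.kap N p) (Or.inr hκ.le)
    rw [Real.zero_rpow hκ.ne'] at h2
    have h3 := ((h2.const_add 1).rpow_const (p := -(HS.beta N p s)) (Or.inl (by norm_num))).const_mul
      (Bliss.density (Bliss.expo N p s) (Bliss.dim N p s) m)
    simpa using h3

end BallModel

namespace Truncation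

/-- A smooth cutoff of the interval `(δ, M - δ)`. -/
def cutoff (M δ t : ℝ) : ℝ :=
  Real.smoothTransition (t / δ - 1) * Real.smoothTransition ((M - t) / δ - 1)

/-- A smooth truncation of the identity, constant near `0` and near `M`. -/
def trunc (M δ z : ℝ) : ℝ := ∫ t in (0)..z, cutoff M δ t

variable {M δ : ℝ}

theorem contDiff_cutoff : ContDiff ℝ (⊤ : ℕ∞) (cutoff M δ) := by
  unfold cutoff
  exact (Real.smoothTransition.contDiff.comp ((contDiff_id.div_const δ).sub contDiff_const)).mul
    (Real.smoothTransition.contDiff.comp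
      (((contDiff_const.sub contDiff_id).div_const δ).sub contDiff_const))

theorem continuous_cutoff : Continuous (cutoff M δ) := contDiff_cutoff.continuous

theorem cutoff_nonneg (t : ℝ) : 0 ≤ cutoff M δ t :=
  mul_nonneg (Real.smoothTransition.nonneg _) (Real.smoothTransition.nonneg _)

theorem cutoff_le_one (t : ℝ) : cutoff M δ t ≤ 1 :=
  mul_le_one₀ (Real.smoothTransition.le_one _) (Real.smoothTransition.nonneg _)
    (Real.smoothTransition.le_one _)

theorem cutoff_eq_zero_of_le (hδ : 0 < δ) {t : ℝ} (ht : t ≤ δ) : cutoff M δ t = 0 := by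
  rw [cutoff, Real.smoothTransition.zero_of_nonpos, zero_mul]
  rw [sub_nonpos, div_le_one hδ]; exact ht

theorem cutoff_eq_zero_of_ge (hδ : 0 < δ) {t : ℝ} (ht : M - δ ≤ t) : cutoff M δ t = 0 := by
  rw [cutoff, Real.smoothTransition.zero_of_nonpos (x := (M - t) / δ - 1), mul_zero]
  rw [sub_nonpos, div_le_one hδ]; linarith

theorem tendsto_cutoff {ι : Type*} {l : Filter ι} {δ : ι → ℝ} (hδ : ∀ i, 0 < δ i)
    (hδ0 : Tendsto δ l (𝓝 0)) {t : ℝ} (ht : 0 < t) (htM : t < M) :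
    Tendsto (fun i => cutoff M (δ i) t) l (𝓝 1) := by
  refine tendsto_const_nhds.congr' ?_
  filter_upwards [hδ0.eventually_lt_const (half_pos ht),
    hδ0.eventually_lt_const (half_pos (sub_pos.2 htM))] with i h1 h2
  rw [cutoff, Real.smoothTransition.one_of_one_le, Real.smoothTransition.one_of_one_le, mul_one]
  · rw [le_sub_iff_add_le, le_div_iff₀ (hδ i)]; linarith
  · rw [le_sub_iff_add_le, le_div_iff₀ (hδ i)]; linarith

theorem hasDerivAt_trunc (z : ℝ) : HasDerivAt (trunc M δ) (cutoff M δ z) z :=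
  (continuous_cutoff.integral_hasStrictDerivAt 0 z).hasDerivAt

theorem contDiff_trunc : ContDiff ℝ (⊤ : ℕ∞) (trunc M δ) := by
  refine contDiff_infty_iff_deriv.2 ⟨fun z => (hasDerivAt_trunc z).differentiableAt, ?_⟩
  rw [show deriv (trunc M δ) = cutoff M δ from funext fun z => (hasDerivAt_trunc z).deriv]
  exact contDiff_cutoff

theorem trunc_nonneg {z : ℝ} (hz : 0 ≤ z) : 0 ≤ trunc M δ z :=
  intervalIntegral.integral_nonneg hz fun t _ => cutoff_nonneg t

theorem trunc_le {z : ℝ} (hz : 0 ≤ z) : trunc M δ z ≤ z := by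
  have := intervalIntegral.integral_mono_on hz (continuous_cutoff.intervalIntegrable 0 z)
    (continuous_const.intervalIntegrable 0 z) (μ := volume) (f := cutoff M δ) (g := fun _ => 1)
    fun t _ => cutoff_le_one t
  simpa [trunc] using this

theorem trunc_eq_zero (hδ : 0 < δ) {z : ℝ} (hz : z ≤ δ) : trunc M δ z = 0 := by
  rw [trunc, intervalIntegral.integral_congr (g := fun _ => 0) fun t ht =>
    cutoff_eq_zero_of_le hδ (ht.2.trans (max_le hδ.le hz)), intervalIntegral.integral_zero]

theorem trunc_eq_of_ge (hδ : 0 < δ) {z w : ℝ} (hz : M - δ ≤ z) (hw : M - δ ≤ w) :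
    trunc M δ z = trunc M δ w := by
  rw [← sub_eq_zero, trunc, trunc, intervalIntegral.integral_interval_sub_left
    (continuous_cutoff.intervalIntegrable _ _) (continuous_cutoff.intervalIntegrable _ _),
    intervalIntegral.integral_congr (g := fun _ => 0) fun t ht =>
      cutoff_eq_zero_of_ge hδ ((le_min hw hz).trans ht.1), intervalIntegral.integral_zero]

theorem tendsto_trunc {δ : ℕ → ℝ} (hδ : ∀ i, 0 < δ i)
    (hδ0 : Tendsto δ atTop (𝓝 0)) {z : ℝ} (hz : 0 ≤ z) (hzM : z ≤ M) :
    Tendsto (fun i => trunc M (δ i) z) atTop (𝓝 z) := by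
  have := intervalIntegral.tendsto_integral_filter_of_dominated_convergence (μ := volume) (a := 0)
    (b := z) (F := fun i => cutoff M (δ i)) (f := fun _ => 1) (l := atTop) (fun _ => 1)
    (Eventually.of_forall fun i => continuous_cutoff.aestronglyMeasurable)
    (Eventually.of_forall fun i => ae_of_all _ fun t _ => by
      rw [Real.norm_of_nonneg (cutoff_nonneg t)]; exact cutoff_le_one t)
    (continuous_const.intervalIntegrable 0 z) ?_
  · simpa [trunc] using this
  · filter_upwards [show ∀ᵐ t : ℝ, t ≠ z by simp [ae_iff]] with t ht htz
    rw [uIoc_of_le hz] at htz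
    exact tendsto_cutoff hδ hδ0 htz.1 ((lt_of_le_of_ne htz.2 ht).trans_le hzM)

variable {N : ℕ} {R : ℝ} {U : EuclideanSpace ℝ (Fin N) → ℝ}

theorem contDiff_trunc_comp (hδ : 0 < δ) (hUc : Continuous U) (hU0 : U 0 = M)
    (hUR : ∀ x, R ≤ ‖x‖ → U x = 0)
    (hUd : ∀ x, x ≠ 0 → ‖x‖ < R → ContDiffAt ℝ (⊤ : ℕ∞) U x) :
    ContDiff ℝ (⊤ : ℕ∞) fun x => trunc M δ (U x) := by
  rw [contDiff_iff_contDiffAt]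
  intro x
  rcases eq_or_ne x 0 with rfl | hx
  · refine (contDiffAt_const (c := trunc M δ M)).congr_of_eventuallyEq ?_
    filter_upwards [hUc.continuousAt.eventually_const_lt
      (show M - δ < U 0 by linarith)] with y hy
    exact trunc_eq_of_ge hδ hy.le (by linarith)
  by_cases hxR : ‖x‖ < R
  · exact contDiff_trunc.contDiffAt.comp x (hUd x hx hxR)
  · refine (contDiffAt_const (c := (0 : ℝ))).congr_of_eventuallyEq ?_
    filter_upwards [hUc.continuousAt.eventually_lt_const
      (show U x < δ by rwa [hUR x (not_lt.1 hxR)])] with y hy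
    exact trunc_eq_zero hδ hy.le

theorem isTest_trunc_comp (hδ : 0 < δ) (hUc : Continuous U) (hU0 : U 0 = M)
    (hUR : ∀ x, R ≤ ‖x‖ → U x = 0)
    (hUd : ∀ x, x ≠ 0 → ‖x‖ < R → ContDiffAt ℝ (⊤ : ℕ∞) U x) :
    HS.IsTest N R fun x => trunc M δ (U x) := by
  have hcl : IsClosed {x | δ ≤ U x} := isClosed_le continuous_const hUc
  have hsub : {x | δ ≤ U x} ⊆ ball 0 R := fun x hx => by
    rw [mem_ball_zero_iff]
    by_contra! h
    have : δ ≤ U x := hx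
    rw [hUR x h] at this
    linarith
  have hsupp : Function.support (fun x => trunc M δ (U x)) ⊆ {x | δ ≤ U x} := fun x hx => by
    by_contra h
    exact hx (trunc_eq_zero hδ (not_le.1 h).le)
  refine ⟨contDiff_trunc_comp hδ hUc hU0 hUR hUd, ?_, (closure_minimal hsupp hcl).trans hsub⟩
  exact HasCompactSupport.of_support_subset_isCompact ((isCompact_closedBall 0 R).of_isClosed_subset
    hcl (hsub.trans ball_subset_closedBall)) hsupp

theorem gradient_trunc_comp {x : EuclideanSpace ℝ (Fin N)} (hU : DifferentiableAt ℝ U x) :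
    gradient (fun x => trunc M δ (U x)) x = cutoff M δ (U x) • gradient U x := by
  have := (hasDerivAt_trunc (M := M) (δ := δ) (U x)).comp_hasFDerivAt x hU.hasFDerivAt
  rw [gradient, show fderiv ℝ (fun x => trunc M δ (U x)) x = _ from this.fderiv, gradient]
  simp

end Truncation

namespace Truncation

variable {N : ℕ} {p s R lam : ℝ}

theorem measurable_gradient (u : EuclideanSpace ℝ (Fin N) → ℝ) : Measurable (gradient u) :=
  (InnerProductSpace.toDual ℝ (EuclideanSpace ℝ (Fin N))).symm.continuous.measurable.comp
    (measurable_fderiv ℝ u)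

/-- Smooth approximations of `Ulam` by test functions. -/
def approx (N : ℕ) (p s R lam : ℝ) (n : ℕ) (x : EuclideanSpace ℝ (Fin N)) : ℝ :=
  trunc (lam ^ (((N : ℝ) - p) / p)) (1 / ((n : ℝ) + 1)) (Ulam N p s R lam x)

theorem one_div_pos_seq (n : ℕ) : 0 < 1 / ((n : ℝ) + 1) := by positivity

theorem ae_ball (hp : 1 < p) (hpN : p < N) : ∀ᵐ x ∂volume.restrict (ball (0 : EuclideanSpace ℝ (Fin N)) R),
    x ≠ 0 ∧ ‖x‖ < R := by
  have hN : N ≠ 0 := by rintro rfl; norm_num at hpN; linarith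
  refine (ae_restrict_iff' measurableSet_ball).2 ?_
  filter_upwards [Rearrangement.ae_ne_zero hN] with x hx hxR
  exact ⟨hx, by simpa using hxR⟩

section

variable (hp : 1 < p) (hpN : p < N) (hsp : s < p) (hR : 0 < R) (hlam : 0 < lam)

include hp hpN hsp hR hlam

theorem isTest_approx (n : ℕ) : HS.IsTest N R (approx N p s R lam n) :=
  isTest_trunc_comp (one_div_pos_seq n) (BallModel.continuous_Ulam hp hpN hsp hR hlam)
    (BallModel.Ulam_zero hp hsp hR)
    (fun x hx => by rw [Ulam, if_neg (not_lt.2 hx)])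
    (fun x hx hxR => BallModel.contDiffAt_Ulam hp hpN hsp hR hlam hx hxR)

theorem approx_nonneg (n : ℕ) (x : EuclideanSpace ℝ (Fin N)) : 0 ≤ approx N p s R lam n x :=
  trunc_nonneg (BallModel.Ulam_nonneg hp hpN hsp hR hlam x)

theorem approx_le (n : ℕ) (x : EuclideanSpace ℝ (Fin N)) :
    approx N p s R lam n x ≤ Ulam N p s R lam x :=
  trunc_le (BallModel.Ulam_nonneg hp hpN hsp hR hlam x)

theorem Ulam_le (x : EuclideanSpace ℝ (Fin N)) :
    Ulam N p s R lam x ≤ lam ^ (((N : ℝ) - p) / p) := by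
  rcases eq_or_ne x 0 with rfl | hx
  · exact (BallModel.Ulam_zero hp hsp hR).le
  · exact (BallModel.Ulam_lt hp hpN hsp hR hlam hx).le

theorem tendsto_approx (x : EuclideanSpace ℝ (Fin N)) :
    Tendsto (fun n => approx N p s R lam n x) atTop (𝓝 (Ulam N p s R lam x)) :=
  tendsto_trunc one_div_pos_seq tendsto_one_div_add_atTop_nhds_zero_nat
    (BallModel.Ulam_nonneg hp hpN hsp hR hlam x) (Ulam_le hp hpN hsp hR hlam x)

theorem gradient_approx (n : ℕ) {x : EuclideanSpace ℝ (Fin N)} (hx : x ≠ 0) (hxR : ‖x‖ < R) :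
    gradient (approx N p s R lam n) x =
      cutoff (lam ^ (((N : ℝ) - p) / p)) (1 / ((n : ℝ) + 1)) (Ulam N p s R lam x) •
        gradient (Ulam N p s R lam) x :=
  gradient_trunc_comp ((BallModel.contDiffAt_Ulam hp hpN hsp hR hlam hx hxR).differentiableAt
    (by simp))

theorem tendsto_cutoff_Ulam {x : EuclideanSpace ℝ (Fin N)} (hx : x ≠ 0) (hxR : ‖x‖ < R) :
    Tendsto (fun n : ℕ => cutoff (lam ^ (((N : ℝ) - p) / p)) (1 / ((n : ℝ) + 1))
      (Ulam N p s R lam x)) atTop (𝓝 1) :=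
  tendsto_cutoff one_div_pos_seq tendsto_one_div_add_atTop_nhds_zero_nat
    (BallModel.Ulam_pos hp hpN hsp hR hlam hxR) (BallModel.Ulam_lt hp hpN hsp hR hlam hx)

/-- `Ulam` belongs to the Sobolev space `W₀^{1,p}` of the ball, with its classical gradient. -/
theorem memW_Ulam : HS.MemW N p R (Ulam N p s R lam) (gradient (Ulam N p s R lam)) := by
  have hp0 : 0 < p := by linarith
  have hae := ae_ball (R := R) hp hpN
  refine ⟨approx N p s R lam, isTest_approx hp hpN hsp hR hlam, ?_, ?_⟩
  · rw [← integral_zero (EuclideanSpace ℝ (Fin N)) ℝ (μ := volume.restrict (ball 0 R))]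
    refine tendsto_integral_of_dominated_convergence _ (fun n =>
      (((measurable_gradient _).sub (measurable_gradient _)).norm.pow_const
        p).aestronglyMeasurable)
      (BallModel.integral_gradient_Ulam hp hpN hsp hR hlam).1 (fun n => ?_) ?_
    · filter_upwards [hae] with x hx
      rw [Real.norm_of_nonneg (by positivity), gradient_approx hp hpN hsp hR hlam n hx.1 hx.2]
      refine Real.rpow_le_rpow (norm_nonneg _) ?_ hp0.le
      set c := cutoff (lam ^ (((N : ℝ) - p) / p)) (1 / ((n : ℝ) + 1)) (Ulam N p s R lam x)
      have hc0 : 0 ≤ c := cutoff_nonneg _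
      have hc1 : c ≤ 1 := cutoff_le_one _
      rw [show ∀ v : EuclideanSpace ℝ (Fin N), c • v - v = (c - 1) • v from fun v => by
        rw [sub_smul, one_smul], norm_smul]
      refine mul_le_of_le_one_left (norm_nonneg _) ?_
      rw [Real.norm_eq_abs, abs_le]
      constructor <;> linarith
    · filter_upwards [hae] with x hx
      simp only [gradient_approx hp hpN hsp hR hlam _ hx.1 hx.2]
      have h1 := ((((tendsto_cutoff_Ulam hp hpN hsp hR hlam hx.1 hx.2).smul_const
        (gradient (Ulam N p s R lam) x)).sub_const (gradient (Ulam N p s R lam) x)).norm).rpow_const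
        (p := p) (Or.inr hp0.le)
      simpa [Real.zero_rpow hp0.ne'] using h1
  · rw [← integral_zero (EuclideanSpace ℝ (Fin N)) ℝ (μ := volume.restrict (ball 0 R))]
    have hUm := (BallModel.continuous_Ulam hp hpN hsp hR hlam).measurable
    refine tendsto_integral_of_dominated_convergence
      (fun _ => (lam ^ (((N : ℝ) - p) / p)) ^ p) (fun n => ?_)
      (integrableOn_const measure_ball_lt_top.ne) (fun n => ae_of_all _ fun x => ?_)
      (ae_of_all _ fun x => ?_)
    · exact (((isTest_approx hp hpN hsp hR hlam n).1.continuous.measurable.sub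
        hUm).abs.pow_const p).aestronglyMeasurable
    · rw [Real.norm_of_nonneg (by positivity)]
      have h1 := approx_nonneg hp hpN hsp hR hlam n x
      have h2 := approx_le hp hpN hsp hR hlam n x
      have h3 := Ulam_le hp hpN hsp hR hlam x
      refine Real.rpow_le_rpow (abs_nonneg _) (abs_le.2 ⟨?_, ?_⟩) hp0.le <;> linarith
    · have h1 := (((tendsto_approx hp hpN hsp hR hlam x).sub_const
        (Ulam N p s R lam x)).abs).rpow_const (p := p) (Or.inr hp0.le)
      simpa [Real.zero_rpow hp0.ne'] using h1

theorem quotW_Ulam : HS.quotW N p s R 1 (Ulam N p s R lam) (gradient (Ulam N p s R lam)) =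
    Bliss.const N p s := by
  rw [HS.quotW, HS.denomV, (BallModel.integral_gradient_Ulam hp hpN hsp hR hlam).2,
    BallModel.integral_Ulam_rpow_pstar hp hpN hsp hR hlam, Bliss.const]

theorem integral_fderiv_approx_le (n : ℕ) :
    ∫ x, ‖fderiv ℝ (approx N p s R lam n) x‖ ^ p ≤ Bliss.energy N p s := by
  have hp0 : 0 < p := by linarith
  rw [← (BallModel.integral_gradient_Ulam hp hpN hsp hR hlam).2,
    ← setIntegral_eq_integral_of_forall_compl_eq_zero (s := ball 0 R)]
  · refine integral_mono_of_nonneg (ae_of_all _ fun x => by positivity)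
      (BallModel.integral_gradient_Ulam hp hpN hsp hR hlam).1 ?_
    filter_upwards [ae_ball hp hpN] with x hx
    have : ‖fderiv ℝ (approx N p s R lam n) x‖ = ‖gradient (approx N p s R lam n) x‖ := by
      rw [gradient, LinearIsometryEquiv.norm_map]
    rw [this, gradient_approx hp hpN hsp hR hlam n hx.1 hx.2, norm_smul,
      Real.norm_of_nonneg (cutoff_nonneg _)]
    exact Real.rpow_le_rpow (mul_nonneg (cutoff_nonneg _) (norm_nonneg _))
      (mul_le_of_le_one_left (norm_nonneg _) (cutoff_le_one _)) hp0.le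
  · intro x hx
    have : fderiv ℝ (approx N p s R lam n) x = 0 := by
      by_contra h
      exact hx ((isTest_approx hp hpN hsp hR hlam n).2.2 (support_fderiv_subset ℝ h))
    rw [this, norm_zero, Real.zero_rpow hp0.ne']

theorem tendsto_integral_approx :
    Tendsto (fun n => ∫ x, |approx N p s R lam n x| ^ HS.pstar N p s * ‖x‖ ^ (-s)) atTop
      (𝓝 (∫ x in ball 0 R, |Ulam N p s R lam x| ^ HS.pstar N p s * ‖x‖ ^ (-s))) := by
  have hq := Bliss.pstar_pos hp hpN hsp
  have e : ∀ n, ∫ x, |approx N p s R lam n x| ^ HS.pstar N p s * ‖x‖ ^ (-s) =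
      ∫ x in ball 0 R, |approx N p s R lam n x| ^ HS.pstar N p s * ‖x‖ ^ (-s) := fun n => by
    rw [setIntegral_eq_integral_of_forall_compl_eq_zero]
    intro x hx
    have : approx N p s R lam n x = 0 := by
      by_contra h
      exact hx ((isTest_approx hp hpN hsp hR hlam n).2.2 (subset_tsupport _ h))
    rw [this, abs_zero, Real.zero_rpow hq.ne', zero_mul]
  simp only [e]
  refine tendsto_integral_of_dominated_convergence _ (fun n =>
    (((isTest_approx hp hpN hsp hR hlam n).1.continuous.abs.measurable.pow_const _).mul
      (measurable_norm.pow_const _)).aestronglyMeasurable)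
    (BallModel.integral_Ulam_rpow_pstar_mul_rpow hp hpN hsp hR hlam).1
    (fun n => ae_of_all _ fun x => ?_) (ae_of_all _ fun x => ?_)
  · have h1 := approx_nonneg hp hpN hsp hR hlam n x
    have h2 := approx_le hp hpN hsp hR hlam n x
    rw [Real.norm_of_nonneg (by positivity), abs_of_nonneg h1, abs_of_nonneg (h1.trans h2)]
    gcongr
  · exact (((tendsto_approx hp hpN hsp hR hlam x).abs).rpow_const (Or.inr hq.le)).mul_const _

theorem eventually_approx_ne_zero
    (hD : 0 < ∫ x in ball 0 R, |Ulam N p s R lam x| ^ HS.pstar N p s * ‖x‖ ^ (-s)) :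
    ∀ᶠ n in atTop, approx N p s R lam n ≠ 0 := by
  filter_upwards [(tendsto_integral_approx hp hpN hsp hR hlam).eventually_const_lt hD] with n hn h
  have hq := Bliss.pstar_pos hp hpN hsp
  simp [h, Real.zero_rpow hq.ne'] at hn

theorem HSC_le
    (hD : 0 < ∫ x in ball 0 R, |Ulam N p s R lam x| ^ HS.pstar N p s * ‖x‖ ^ (-s)) :
    HS.HSC N p s ≤ Bliss.energy N p s /
      (∫ x in ball 0 R, |Ulam N p s R lam x| ^ HS.pstar N p s * ‖x‖ ^ (-s)) ^
        (p / HS.pstar N p s) := by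
  have hq := Bliss.pstar_pos hp hpN hsp
  have hT := tendsto_integral_approx hp hpN hsp hR hlam
  refine ge_of_tendsto (tendsto_const_nhds.div (hT.rpow_const (Or.inl hD.ne'))
    (Real.rpow_pos_of_pos hD _).ne') ?_
  filter_upwards [eventually_approx_ne_zero hp hpN hsp hR hlam hD] with n hn
  have hb : BddBelow ((fun u : HS.Euc N → ℝ => (∫ x : HS.Euc N, ‖fderiv ℝ u x‖ ^ p) /
      (∫ x : HS.Euc N, |u x| ^ HS.pstar N p s * ‖x‖ ^ (-s)) ^ (p / HS.pstar N p s)) ''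
      {u : HS.Euc N → ℝ | ContDiff ℝ (⊤ : ℕ∞) u ∧ HasCompactSupport u ∧ u ≠ 0}) := by
    refine ⟨0, ?_⟩
    rintro _ ⟨u, -, rfl⟩
    exact div_nonneg (integral_nonneg fun x => by positivity)
      (Real.rpow_nonneg (integral_nonneg fun x => by positivity) _)
  have ht := isTest_approx hp hpN hsp hR hlam n
  refine (csInf_le hb ⟨_, ⟨ht.1, ht.2.1, hn⟩, rfl⟩).trans ?_
  exact div_le_div_of_nonneg_right (integral_fderiv_approx_le hp hpN hsp hR hlam n)
    (Real.rpow_nonneg (integral_nonneg fun x => by positivity) _)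

end

theorem HSC_eq_const (hN : 2 ≤ N) (hp : 1 < p) (hpN : p < N) (hs : 0 ≤ s) (hsp : s < p) :
    HS.HSC N p s = Bliss.const N p s := by
  have hM := Bliss.mass_pos hp hpN hsp
  have hT : Tendsto (fun lam : ℝ => ∫ x in ball (0 : EuclideanSpace ℝ (Fin N)) 1,
      |Ulam N p s 1 lam x| ^ HS.pstar N p s * ‖x‖ ^ (-s)) atTop (𝓝 (Bliss.mass N p s)) := by
    refine ((BallModel.tendsto_integral_truncated_density hp hpN hsp one_pos).const_mul
      (Bliss.sphereConst N s)).congr' ?_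
    filter_upwards [eventually_gt_atTop 0] with lam hlam
    exact (BallModel.integral_Ulam_rpow_pstar_mul_rpow hp hpN hsp one_pos hlam).2.symm
  have hev : ∀ᶠ lam : ℝ in atTop, 0 < lam ∧ 0 < ∫ x in ball (0 : EuclideanSpace ℝ (Fin N)) 1,
      |Ulam N p s 1 lam x| ^ HS.pstar N p s * ‖x‖ ^ (-s) :=
    (eventually_gt_atTop 0).and (hT.eventually_const_lt hM)
  refine le_antisymm ?_ ?_
  · refine ge_of_tendsto (tendsto_const_nhds.div (hT.rpow_const (Or.inl hM.ne'))
      (Real.rpow_pos_of_pos hM _).ne') ?_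
    filter_upwards [hev] with lam hlam
    exact HSC_le hp hpN hsp one_pos hlam.1 hlam.2
  · obtain ⟨lam, hlam, hD⟩ := hev.exists
    obtain ⟨n, hn⟩ := (eventually_approx_ne_zero hp hpN hsp one_pos hlam hD).exists
    have ht := isTest_approx hp hpN hsp one_pos hlam n
    exact Rearrangement.const_le_HSC hN hp hpN hs hsp ht.1 ht.2.1 hn

end Truncation

end

/-- for every `λ > 0`, `U^λ` is a minimizer of the quotient with `a = 1`
over nonzero radial functions in `W_0^{1,p}(B_R)`, with value `C_{N,p,s}`. -/
theorem Ulam_minimizer (N : ℕ) (p s R lam : ℝ) (hN : 2 ≤ N) (hp : 1 < p)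
    (hpN : p < (N : ℝ)) (hs : 0 ≤ s) (hsp : s < p) (hR : 0 < R) (hlam : 0 < lam) :
    (∃ g : HS.Euc N → HS.Euc N, HS.MemW N p R (Ulam N p s R lam) g ∧
        HS.quotW N p s R 1 (Ulam N p s R lam) g = HS.HSC N p s) ∧
      ∀ u : HS.Euc N → ℝ, HS.IsTest N R u → HS.IsRadial u → u ≠ 0 →
        HS.HSC N p s ≤ HS.quotV N p s R 1 u := by
  have hC := Truncation.HSC_eq_const hN hp hpN hs hsp
  refine ⟨⟨gradient (Ulam N p s R lam), Truncation.memW_Ulam hp hpN hsp hR hlam, ?_⟩,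
    fun u hu hr hne => ?_⟩
  · rw [hC, Truncation.quotW_Ulam hp hpN hsp hR hlam]
  · rw [hC]
    exact BallModel.const_le_quotV hN hp hpN hs hsp hR hu hr hne
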